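/- arXiv:1112.3304 — 6 statements merged into one kernel-verified Lean document; each statement's English description precedes it below -/
import Mathlib

section
/- For every s with 1/3 ≤ s < 1, there exists an avoidance coupling of two s-lazy walkers on the looped three-vertex complete graph K_3^*. -/
open MeasureTheory ProbabilityTheory

/-- `X` is a faithful `s`-lazy walk on the looped complete graph `K_3^*`: at
each step it stays put with probability `s` and moves to each of the other two
vertices with probability `(1 - s)/2`. -/
def IsLazyWalk3 {Ω : Type} [MeasurableSpace Ω] (μ : Measure Ω) (s : ℝ)
    (X : ℕ → Ω → Fin 3) : Prop :=
  ∀ (t : ℕ) (v : ℕ → Fin 3),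
    μ {ω | ∀ u ≤ t + 1, X u ω = v u} =
      μ {ω | ∀ u ≤ t, X u ω = v u} *
        ENNReal.ofReal (if v (t + 1) = v t then s else (1 - s) / 2)

/-- The two walkers `X` (moving first in each round) and `Y` almost surely
never collide: for every `t`, `X t ≠ Y t` and `X (t+1) ≠ Y t`. -/
def AvoidsPairAE {Ω : Type} [MeasurableSpace Ω] (μ : Measure Ω)
    (X Y : ℕ → Ω → Fin 3) : Prop :=
  ∀ᵐ ω ∂μ, ∀ t : ℕ, X t ω ≠ Y t ω ∧ X (t + 1) ω ≠ Y t ω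

/-- The coupling of the two walkers `X, Y` (moving alternately in the order
`X 0, Y 0, X 1, Y 1, …`) is Markovian: there are transition rules `f, g` such
that conditionally on the history, `X (t+1)` is distributed as `f (X t, Y t)`
and `Y (t+1)` is distributed as `g (X (t+1), Y t)`. -/
def IsMarkovianPair {Ω : Type} [MeasurableSpace Ω] (μ : Measure Ω)
    (X Y : ℕ → Ω → Fin 3) : Prop :=
  ∃ f g : Fin 3 × Fin 3 → PMF (Fin 3),
    (∀ (t : ℕ) (v u : ℕ → Fin 3) (w : Fin 3),
      μ {ω | (∀ r ≤ t, X r ω = v r ∧ Y r ω = u r) ∧ X (t + 1) ω = w} =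
        μ {ω | ∀ r ≤ t, X r ω = v r ∧ Y r ω = u r} * f (v t, u t) w) ∧
    (∀ (t : ℕ) (v u : ℕ → Fin 3) (x w : Fin 3),
      μ {ω | ((∀ r ≤ t, X r ω = v r ∧ Y r ω = u r) ∧ X (t + 1) ω = x) ∧
             Y (t + 1) ω = w} =
        μ {ω | (∀ r ≤ t, X r ω = v r ∧ Y r ω = u r) ∧ X (t + 1) ω = x} *
          g (x, u t) w)

namespace K3Star

/-- Law of the innovation at time `n`: a fair coin at time `0`, afterwards the four joint moves. -/
noncomputable def wt (s : ℝ) (n : ℕ) (e : Fin 4) : ENNReal :=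
  if n = 0 then (if e = 0 ∨ e = 1 then 2⁻¹ else 0)
  else (if e = 0 then ENNReal.ofReal ((3 * s - 1) / 2) else ENNReal.ofReal ((1 - s) / 2))

theorem wt_sum (s : ℝ) (hs : 1 / 3 ≤ s) (hs1 : s < 1) (n : ℕ) : ∑ e, wt s n e = 1 := by
  by_cases hn : n = 0
  · simp [wt, hn, Fin.sum_univ_four, ENNReal.inv_two_add_inv_two]
  · simp only [wt, hn, Fin.sum_univ_four]
    simp only [if_false, if_true, show (1 : Fin 4) ≠ 0 by decide, show (2 : Fin 4) ≠ 0 by decide,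
      show (3 : Fin 4) ≠ 0 by decide]
    rw [← ENNReal.ofReal_add (by linarith) (by linarith),
      ← ENNReal.ofReal_add (by linarith) (by linarith),
      ← ENNReal.ofReal_add (by linarith) (by linarith), ← ENNReal.ofReal_one]
    congr 1; ring

noncomputable def law (s : ℝ) (hs : 1 / 3 ≤ s) (hs1 : s < 1) (n : ℕ) : Measure (Fin 4) :=
  (PMF.ofFintype (wt s n) (wt_sum s hs hs1 n)).toMeasure

instance (s : ℝ) (hs : 1 / 3 ≤ s) (hs1 : s < 1) (n : ℕ) :
    IsProbabilityMeasure (law s hs hs1 n) := by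
  unfold law; infer_instance

theorem law_singleton (s : ℝ) (hs : 1 / 3 ≤ s) (hs1 : s < 1) (n : ℕ) (e : Fin 4) :
    law s hs hs1 n {e} = wt s n e := by
  simp [law]

noncomputable def P (s : ℝ) (hs : 1 / 3 ≤ s) (hs1 : s < 1) : Measure (ℕ → Fin 4) :=
  Measure.infinitePi (law s hs hs1)

instance (s : ℝ) (hs : 1 / 3 ≤ s) (hs1 : s < 1) : IsProbabilityMeasure (P s hs hs1) := by
  unfold P; infer_instance

/-- The displacement from `X` to `Y`. -/
def dd (b : Bool) : Fin 3 := if b then 1 else 2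

/-- The joint update. -/
def F (σ : Fin 3 × Bool) (e : Fin 4) : Fin 3 × Bool :=
  if e = 0 then σ else if e = 1 then (σ.1, !σ.2)
  else if e = 2 then (σ.1 - dd σ.2, !σ.2) else (σ.1 - dd σ.2, σ.2)

def S : ℕ → (ℕ → Fin 4) → Fin 3 × Bool
  | 0, ω => (0, decide (ω 0 = 0))
  | t + 1, ω => F (S t ω) (ω (t + 1))

/-- Position of the second walker. -/
def yp (σ : Fin 3 × Bool) : Fin 3 := σ.1 + dd σ.2

theorem S_meas (t : ℕ) : Measurable (S t) := by
  induction t with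
  | zero =>
    exact (Measurable.of_discrete (f := fun e : Fin 4 => ((0 : Fin 3), decide (e = 0)))).comp
      (measurable_pi_apply 0)
  | succ t ih =>
    exact (Measurable.of_discrete (f := fun p : (Fin 3 × Bool) × Fin 4 => F p.1 p.2)).comp
      (ih.prodMk (measurable_pi_apply (t + 1)))

theorem S_congr (t : ℕ) (ω ω' : ℕ → Fin 4) (h : ∀ u ≤ t, ω u = ω' u) : S t ω = S t ω' := by
  induction t with
  | zero => simp [S, h 0 le_rfl]
  | succ t ih => simp only [S]; rw [ih fun u hu => h u (by omega), h (t + 1) le_rfl]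

theorem avoid_fin : ∀ (σ : Fin 3 × Bool), σ.1 ≠ yp σ := by decide
theorem avoid_fin2 : ∀ (σ : Fin 3 × Bool) (e : Fin 4), (F σ e).1 ≠ yp σ := by decide

/-- Events that depend on the first `t+1` innovations only. -/
def Past (t : ℕ) (B : (ℕ → Fin 4) → Prop) : Prop :=
  ∀ ω ω', (∀ u ≤ t, ω u = ω' u) → (B ω → B ω')

theorem key_one (s : ℝ) (hs : 1 / 3 ≤ s) (hs1 : s < 1) (t : ℕ) (B : (ℕ → Fin 4) → Prop)
    (hB : Past t B) (e : Fin 4) :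
    P s hs hs1 {ω | B ω ∧ ω (t + 1) = e} = P s hs hs1 {ω | B ω} * wt s (t + 1) e := by
  have hI : iIndepFun (fun (i : ℕ) (ω : ℕ → Fin 4) => ω i) (P s hs hs1) :=
    iIndepFun_infinitePi (P := law s hs hs1) (X := fun _ x => x) (fun i => measurable_id)
  have h2 := hI.indepFun_finset (Finset.Iic t) {t + 1} (by simp)
    (fun i => measurable_pi_apply i)
  rw [indepFun_iff_measure_inter_preimage_eq_mul] at h2
  have h3 := h2 {r | ∃ ω, B ω ∧ ∀ i : Finset.Iic t, ω i = r i}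
    {r | r ⟨t + 1, by simp⟩ = e} (Set.toFinite _).measurableSet (Set.toFinite _).measurableSet
  have e1 : (fun (ω : ℕ → Fin 4) (i : Finset.Iic t) => ω i) ⁻¹'
      {r | ∃ ω, B ω ∧ ∀ i : Finset.Iic t, ω i = r i} = {ω | B ω} := by
    ext ω
    constructor
    · rintro ⟨ω', h, h'⟩
      exact hB ω' ω (fun u hu => h' ⟨u, by simpa using hu⟩) h
    · intro h
      exact ⟨ω, h, fun _ => rfl⟩
  have e2 : P s hs hs1 {ω | ω (t + 1) = e} = wt s (t + 1) e := by
    have := Measure.infinitePi_map_eval (law s hs hs1) (t + 1)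
    rw [← law_singleton s hs hs1, ← this, Measure.map_apply (measurable_pi_apply _) (by simp)]
    rfl
  rw [e1] at h3
  rw [← e2]
  exact h3

theorem part {Ω α : Type} [MeasurableSpace Ω] [Fintype α] [DecidableEq α] [MeasurableSpace α]
    [MeasurableSingletonClass α] (μ : Measure Ω) (Z : Ω → α) (hZ : Measurable Z) (A : Ω → Prop) :
    μ {ω | A ω} = ∑ a, μ {ω | A ω ∧ Z ω = a} := by
  have := MeasureTheory.Measure.map_apply hZ (μ := μ.restrict {ω | A ω})
    (MeasurableSet.univ)
  have h1 : μ {ω | A ω} = (μ.restrict {ω | A ω}).map Z Set.univ := by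
    rw [this]; simp
  rw [h1, ← Finset.coe_univ, ← sum_measure_singleton]
  refine Finset.sum_congr rfl fun a _ => ?_
  rw [Measure.map_apply hZ (by simp), Measure.restrict_apply (hZ (by simp))]
  congr 1
  ext ω; simp [and_comm]

theorem key (s : ℝ) (hs : 1 / 3 ≤ s) (hs1 : s < 1) (t : ℕ) (B : (ℕ → Fin 4) → Prop)
    (hB : Past t B) (ψ : Fin 3 × Bool → Fin 4 → Prop) [∀ a b, Decidable (ψ a b)] :
    P s hs hs1 {ω | B ω ∧ ψ (S t ω) (ω (t + 1))} =
      ∑ σ, P s hs hs1 {ω | B ω ∧ S t ω = σ} *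
        ∑ e, if ψ σ e then wt s (t + 1) e else 0 := by
  rw [part _ (S t) (S_meas t)]
  refine Finset.sum_congr rfl fun σ _ => ?_
  rw [part _ (fun ω => ω (t + 1)) (measurable_pi_apply _), Finset.mul_sum]
  refine Finset.sum_congr rfl fun e _ => ?_
  split_ifs with h
  · rw [← key_one s hs hs1 t (fun ω => B ω ∧ S t ω = σ)]
    · congr 1; ext ω; simp only [Set.mem_ofPred_eq]
      constructor
      · rintro ⟨⟨⟨h1, -⟩, h2⟩, h3⟩; exact ⟨⟨h1, h2⟩, h3⟩
      · rintro ⟨⟨h1, h2⟩, h3⟩; exact ⟨⟨⟨h1, by rw [h2, h3]; exact h⟩, h2⟩, h3⟩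
    · rintro ω ω' h ⟨h1, h2⟩
      exact ⟨hB ω ω' h h1, by rw [← S_congr t ω ω' h, h2]⟩
  · rw [mul_zero]
    convert measure_empty (μ := P s hs hs1)
    ext ω; simp only [Set.mem_ofPred_eq, Set.mem_empty_iff_false, iff_false]
    rintro ⟨⟨⟨h1, h4⟩, h2⟩, h3⟩; rw [h2, h3] at h4; exact h h4

theorem past_hist (t : ℕ) (f : Fin 3 × Bool → Fin 3) (v : ℕ → Fin 3) :
    Past t (fun ω => ∀ u ≤ t, f (S u ω) = v u) := by
  intro ω ω' h h1 u hu
  rw [← S_congr u ω ω' fun w hw => h w (by omega)]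
  exact h1 u hu

theorem forall_succ (t : ℕ) (p : ℕ → Prop) : (∀ u ≤ t + 1, p u) ↔ (∀ u ≤ t, p u) ∧ p (t + 1) := by
  constructor
  · intro h; exact ⟨fun u hu => h u (by omega), h _ le_rfl⟩
  · rintro ⟨h1, h2⟩ u hu
    rcases Nat.lt_or_ge t u with h | h
    · obtain rfl : u = t + 1 := by omega
      exact h2
    · exact h1 u h

theorem add_w (s : ℝ) (hs : 1 / 3 ≤ s) (hs1 : s < 1) :
    ENNReal.ofReal ((3 * s - 1) / 2) + ENNReal.ofReal ((1 - s) / 2) = ENNReal.ofReal s := by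
  rw [← ENNReal.ofReal_add (by linarith) (by linarith)]; congr 1; ring

theorem yker (s : ℝ) (hs : 1 / 3 ≤ s) (hs1 : s < 1) (t : ℕ) (σ : Fin 3 × Bool) (w : Fin 3) :
    (∑ e, if yp (F σ e) = w then wt s (t + 1) e else 0) =
      ENNReal.ofReal (if w = yp σ then s else (1 - s) / 2) := by
  obtain ⟨x, b⟩ := σ
  have h := add_w s hs hs1
  fin_cases x <;> cases b <;> fin_cases w <;>
    simp [Fin.sum_univ_four, F, yp, dd, wt, h, show (-1 : Fin 3) = 2 from rfl, show (-2 : Fin 3) = 1 from rfl,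
      show (2 : Fin 3) + 1 = 0 from rfl, show (1 : Fin 3) + 2 = 0 from rfl,
      show (1 : Fin 3) + 1 = 2 from rfl, show (2 : Fin 3) + 2 = 1 from rfl]

theorem ywalk (s : ℝ) (hs : 1 / 3 ≤ s) (hs1 : s < 1) :
    IsLazyWalk3 (P s hs hs1) s (fun t ω => yp (S t ω)) := by
  intro t v
  have h := key s hs hs1 t _ (past_hist t yp v) (fun σ e => yp (F σ e) = v (t + 1))
  simp only [forall_succ]
  refine h.trans ?_
  rw [part _ (S t) (S_meas t) (fun ω => ∀ u ≤ t, yp (S u ω) = v u), Finset.sum_mul]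
  refine Finset.sum_congr rfl fun σ _ => ?_
  by_cases hσ : yp σ = v t
  · rw [yker s hs hs1, hσ]
  · have : {ω | (∀ u ≤ t, yp (S u ω) = v u) ∧ S t ω = σ} = ∅ := by
      ext ω; simp only [Set.mem_ofPred_eq, Set.mem_empty_iff_false, iff_false]
      rintro ⟨h1, h2⟩; exact hσ (h2 ▸ h1 t le_rfl)
    rw [this]; simp

theorem xrec (s : ℝ) (hs : 1 / 3 ≤ s) (hs1 : s < 1) (t : ℕ) (v : ℕ → Fin 3) (β : Bool) :
    P s hs hs1 {ω | (∀ u ≤ t + 1, (S u ω).1 = v u) ∧ (S (t + 1) ω).2 = β} =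
      ∑ δ : Bool, P s hs hs1 {ω | (∀ u ≤ t, (S u ω).1 = v u) ∧ (S t ω).2 = δ} *
        ∑ e, if F (v t, δ) e = (v (t + 1), β) then wt s (t + 1) e else 0 := by
  have h := key s hs hs1 t _ (past_hist t Prod.fst v) (fun σ e => F σ e = (v (t + 1), β))
  have e1 : {ω | (∀ u ≤ t + 1, (S u ω).1 = v u) ∧ (S (t + 1) ω).2 = β} =
      {ω | (∀ u ≤ t, (S u ω).1 = v u) ∧ F (S t ω) (ω (t + 1)) = (v (t + 1), β)} := by
    ext ω
    simp only [Set.mem_ofPred_eq, forall_succ, S, Prod.ext_iff, and_assoc]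
  rw [e1, h, Fintype.sum_prod_type, Finset.sum_eq_single (v t)]
  · refine Finset.sum_congr rfl fun δ _ => ?_
    congr 2
    ext ω
    simp only [Set.mem_ofPred_eq, Prod.ext_iff]
    constructor
    · rintro ⟨h1, -, h3⟩; exact ⟨h1, h3⟩
    · rintro ⟨h1, h3⟩; exact ⟨h1, h1 t le_rfl, h3⟩
  · intro x _ hx
    refine Finset.sum_eq_zero fun δ _ => ?_
    have : {ω | (∀ u ≤ t, (S u ω).1 = v u) ∧ S t ω = (x, δ)} = ∅ := by
      ext ω; simp only [Set.mem_ofPred_eq, Set.mem_empty_iff_false, iff_false]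
      rintro ⟨h1, h2⟩; exact hx (by rw [← h1 t le_rfl, h2])
    rw [this]; simp
  · simp

theorem xker (s : ℝ) (hs : 1 / 3 ≤ s) (hs1 : s < 1) (t : ℕ) (x w : Fin 3) (β : Bool)
    (a : ENNReal) :
    (∑ δ : Bool, a * ∑ e, if F (x, δ) e = (w, β) then wt s (t + 1) e else 0) =
      a * ENNReal.ofReal (if w = x then s else (1 - s) / 2) := by
  have h := add_w s hs hs1
  have h' := h
  rw [add_comm] at h'
  rw [← Finset.mul_sum]
  congr 1
  fin_cases x <;> cases β <;> fin_cases w <;>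
    simp [Fin.sum_univ_four, F, dd, wt, h, h', show (-1 : Fin 3) = 2 from rfl, show (-2 : Fin 3) = 1 from rfl,
      show (2 : Fin 3) + 1 = 0 from rfl, show (1 : Fin 3) + 2 = 0 from rfl,
      show (1 : Fin 3) + 1 = 2 from rfl, show (2 : Fin 3) + 2 = 1 from rfl]

theorem xsym (s : ℝ) (hs : 1 / 3 ≤ s) (hs1 : s < 1) (v : ℕ → Fin 3) (t : ℕ) : ∀ β : Bool,
    P s hs hs1 {ω | (∀ u ≤ t, (S u ω).1 = v u) ∧ (S t ω).2 = β} =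
      P s hs hs1 {ω | (∀ u ≤ t, (S u ω).1 = v u) ∧ (S t ω).2 = true} := by
  induction t with
  | zero =>
    have hc : ∀ e : Fin 4, P s hs hs1 {ω | ω 0 = e} = wt s 0 e := by
      intro e
      have := Measure.infinitePi_map_eval (law s hs hs1) 0
      rw [← law_singleton s hs hs1, ← this, Measure.map_apply (measurable_pi_apply _) (by simp)]
      rfl
    have hb : ∀ β, P s hs hs1 {ω | (S 0 ω).2 = β} = 2⁻¹ := by
      intro β
      rw [part _ (fun ω => ω 0) (measurable_pi_apply _)]
      have : ∀ e : Fin 4, P s hs hs1 {ω | (S 0 ω).2 = β ∧ ω 0 = e} =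
          if decide (e = 0) = β then wt s 0 e else 0 := by
        intro e
        split_ifs with h
        · rw [← hc]; congr 1; ext ω
          simp only [S, Set.mem_ofPred_eq]
          constructor
          · exact fun h => h.2
          · intro h2; exact ⟨by rw [h2]; exact h, h2⟩
        · convert measure_empty (μ := P s hs hs1)
          ext ω; simp only [S, Set.mem_ofPred_eq, Set.mem_empty_iff_false, iff_false]
          rintro ⟨h1, h2⟩; rw [h2] at h1; exact h h1
      simp only [this]
      cases β <;> simp [Fin.sum_univ_four, wt]
    intro β
    by_cases h0 : v 0 = 0
    · have : ∀ β, {ω | (∀ u ≤ 0, (S u ω).1 = v u) ∧ (S 0 ω).2 = β} = {ω | (S 0 ω).2 = β} := by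
        intro β; ext ω; simp [S, h0]
      rw [this, this, hb, hb]
    · have : ∀ β, {ω | (∀ u ≤ 0, (S u ω).1 = v u) ∧ (S 0 ω).2 = β} = ∅ := by
        intro β; ext ω; simp [S, Ne.symm h0]
      rw [this, this]
  | succ t ih =>
    intro β
    rw [xrec, xrec]
    simp only [ih]
    rw [xker s hs hs1, xker s hs hs1]

theorem xwalk (s : ℝ) (hs : 1 / 3 ≤ s) (hs1 : s < 1) :
    IsLazyWalk3 (P s hs hs1) s (fun t ω => (S t ω).1) := by
  intro t v
  rw [part _ (fun ω => (S (t + 1) ω).2) (measurable_snd.comp (S_meas (t + 1))),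
    part _ (fun ω => (S t ω).2) (measurable_snd.comp (S_meas t)), Finset.sum_mul]
  refine Finset.sum_congr rfl fun β _ => ?_
  rw [xrec]
  simp only [xsym s hs hs1 v t]
  rw [xker s hs hs1]

end K3Star

/-- For every `s` with `1/3 ≤ s < 1`, there exists an avoidance coupling of
two `s`-lazy walkers on the looped three-vertex complete graph `K_3^*`. -/
theorem exists_avoidance_coupling_K3star (s : ℝ) (hs : 1 / 3 ≤ s) (hs1 : s < 1) :
    ∃ (Ω : Type) (_ : MeasurableSpace Ω) (μ : Measure Ω) (X Y : ℕ → Ω → Fin 3),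
      IsProbabilityMeasure μ ∧ (∀ t, Measurable (X t)) ∧ (∀ t, Measurable (Y t)) ∧
      IsLazyWalk3 μ s X ∧ IsLazyWalk3 μ s Y ∧ AvoidsPairAE μ X Y := by
  refine ⟨ℕ → Fin 4, inferInstance, K3Star.P s hs hs1, fun t ω => (K3Star.S t ω).1,
    fun t ω => K3Star.yp (K3Star.S t ω), inferInstance, fun t => ?_, fun t => ?_,
    K3Star.xwalk s hs hs1, K3Star.ywalk s hs hs1, ?_⟩
  · exact measurable_fst.comp (K3Star.S_meas t)
  · exact (Measurable.of_discrete (f := K3Star.yp)).comp (K3Star.S_meas t)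
  · exact Filter.Eventually.of_forall fun ω t =>
      ⟨K3Star.avoid_fin _, K3Star.avoid_fin2 _ _⟩
end

section
/- For every s with 1/2 ≤ s < 1, there exists a Markovian avoidance coupling of two s-lazy walkers on the looped three-vertex complete graph K_3^*. -/
open MeasureTheory ProbabilityTheory

/-- The chirality sign of a bit: `+1` or `-1` modulo `3`. -/
def chi (b : Bool) : Fin 3 := cond b 1 2

/-- Position of the first walker, driven by the bits `ω`. -/
def walkX : ℕ → (ℕ → Bool) → Fin 3
  | 0, _ => 0
  | t + 1, ω => walkX t ω + chi (ω (2 * t)) - chi (ω (2 * t + 1))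

/-- Position of the second walker, driven by the bits `ω`. -/
def walkY (t : ℕ) (ω : ℕ → Bool) : Fin 3 := walkX t ω + chi (ω (2 * t))

/-- The set `A` is determined by the first `n` bits. -/
def DetBy (n : ℕ) (A : Set (ℕ → Bool)) : Prop :=
  ∀ ω ω' : ℕ → Bool, (∀ i < n, ω i = ω' i) → ω ∈ A → ω' ∈ A

lemma walkX_congr (t : ℕ) (ω ω' : ℕ → Bool) (h : ∀ i < 2 * t, ω i = ω' i) :
    walkX t ω = walkX t ω' := by
  induction t with
  | zero => rfl
  | succ t ih =>
    simp only [walkX]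
    rw [ih (fun i hi => h i (by omega)), h (2 * t) (by omega), h (2 * t + 1) (by omega)]

lemma walkY_congr (t : ℕ) (ω ω' : ℕ → Bool) (h : ∀ i < 2 * t + 1, ω i = ω' i) :
    walkY t ω = walkY t ω' := by
  simp only [walkY]
  rw [walkX_congr t ω ω' (fun i hi => h i (by omega)), h (2 * t) (by omega)]

lemma measurable_walkX (t : ℕ) : Measurable (walkX t) := by
  induction t with
  | zero => exact measurable_const
  | succ t ih =>
    have h : Measurable (fun q : Fin 3 × Bool × Bool => q.1 + chi q.2.1 - chi q.2.2) :=
      measurable_of_countable _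
    exact h.comp (ih.prodMk ((measurable_pi_apply (2 * t)).prodMk
      (measurable_pi_apply (2 * t + 1))))

lemma measurable_walkY (t : ℕ) : Measurable (walkY t) := by
  have h : Measurable (fun q : Fin 3 × Bool => q.1 + chi q.2) := measurable_of_countable _
  exact h.comp ((measurable_walkX t).prodMk (measurable_pi_apply (2 * t)))

/-- Law of infinitely many independent bits. -/
noncomputable def bitLaw (P : PMF Bool) : Measure (ℕ → Bool) :=
  Measure.infinitePi (fun _ : ℕ => P.toMeasure)

instance (P : PMF Bool) : IsProbabilityMeasure (bitLaw P) := by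
  unfold bitLaw; infer_instance

lemma bitLaw_step (P : PMF Bool) (n : ℕ) (A : Set (ℕ → Bool)) (hA : DetBy n A) (S : Set Bool) :
    bitLaw P {ω | ω ∈ A ∧ ω n ∈ S} = bitLaw P A * P.toMeasure S := by
  have hind : iIndepFun (fun (i : ℕ) (ω : ℕ → Bool) => ω i) (bitLaw P) :=
    iIndepFun_infinitePi (X := fun _ b => b) (fun _ => measurable_id)
  have h2 := hind.indepFun_finset (Finset.range n) {n} (by simp)
    (fun i => measurable_pi_apply i)
  have hAeq : (fun (a : ℕ → Bool) (i : Finset.range n) => a i) ⁻¹'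
      ((fun (a : ℕ → Bool) (i : Finset.range n) => a i) '' A) = A := by
    ext ω
    constructor
    · rintro ⟨ω', h', he⟩
      exact hA ω' ω (fun i hi => congrFun he ⟨i, Finset.mem_range.2 hi⟩) h'
    · intro h
      exact ⟨ω, h, rfl⟩
  have h3 := h2.measure_inter_preimage_eq_mul
    ((fun (a : ℕ → Bool) (i : Finset.range n) => a i) '' A)
    {q | q ⟨n, by simp⟩ ∈ S} (Set.toFinite _).measurableSet (Set.toFinite _).measurableSet
  rw [hAeq] at h3
  have h4 : bitLaw P ((fun ω : ℕ → Bool => ω n) ⁻¹' S) = P.toMeasure S :=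
    (measurePreserving_eval_infinitePi (fun _ : ℕ => P.toMeasure) n).measure_preimage
      (Set.toFinite S).measurableSet.nullMeasurableSet
  rw [← h4]
  exact h3

lemma bitLaw_two (P : PMF Bool) (n : ℕ) (A : Set (ℕ → Bool)) (hA : DetBy n A) (b c : Bool) :
    bitLaw P {ω | ω ∈ A ∧ ω n = b ∧ ω (n + 1) = c} = bitLaw P A * (P b * P c) := by
  have hB : DetBy (n + 1) {ω | ω ∈ A ∧ ω n ∈ ({b} : Set Bool)} := by
    rintro ω ω' h ⟨h1, h2⟩
    exact ⟨hA ω ω' (fun i hi => h i (by omega)) h1, by rw [← h n (by omega)]; exact h2⟩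
  have h1 := bitLaw_step P (n + 1) _ hB {c}
  rw [bitLaw_step P n A hA {b}, P.toMeasure_apply_singleton _ (measurableSet_singleton _),
    P.toMeasure_apply_singleton _ (measurableSet_singleton _), mul_assoc] at h1
  rw [← h1]
  congr 1
  ext ω
  simp [and_assoc]

lemma DetBy.measurableSet {n : ℕ} {A : Set (ℕ → Bool)} (hA : DetBy n A) : MeasurableSet A := by
  have hAeq : (fun (a : ℕ → Bool) (i : Finset.range n) => a i) ⁻¹'
      ((fun (a : ℕ → Bool) (i : Finset.range n) => a i) '' A) = A := by
    ext ω
    constructor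
    · rintro ⟨ω', h', he⟩
      exact hA ω' ω (fun i hi => congrFun he ⟨i, Finset.mem_range.2 hi⟩) h'
    · intro h
      exact ⟨ω, h, rfl⟩
  rw [← hAeq]
  exact measurableSet_preimage (by fun_prop) (Set.toFinite _).measurableSet

lemma bitLaw_diff (P : PMF Bool) (s : ℝ)
    (h0 : P true * P true + P false * P false = ENNReal.ofReal s)
    (h1 : P true * P false = ENNReal.ofReal ((1 - s) / 2))
    (n : ℕ) (A : Set (ℕ → Bool)) (hA : DetBy n A) (d : Fin 3) :
    bitLaw P {ω | ω ∈ A ∧ chi (ω n) - chi (ω (n + 1)) = d} =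
      bitLaw P A * ENNReal.ofReal (if d = 0 then s else (1 - s) / 2) := by
  have key : ∀ b c : Bool, chi b - chi c = 0 ↔ b = c := by decide
  have key1 : ∀ b c : Bool, chi b - chi c = 1 ↔ b = false ∧ c = true := by decide
  have key2 : ∀ b c : Bool, chi b - chi c = 2 ↔ b = true ∧ c = false := by decide
  have hd : d = 0 ∨ d = 1 ∨ d = 2 := by revert d; decide
  rcases hd with rfl | rfl | rfl
  · have hu : {ω : ℕ → Bool | ω ∈ A ∧ chi (ω n) - chi (ω (n + 1)) = 0} =
        {ω | ω ∈ A ∧ ω n = true ∧ ω (n + 1) = true} ∪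
        {ω | ω ∈ A ∧ ω n = false ∧ ω (n + 1) = false} := by
      ext ω
      simp only [Set.mem_ofPred_eq, Set.mem_union, key]
      cases ω n <;> cases ω (n + 1) <;> simp
    rw [hu, measure_union, bitLaw_two P n A hA, bitLaw_two P n A hA, ← mul_add, h0, if_pos rfl]
    · rw [Set.disjoint_left]
      rintro ω ⟨_, h, _⟩ ⟨_, h', _⟩
      rw [h] at h'
      exact absurd h' (by decide)
    · apply DetBy.measurableSet (n := n + 2)
      rintro ω ω' h ⟨h1, h2, h3⟩
      exact ⟨hA ω ω' (fun i hi => h i (by omega)) h1, by rw [← h n (by omega)]; exact h2,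
        by rw [← h (n + 1) (by omega)]; exact h3⟩
  · simp only [key1]
    rw [bitLaw_two P n A hA, if_neg (by decide), ← h1, mul_comm (P false)]
  · simp only [key2]
    rw [bitLaw_two P n A hA, if_neg (by decide), ← h1]

lemma exists_bit (s : ℝ) (hs : 1 / 2 ≤ s) (hs1 : s < 1) : ∃ P : PMF Bool,
    P true * P true + P false * P false = ENNReal.ofReal s ∧
    P true * P false = ENNReal.ofReal ((1 - s) / 2) := by
  set r := Real.sqrt (2 * s - 1) with hr
  have hr0 : 0 ≤ r := Real.sqrt_nonneg _
  have hr2 : r * r = 2 * s - 1 := Real.mul_self_sqrt (by linarith)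
  have hr1 : r ≤ 1 := by nlinarith
  have ha : 0 ≤ (1 + r) / 2 := by linarith
  have hb : 0 ≤ (1 - r) / 2 := by linarith
  refine ⟨PMF.ofFintype
    (fun b => cond b (ENNReal.ofReal ((1 + r) / 2)) (ENNReal.ofReal ((1 - r) / 2))) ?_, ?_, ?_⟩
  · rw [Fintype.sum_bool]
    simp only [cond_true, cond_false]
    rw [← ENNReal.ofReal_add ha hb, ← ENNReal.ofReal_one]
    congr 1
    ring
  · simp only [PMF.ofFintype_apply, cond_true, cond_false]
    rw [← ENNReal.ofReal_mul ha, ← ENNReal.ofReal_mul hb,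
      ← ENNReal.ofReal_add (by positivity) (by positivity)]
    congr 1
    linarith
  · simp only [PMF.ofFintype_apply, cond_true, cond_false]
    rw [← ENNReal.ofReal_mul ha]
    congr 1
    linarith

lemma detBy_X (t : ℕ) (v : ℕ → Fin 3) : DetBy (2 * t) {ω | ∀ u ≤ t, walkX u ω = v u} := by
  intro ω ω' h hω u hu
  rw [← walkX_congr u ω ω' (fun i hi => h i (by omega))]
  exact hω u hu

lemma detBy_Y (t : ℕ) (v : ℕ → Fin 3) : DetBy (2 * t + 1) {ω | ∀ u ≤ t, walkY u ω = v u} := by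
  intro ω ω' h hω u hu
  rw [← walkY_congr u ω ω' (fun i hi => h i (by omega))]
  exact hω u hu

lemma detBy_XY (t : ℕ) (v u : ℕ → Fin 3) :
    DetBy (2 * t + 1) {ω | ∀ r ≤ t, walkX r ω = v r ∧ walkY r ω = u r} := by
  intro ω ω' h hω r hr
  rw [← walkY_congr r ω ω' (fun i hi => h i (by omega)),
    ← walkX_congr r ω ω' (fun i hi => h i (by omega))]
  exact hω r hr

lemma detBy_XYX (t : ℕ) (v u : ℕ → Fin 3) (x : Fin 3) :
    DetBy (2 * t + 2)
      {ω | (∀ r ≤ t, walkX r ω = v r ∧ walkY r ω = u r) ∧ walkX (t + 1) ω = x} := by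
  rintro ω ω' h ⟨hω, hx⟩
  refine ⟨detBy_XY t v u ω ω' (fun i hi => h i (by omega)) hω, ?_⟩
  rw [← walkX_congr (t + 1) ω ω' (fun i hi => h i (by omega))]
  exact hx

lemma map_apply_eq (P : PMF Bool) (f : Bool → Fin 3) (w : Fin 3) :
    P.toMeasure {b | f b = w} = P.map f w := by
  rw [← (P.map f).toMeasure_apply_singleton w (measurableSet_singleton _),
    PMF.toMeasure_map_apply f P _ (measurable_of_countable _) (measurableSet_singleton _)]
  rfl

/-- For every `s` with `1/2 ≤ s < 1`, there exists a Markovian avoidance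
coupling of two `s`-lazy walkers on the looped three-vertex complete graph
`K_3^*`. -/
theorem exists_markovian_avoidance_coupling_K3star (s : ℝ) (hs : 1 / 2 ≤ s)
    (hs1 : s < 1) :
    ∃ (Ω : Type) (_ : MeasurableSpace Ω) (μ : Measure Ω) (X Y : ℕ → Ω → Fin 3),
      IsProbabilityMeasure μ ∧ (∀ t, Measurable (X t)) ∧ (∀ t, Measurable (Y t)) ∧
      IsLazyWalk3 μ s X ∧ IsLazyWalk3 μ s Y ∧ AvoidsPairAE μ X Y ∧
      IsMarkovianPair μ X Y := by
  obtain ⟨P, h0, h1⟩ := exists_bit s hs hs1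
  refine ⟨ℕ → Bool, inferInstance, bitLaw P, walkX, walkY, inferInstance, measurable_walkX,
    measurable_walkY, ?_, ?_, ?_, ?_⟩
  · intro t v
    have hc : ∀ a b x y : Fin 3, a + x - y = b ↔ x - y = b - a := by decide
    have hz : ∀ a b : Fin 3, b - a = 0 ↔ b = a := by decide
    have h := bitLaw_diff P s h0 h1 (2 * t) _ (detBy_X t v) (v (t + 1) - v t)
    simp only [hz] at h
    rw [← h]
    congr 1
    ext ω
    simp only [Set.mem_ofPred_eq]
    constructor
    · intro H
      refine ⟨fun u hu => H u (by omega), ?_⟩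
      rw [← hc, ← H t (by omega)]
      exact H (t + 1) le_rfl
    · rintro ⟨H, H'⟩ u hu
      rcases Nat.lt_or_ge u (t + 1) with h | h
      · exact H u (by omega)
      · obtain rfl : u = t + 1 := by omega
        rw [← hc, ← H t le_rfl] at H'
        exact H'
  · intro t v
    have hc : ∀ a b x y : Fin 3, a - x + y = b ↔ x - y = a - b := by decide
    have hz : ∀ a b : Fin 3, a - b = 0 ↔ b = a := by decide
    have hy : ∀ ω, walkY (t + 1) ω = walkY t ω - chi (ω (2 * t + 1)) + chi (ω (2 * t + 1 + 1)) :=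
      fun ω => rfl
    have h := bitLaw_diff P s h0 h1 (2 * t + 1) _ (detBy_Y t v) (v t - v (t + 1))
    simp only [hz] at h
    rw [← h]
    congr 1
    ext ω
    simp only [Set.mem_ofPred_eq]
    constructor
    · intro H
      refine ⟨fun u hu => H u (by omega), ?_⟩
      rw [← hc, ← H t (by omega), ← hy]
      exact H (t + 1) le_rfl
    · rintro ⟨H, H'⟩ u hu
      rcases Nat.lt_or_ge u (t + 1) with h | h
      · exact H u (by omega)
      · obtain rfl : u = t + 1 := by omega
        rw [← hc, ← H t le_rfl, ← hy] at H'
        exact H'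
  · refine Filter.Eventually.of_forall fun ω t => ?_
    have ha : ∀ (a : Fin 3) (b : Bool), a ≠ a + chi b := by decide
    have hb : ∀ (a : Fin 3) (b : Bool), a - chi b ≠ a := by decide
    exact ⟨ha _ _, hb _ _⟩
  · refine ⟨fun q => P.map (fun b => q.2 - chi b), fun q => P.map (fun b => q.1 + chi b), ?_, ?_⟩
    · intro t v u w
      rw [← map_apply_eq, ← bitLaw_step P (2 * t + 1) _ (detBy_XY t v u)]
      congr 1
      ext ω
      simp only [Set.mem_ofPred_eq]
      refine and_congr_right fun H => ?_
      rw [← (H t le_rfl).2]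
      rfl
    · intro t v u x w
      rw [← map_apply_eq, ← bitLaw_step P (2 * t + 2) _ (detBy_XYX t v u x)]
      congr 1
      ext ω
      simp only [Set.mem_ofPred_eq]
      refine and_congr_right fun H => ?_
      rw [← H.2]
      rfl
end

section
/- For every composite n = a·b with integers a > 1 and b > 1, there exists a Markovian avoidance coupling of two walkers on the (loopless) complete graph K_n. -/
open MeasureTheory ProbabilityTheory

/-- `X` is a faithful simple random walk on the loopless complete graph `K_n`:
at each step the walker moves to a uniformly random vertex other than its
current one. -/
def IsWalkLoopless {Ω : Type} [MeasurableSpace Ω] (μ : Measure Ω) {n : ℕ}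
    (X : ℕ → Ω → Fin n) : Prop :=
  ∀ (t : ℕ) (v : ℕ → Fin n),
    μ {ω | ∀ s ≤ t + 1, X s ω = v s} =
      μ {ω | ∀ s ≤ t, X s ω = v s} *
        (if v (t + 1) = v t then 0 else ((n - 1 : ℕ) : ENNReal)⁻¹)

/-- `X` is a faithful simple random walk on the looped complete graph `K_n^*`:
at each step the walker moves to a uniformly random vertex (possibly its
current one). -/
def IsWalkLooped {Ω : Type} [MeasurableSpace Ω] (μ : Measure Ω) {n : ℕ}
    (X : ℕ → Ω → Fin n) : Prop :=
  ∀ (t : ℕ) (v : ℕ → Fin n),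
    μ {ω | ∀ s ≤ t + 1, X s ω = v s} =
      μ {ω | ∀ s ≤ t, X s ω = v s} * ((n : ℕ) : ENNReal)⁻¹

/-- The `k` walkers `X 0, …, X (k-1)`, moving in turn in cyclic order, almost
surely never collide: initially their positions are pairwise distinct, and
whenever a walker moves it never lands on the current position of another
walker (walkers `i < j` having already made their move number `t+1`, walkers
`i > j` still sitting at their position at time `t`). -/
def AvoidsAE {Ω : Type} [MeasurableSpace Ω] (μ : Measure Ω) {n k : ℕ}
    (X : Fin k → ℕ → Ω → Fin n) : Prop :=
  ∀ᵐ ω ∂μ,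
    (∀ i j : Fin k, i ≠ j → X i 0 ω ≠ X j 0 ω) ∧
    (∀ (t : ℕ) (i j : Fin k),
      (i < j → X j (t + 1) ω ≠ X i (t + 1) ω) ∧
      (j < i → X j (t + 1) ω ≠ X i t ω))

/-- The coupling is Markovian: there are transition rules `f j` so that for
every walker `j` and time `t`, conditionally on the whole history (all
positions up to time `t`, together with the moves at time `t+1` of the walkers
`i < j` preceding `j` in the current round), the next position `X j (t+1)` is
distributed according to `f j` applied to the current configuration. -/
def IsMarkovianCoupling {Ω : Type} [MeasurableSpace Ω] (μ : Measure Ω) {n k : ℕ}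
    (X : Fin k → ℕ → Ω → Fin n) : Prop :=
  ∃ f : Fin k → (Fin k → Fin n) → PMF (Fin n),
    ∀ (t : ℕ) (j : Fin k) (v : Fin k → ℕ → Fin n) (w : Fin n),
      μ {ω | ((∀ i : Fin k, ∀ s ≤ t, X i s ω = v i s) ∧
              (∀ i < j, X i (t + 1) ω = v i (t + 1))) ∧ X j (t + 1) ω = w} =
        μ {ω | (∀ i : Fin k, ∀ s ≤ t, X i s ω = v i s) ∧
               (∀ i < j, X i (t + 1) ω = v i (t + 1))} *
          f j (fun i => if i < j then v i (t + 1) else v i t) w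

/-- There is an avoidance coupling of `k` walkers on the loopless complete
graph `K_n`. -/
def AvoidanceCouplingLoopless (n k : ℕ) : Prop :=
  ∃ (Ω : Type) (_ : MeasurableSpace Ω) (μ : Measure Ω)
    (X : Fin k → ℕ → Ω → Fin n),
      IsProbabilityMeasure μ ∧ (∀ j t, Measurable (X j t)) ∧
      (∀ j, IsWalkLoopless μ (X j)) ∧ AvoidsAE μ X

/-- There is an avoidance coupling of `k` walkers on the looped complete
graph `K_n^*`. -/
def AvoidanceCouplingLooped (n k : ℕ) : Prop :=
  ∃ (Ω : Type) (_ : MeasurableSpace Ω) (μ : Measure Ω)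
    (X : Fin k → ℕ → Ω → Fin n),
      IsProbabilityMeasure μ ∧ (∀ j t, Measurable (X j t)) ∧
      (∀ j, IsWalkLooped μ (X j)) ∧ AvoidsAE μ X

/-- There is a Markovian avoidance coupling of `k` walkers on `K_n`. -/
def MarkovianAvoidanceCouplingLoopless (n k : ℕ) : Prop :=
  ∃ (Ω : Type) (_ : MeasurableSpace Ω) (μ : Measure Ω)
    (X : Fin k → ℕ → Ω → Fin n),
      IsProbabilityMeasure μ ∧ (∀ j t, Measurable (X j t)) ∧
      (∀ j, IsWalkLoopless μ (X j)) ∧ AvoidsAE μ X ∧ IsMarkovianCoupling μ X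

/-- There is a Markovian avoidance coupling of `k` walkers on `K_n^*`. -/
def MarkovianAvoidanceCouplingLooped (n k : ℕ) : Prop :=
  ∃ (Ω : Type) (_ : MeasurableSpace Ω) (μ : Measure Ω)
    (X : Fin k → ℕ → Ω → Fin n),
      IsProbabilityMeasure μ ∧ (∀ j t, Measurable (X j t)) ∧
      (∀ j, IsWalkLooped μ (X j)) ∧ AvoidsAE μ X ∧ IsMarkovianCoupling μ X

/-- Trajectory of a second-order chain driven by a table of independent choices. -/
def chainTraj {V : Type} (v0 : V) (ω : ℕ × V × V → V) : ℕ → V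
  | 0 => v0
  | 1 => v0
  | (i + 2) => ω (i, chainTraj v0 ω i, chainTraj v0 ω (i + 1))

lemma exists_chain {V : Type} [Fintype V] [DecidableEq V] [MeasurableSpace V]
    [MeasurableSingletonClass V] (v0 : V) (f : ℕ → V → V → PMF V) :
    ∃ (Ω : Type) (_ : MeasurableSpace Ω) (μ : Measure Ω) (W : ℕ → Ω → V),
      IsProbabilityMeasure μ ∧ (∀ i, Measurable (W i)) ∧
      (∀ ω, W 0 ω = v0 ∧ W 1 ω = v0) ∧
      ∀ (m : ℕ) (E : Set Ω) (p q r : V),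
        (∀ ω ω', (∀ i ≤ m + 1, W i ω = W i ω') → ω ∈ E → ω' ∈ E) →
        (∀ ω ∈ E, W m ω = p ∧ W (m + 1) ω = q) →
        μ (E ∩ {ω | W (m + 2) ω = r}) = μ E * f m p q r := by
  let μ : Measure (ℕ × V × V → V) := Measure.infinitePi (fun i => (f i.1 i.2.1 i.2.2).toMeasure)
  let mm : ℕ × V × V → MeasurableSpace (ℕ × V × V → V) :=
    fun i => MeasurableSpace.comap (fun ω => ω i) inferInstance
  let F : ℕ → MeasurableSpace (ℕ × V × V → V) := fun m => ⨆ i ∈ {i : ℕ × V × V | i.1 < m}, mm i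
  have hmm : ∀ i, mm i ≤ MeasurableSpace.pi := fun i => (measurable_pi_apply i).comap_le
  have hF : ∀ m, F m ≤ MeasurableSpace.pi := fun m => iSup₂_le fun i _ => hmm i
  have hcoord : ∀ m i (r : V), i.1 < m → MeasurableSet[F m] {ω : ℕ × V × V → V | ω i = r} := by
    intro m i r hi
    have h1 : mm i ≤ F m := le_iSup₂_of_le i hi le_rfl
    exact h1 _ ⟨{r}, measurableSet_singleton r, rfl⟩
  have hWF : ∀ i m, i ≤ m + 1 → ∀ r : V,
      MeasurableSet[F m] {ω : ℕ × V × V → V | chainTraj v0 ω i = r} := by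
    intro i
    induction i using Nat.strong_induction_on with
    | _ i ih =>
      intro m him r
      match i, ih, him with
      | 0, _, _ => simp only [chainTraj]; exact @MeasurableSet.const _ (F m) _
      | 1, _, _ => simp only [chainTraj]; exact @MeasurableSet.const _ (F m) _
      | i + 2, ih, him =>
        have : {ω : ℕ × V × V → V | chainTraj v0 ω (i + 2) = r} =
            ⋃ p : V, ⋃ q : V, ({ω | chainTraj v0 ω i = p} ∩ {ω | chainTraj v0 ω (i + 1) = q} ∩
              {ω | ω (i, p, q) = r}) := by
          ext ω; simp [chainTraj]
        rw [this]
        refine @MeasurableSet.iUnion _ _ (F m) _ _ fun p => @MeasurableSet.iUnion _ _ (F m) _ _ fun q => ?_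
        exact @MeasurableSet.inter _ (F m) _ _ (@MeasurableSet.inter _ (F m) _ _
          (ih i (by omega) m (by omega) p) (ih (i+1) (by omega) m (by omega) q))
          (hcoord m _ r (by simp; omega))
  have hind : iIndepFun (fun (i : ℕ × V × V) (ω : ℕ × V × V → V) => ω i) μ :=
    iIndepFun_infinitePi (P := fun i : ℕ × V × V => (f i.1 i.2.1 i.2.2).toMeasure)
      (X := fun _ ω => ω) (fun i => measurable_id)
  refine ⟨ℕ × V × V → V, inferInstance, μ, fun i ω => chainTraj v0 ω i, inferInstance, ?_, ?_, ?_⟩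
  · intro i
    refine measurable_to_countable' fun r => hF i _ (hWF i i (by omega) r)
  · intro ω; simp [chainTraj]
  · intro m E p q r hE hpq
    simp only at hpq hE
    have hEm : MeasurableSet[F m] E := by
      have : E = ⋃ z ∈ ((fun ω (i : Fin (m + 2)) => chainTraj v0 ω i) '' E),
          ⋂ i : Fin (m + 2), {ω | chainTraj v0 ω i = z i} := by
        ext ω
        simp only [Set.mem_iUnion, Set.mem_iInter, Set.mem_ofPred_eq]
        constructor
        · intro h
          exact ⟨_, ⟨ω, h, rfl⟩, fun i => rfl⟩
        · rintro ⟨_, ⟨ω', h, rfl⟩, h2⟩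
          exact hE ω' ω (fun i hi => (h2 ⟨i, by omega⟩).symm) h
      rw [this]
      refine @MeasurableSet.biUnion _ _ (F m) _ _ (Set.to_countable _) fun z _ =>
        @MeasurableSet.iInter _ _ (F m) _ _ fun i => hWF i m (by omega) _
    have hset : E ∩ {ω | chainTraj v0 ω (m + 2) = r} = E ∩ {ω | ω (m, p, q) = r} := by
      ext ω
      simp only [Set.mem_inter_iff, Set.mem_ofPred_eq, chainTraj]
      refine and_congr_right fun h => ?_
      rw [(hpq ω h).1, (hpq ω h).2]
    have hI := indep_iSup_of_disjoint hmm hind.iIndep (S := {i | i.1 < m}) (T := {(m, p, q)})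
      (by simp)
    have hT : MeasurableSet[⨆ i ∈ ({(m, p, q)} : Set (ℕ × V × V)), mm i]
        {ω : ℕ × V × V → V | ω (m, p, q) = r} := by
      rw [iSup_singleton]
      exact ⟨{r}, measurableSet_singleton r, rfl⟩
    have h2 := (Indep_iff _ _ _).1 hI E {ω | ω (m, p, q) = r} hEm hT
    change μ (E ∩ {ω | chainTraj v0 ω (m + 2) = r}) = _
    rw [hset, h2]
    congr 1
    have h3 := Measure.infinitePi_map_eval (fun i : ℕ × V × V => (f i.1 i.2.1 i.2.2).toMeasure) (m, p, q)
    have h4 := congrArg (fun ν => ν {r}) h3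
    simp only at h4
    rw [Measure.map_apply (measurable_pi_apply _) (measurableSet_singleton r),
      PMF.toMeasure_apply_singleton _ _ (measurableSet_singleton r)] at h4
    exact h4

section Weights

variable {V I : Type} [Fintype V] [DecidableEq V] [DecidableEq I]

/-- Weight of Alice's move from `x` to `z` when Bob is at `y`. -/
noncomputable def wA (blk : V → I) (σ : Equiv.Perm I) (a N : ℝ) (x y z : V) : ℝ :=
  if z = x ∨ z = y then 0 else if blk z = σ (blk x) then a / (N * (a - 1)) else 1 / N

/-- Weight of Bob's move from `y` to `z` when Alice is at `x`. -/
noncomputable def wB (blk : V → I) (σ : Equiv.Perm I) (a : ℝ) (x y z : V) : ℝ :=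
  if blk z = σ (blk x) then
    (if blk y = σ (blk x) then (if z = y then 0 else 1 / (a - 1)) else 1 / a) else 0

/-- Conditional law of Bob's position given Alice's. -/
noncomputable def wU (blk : V → I) (σ : Equiv.Perm I) (a : ℝ) (x y : V) : ℝ :=
  if blk y = σ (blk x) then 1 / a else 0

variable {blk : V → I} {σ : Equiv.Perm I} {a : ℝ}

lemma sumBlk (hc : ∀ i, ((Finset.univ.filter fun v => blk v = i).card : ℝ) = a) (i : I) (k : ℝ) :
    ∑ v, (if blk v = i then k else 0) = a * k := by
  rw [← Finset.sum_filter, Finset.sum_const, nsmul_eq_mul, hc]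

lemma sumBlk' (hc : ∀ i, ((Finset.univ.filter fun v => blk v = i).card : ℝ) = a) (i : I) (k : ℝ)
    (y : V) (hy : blk y = i) :
    ∑ v, (if blk v = i then (if v = y then 0 else k) else 0) = (a - 1) * k := by
  have : ∀ v, (if blk v = i then (if v = y then 0 else k) else 0) =
      (if blk v = i then k else 0) - (if v = y then k else 0) := by
    intro v
    by_cases h : v = y
    · subst h; simp [hy]
    · simp [h]
  simp only [this, Finset.sum_sub_distrib, sumBlk hc]
  simp; ring

lemma wA_nonneg (ha : 1 < a) {N : ℝ} (hN : 0 < N) (x y z : V) : 0 ≤ wA blk σ a N x y z := by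
  have : 0 < a - 1 := by linarith
  unfold wA; split_ifs <;> positivity

lemma wB_nonneg (ha : 1 < a) (x y z : V) : 0 ≤ wB blk σ a x y z := by
  have : 0 < a - 1 := by linarith
  unfold wB; split_ifs <;> positivity

lemma wU_nonneg (ha : 1 < a) (x y : V) : 0 ≤ wU blk σ a x y := by
  unfold wU; split_ifs <;> positivity

variable (hc : ∀ i, ((Finset.univ.filter fun v => blk v = i).card : ℝ) = a) (hσ : ∀ i, σ i ≠ i)
  (ha : 1 < a) {N : ℝ} (hN : 0 < N) 

include hc ha in
lemma wU_sum (x : V) : ∑ y, wU blk σ a x y = 1 := by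
  unfold wU
  rw [sumBlk hc]; field_simp

include hc ha in
lemma wB_sum (x y : V) : ∑ z, wB blk σ a x y z = 1 := by
  have : a - 1 ≠ 0 := by linarith
  by_cases h : blk y = σ (blk x)
  · simp only [wB, h, if_true]
    rw [sumBlk' hc _ _ _ h]; field_simp
  · simp only [wB, h, if_false]
    rw [sumBlk hc]; field_simp

include hc hσ ha hN in
lemma wA_sum (hcard : (Fintype.card V : ℝ) = N + 1) (x y : V) (h : blk y = σ (blk x)) :
    ∑ z, wA blk σ a N x y z = 1 := by
  have h1 : a - 1 ≠ 0 := by linarith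
  have : ∀ z, wA blk σ a N x y z =
      (if blk z = σ (blk x) then (if z = y then 0 else a / (N * (a - 1))) else 0)
      + (1 / N - (if blk z = σ (blk x) then 1 / N else 0) - (if z = x then 1 / N else 0)) := by
    intro z
    unfold wA
    by_cases hx : z = x
    · subst hx
      simp [(hσ (blk z)).symm]
    · by_cases hy : z = y
      · subst hy
        simp [hx, h]
      · by_cases hz : blk z = σ (blk x) <;> simp [hx, hy, hz]
  simp only [this, Finset.sum_add_distrib, Finset.sum_sub_distrib, sumBlk hc, sumBlk' hc _ _ y h]
  simp [hcard]
  field_simp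
  ring

include hc hσ ha hN in
lemma key2 (x z w : V) : ∑ y, wU blk σ a x y * wA blk σ a N x y z * wB blk σ a z y w =
    (if z = x then 0 else 1 / N) * wU blk σ a z w := by
  have h1 : a - 1 ≠ 0 := by linarith
  by_cases hx : z = x
  · simp [wA, hx]
  by_cases hw : blk w = σ (blk z)
  swap
  · simp [wB, wU, hw]
  by_cases hzx : blk z = blk x
  · have : ∀ y, wU blk σ a x y * wA blk σ a N x y z * wB blk σ a z y w =
        if blk y = σ (blk z) then (if y = w then 0 else 1 / a * (1 / N) * (1 / (a - 1))) else 0 := by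
      intro y
      by_cases hy : blk y = σ (blk x)
      · have hzy : z ≠ y := by
          rintro rfl
          exact hσ (blk x) (by rw [← hy, hzx])
        simp [wU, wA, wB, hy, hzy, hx, hw, hzx, (hσ (blk x)).symm, eq_comm (a := w)]
      · simp [wU, hy, hzx]
    simp only [this, hx, if_false]
    rw [sumBlk' hc _ _ w hw]
    simp only [wU, hw, if_true]
    field_simp
  · by_cases hzs : blk z = σ (blk x)
    · have : ∀ y, wU blk σ a x y * wA blk σ a N x y z * wB blk σ a z y w =
        if blk y = σ (blk x) then (if y = z then 0 else 1 / a * (a / (N * (a - 1))) * (1 / a)) else 0 := by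
        intro y
        by_cases hy : blk y = σ (blk x)
        · by_cases hyz : y = z
          · simp [wA, hyz]
          · simp [wU, wA, wB, hy, Ne.symm hyz, hyz, hx, hw, hzs, (hσ (σ (blk x))).symm]
        · simp [wU, hy]
      simp only [this, hx, if_false]
      rw [sumBlk' hc _ _ z hzs]
      simp only [wU, hw, if_true]
      field_simp
    · have : ∀ y, wU blk σ a x y * wA blk σ a N x y z * wB blk σ a z y w =
        if blk y = σ (blk x) then (1 / a * (1 / N) * (1 / a)) else 0 := by
        intro y
        by_cases hy : blk y = σ (blk x)
        · have hyz : z ≠ y := by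
            rintro rfl; exact hzs hy
          simp [wU, wA, wB, hy, hyz, hx, hw, hzs, Ne.symm hzx]
        · simp [wU, hy]
      simp only [this, hx, if_false]
      rw [sumBlk hc]
      simp only [wU, hw, if_true]
      field_simp

include hc hσ ha hN in
lemma key3 (x y w : V) (hy : blk y = σ (blk x)) :
    ∑ z, wA blk σ a N x y z * wB blk σ a z y w = if w = y then 0 else 1 / N := by
  have h1 : a - 1 ≠ 0 := by linarith
  by_cases hwy : blk w = blk y
  · have : ∀ z, wA blk σ a N x y z * wB blk σ a z y w =
        if blk z = blk x then (if z = x then 0 else 1 / N * (if w = y then 0 else 1 / (a - 1))) else 0 := by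
      intro z
      by_cases hz : blk z = blk x
      · have hzy : z ≠ y := by
          rintro rfl
          exact hσ (blk x) (by rw [← hy, hz])
        by_cases hzx : z = x
        · simp [wA, hzx]
        · simp [wA, wB, hzx, hzy, hz, hwy, hy, (hσ (blk x)).symm]
      · simp [wB, hwy, hy, hz, Ne.symm hz]
    simp only [this]
    rw [sumBlk' hc _ _ x rfl]
    split_ifs
    · simp
    · field_simp
  · have hne : w ≠ y := fun h => hwy (by rw [h])
    obtain ⟨C, hC⟩ := σ.surjective (blk w)
    have hCB : C ≠ blk x := by
      rintro rfl; exact hwy (by rw [← hC, hy])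
    by_cases hCs : C = σ (blk x)
    · have : ∀ z, wA blk σ a N x y z * wB blk σ a z y w =
        if blk z = C then (if z = y then 0 else a / (N * (a - 1)) * (1 / a)) else 0 := by
        intro z
        by_cases hz : blk z = C
        · have hzx : z ≠ x := by
            rintro rfl; exact hCB hz.symm
          by_cases hzy : z = y
          · simp [wA, hzy]
          · simp [wA, wB, hzx, hzy, hz, ← hC, hy, Ne.symm hCB, hCs]
            intro h; exact absurd h.symm (hσ _)
        · simp [wB, ← hC, hz, Ne.symm hz]
      simp only [this]
      rw [sumBlk' hc _ _ y (by rw [hy, hCs])]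
      simp only [hne, if_false]
      field_simp
    · have : ∀ z, wA blk σ a N x y z * wB blk σ a z y w =
        if blk z = C then (1 / N * (1 / a)) else 0 := by
        intro z
        by_cases hz : blk z = C
        · have hzx : z ≠ x := by
            rintro rfl; exact hCB hz.symm
          have hzy : z ≠ y := by
            rintro rfl; exact hCs (by rw [← hz, hy])
          simp [wA, wB, hzx, hzy, hz, ← hC, hy, Ne.symm hCB, hCs]
        · simp [wB, ← hC, hz, Ne.symm hz]
      simp only [this]
      rw [sumBlk hc]
      simp only [hne, if_false]
      field_simp

end Weights

lemma exists_rules (a b : ℕ) (ha : 1 < a) (hb : 1 < b) :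
    ∃ (U : Fin (a * b) → PMF (Fin (a * b))) (A B : Fin (a * b) → Fin (a * b) → PMF (Fin (a * b)))
      (good : Fin (a * b) → Fin (a * b) → Prop),
      (∀ x y, ¬ good x y → U x y = 0) ∧ (∀ x y z, ¬ good x z → B x y z = 0) ∧
      (∀ x y, A x y y = 0) ∧ (∀ x y, B x y x = 0) ∧ (∀ x, U x x = 0) ∧
      (∀ x z w, ∑ y, U x y * A x y z * B z y w =
        (if z = x then 0 else ((a * b - 1 : ℕ) : ENNReal)⁻¹) * U z w) ∧
      (∀ x y w, good x y → ∑ z, A x y z * B z y w =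
        (if w = y then 0 else ((a * b - 1 : ℕ) : ENNReal)⁻¹)) := by
  classical
  obtain ⟨b, rfl⟩ : ∃ b', b = b' + 2 := ⟨b - 2, by omega⟩
  have hn : 2 ≤ a * (b + 2) := by nlinarith
  let V := Fin (a * (b + 2))
  let e : V ≃ Fin a × Fin (b + 2) := finProdFinEquiv.symm
  let blk : V → Fin (b + 2) := fun v => (e v).2
  let σ : Equiv.Perm (Fin (b + 2)) := Equiv.addRight 1
  have hσ : ∀ i, σ i ≠ i := by
    intro i; simp [σ]
  have hc : ∀ i, ((Finset.univ.filter fun v => blk v = i).card : ℝ) = (a : ℝ) := by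
    intro i
    have : (Finset.univ.filter fun v : V => blk v = i).card = (Finset.univ : Finset (Fin a)).card := by
      refine Finset.card_bij' (fun v _ => (e v).1) (fun k _ => e.symm (k, i)) ?_ ?_ ?_ ?_
      · simp
      · simp [blk]
      · intro v hv
        simp only [Finset.mem_filter, Finset.mem_univ, true_and, blk] at hv
        rw [← hv]; simp
      · simp
    rw [this]; simp
  have ha' : (1 : ℝ) < a := by exact_mod_cast ha
  set N : ℝ := ((a * (b + 2) - 1 : ℕ) : ℝ) with hNdef
  have hN : 0 < N := by
    rw [hNdef]; exact_mod_cast (by omega : 0 < a * (b + 2) - 1)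
  have hcard : (Fintype.card V : ℝ) = N + 1 := by
    simp only [V, Fintype.card_fin, hNdef]
    exact_mod_cast (by omega : a * (b + 2) = (a * (b + 2) - 1) + 1)
  have hκ : ∀ x z : V, (if z = x then 0 else ((a * (b + 2) - 1 : ℕ) : ENNReal)⁻¹) =
      ENNReal.ofReal (if z = x then 0 else 1 / N) := by
    intro x z
    split_ifs
    · simp
    · rw [one_div, ENNReal.ofReal_inv_of_pos hN, hNdef, ENNReal.ofReal_natCast]
  have hother : ∀ y : V, ∃ z : V, z ≠ y := by
    intro y
    haveI : Nontrivial V := Fin.nontrivial_iff_two_le.2 hn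
    exact exists_ne y
  choose oth hoth using hother
  let U : V → PMF V := fun x => PMF.ofFintype (fun y => ENNReal.ofReal (wU blk σ a x y)) (by
    rw [← ENNReal.ofReal_sum_of_nonneg (fun i _ => wU_nonneg ha' _ _), wU_sum hc ha']; simp)
  let B : V → V → PMF V := fun x y => PMF.ofFintype (fun z => ENNReal.ofReal (wB blk σ a x y z)) (by
    rw [← ENNReal.ofReal_sum_of_nonneg (fun i _ => wB_nonneg ha' _ _ _), wB_sum hc ha']; simp)
  let A : V → V → PMF V := fun x y => if h : blk y = σ (blk x) then
    PMF.ofFintype (fun z => ENNReal.ofReal (wA blk σ a N x y z)) (by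
      rw [← ENNReal.ofReal_sum_of_nonneg (fun i _ => wA_nonneg ha' hN _ _ _),
        wA_sum hc hσ ha' hN hcard x y h]; simp)
    else PMF.pure (oth y)
  have hU : ∀ x y, U x y = ENNReal.ofReal (wU blk σ a x y) := fun x y => rfl
  have hB : ∀ x y z, B x y z = ENNReal.ofReal (wB blk σ a x y z) := fun x y z => rfl
  have hA : ∀ x y z, blk y = σ (blk x) → A x y z = ENNReal.ofReal (wA blk σ a N x y z) := by
    intro x y z h
    simp only [A, dif_pos h]; rfl
  refine ⟨U, A, B, fun x y => blk y = σ (blk x), ?_, ?_, ?_, ?_, ?_, ?_, ?_⟩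
  · intro x y h
    simp [hU, wU, h]
  · intro x y z h
    simp [hB, wB, h]
  · intro x y
    by_cases h : blk y = σ (blk x)
    · rw [hA _ _ _ h]; simp [wA]
    · simp only [A, dif_neg h]
      simp [PMF.pure_apply, (hoth y).symm]
  · intro x y
    simp [hB, wB, (hσ (blk x)).symm]
  · intro x
    simp [hU, wU, (hσ (blk x)).symm]
  · intro x z w
    rw [hκ, hU, ← ENNReal.ofReal_mul (by split_ifs <;> positivity),
      ← key2 hc hσ ha' hN x z w, ENNReal.ofReal_sum_of_nonneg]
    · refine Finset.sum_congr rfl fun y _ => ?_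
      by_cases h : blk y = σ (blk x)
      · rw [hA _ _ _ h, hU, hB, ← ENNReal.ofReal_mul (wU_nonneg ha' _ _), ← ENNReal.ofReal_mul]
        exact mul_nonneg (wU_nonneg ha' _ _) (wA_nonneg ha' hN _ _ _)
      · simp [hU, wU, h]
    · intro y _
      exact mul_nonneg (mul_nonneg (wU_nonneg ha' _ _) (wA_nonneg ha' hN _ _ _)) (wB_nonneg ha' _ _ _)
  · intro x y w h
    rw [hκ, ← key3 hc hσ ha' hN x y w h, ENNReal.ofReal_sum_of_nonneg]
    · refine Finset.sum_congr rfl fun z _ => ?_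
      rw [hA _ _ _ h, hB, ← ENNReal.ofReal_mul (wA_nonneg ha' hN _ _ _)]
    · intro z _
      exact mul_nonneg (wA_nonneg ha' hN _ _ _) (wB_nonneg ha' _ _ _)

lemma measure_split {Ω V : Type} [MeasurableSpace Ω] [Fintype V] [MeasurableSpace V]
    [MeasurableSingletonClass V] (μ : Measure Ω) (Z : Ω → V) (hZ : Measurable Z) (E : Set Ω) :
    μ E = ∑ z, μ (E ∩ {ω | Z ω = z}) := by
  classical
  have h := sum_measure_preimage_singleton (μ := μ.restrict E) (Finset.univ : Finset V) (f := Z)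
    (fun y _ => hZ (measurableSet_singleton y))
  simp only [Finset.coe_univ, Set.preimage_univ, Measure.restrict_apply_univ] at h
  rw [← h]
  refine Finset.sum_congr rfl fun z _ => ?_
  rw [Measure.restrict_apply (hZ (measurableSet_singleton z)), Set.inter_comm]
  rfl

/-- For every composite `n = a * b` with `a, b > 1`, there exists a Markovian
avoidance coupling of two walkers on the loopless complete graph `K_n`. -/
theorem markovian_avoidance_coupling_two_walkers_composite_loopless
    (a b : ℕ) (ha : 1 < a) (hb : 1 < b) :
    MarkovianAvoidanceCouplingLoopless (a * b) 2 := by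
  obtain ⟨U, A, B, good, hUg, hBg, hAy, hBx, hUx, k2, k3⟩ := exists_rules a b ha hb
  have hn : 0 < a * b := by positivity
  let v0 : Fin (a * b) := ⟨0, hn⟩
  let f : ℕ → Fin (a * b) → Fin (a * b) → PMF (Fin (a * b)) := fun m p q =>
    if m = 0 then PMF.pure v0 else if m = 1 then U q else
      if m % 2 = 0 then A p q else B q p
  obtain ⟨Ω, mΩ, μ, W, hμ, hW, hW0, hstep⟩ := exists_chain v0 f
  -- the elementary steps
  have stepU : ∀ (E : Set Ω) (x y : Fin (a * b)),
      (∀ ω ω', (∀ i ≤ 2, W i ω = W i ω') → ω ∈ E → ω' ∈ E) →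
      (∀ ω ∈ E, W 2 ω = x) → μ (E ∩ {ω | W 3 ω = y}) = μ E * U x y := by
    intro E x y h1 h2
    have := hstep 1 E v0 x y h1 (fun ω h => ⟨(hW0 ω).2, h2 ω h⟩)
    simpa [f] using this
  have stepA : ∀ (t : ℕ) (E : Set Ω) (x y z : Fin (a * b)),
      (∀ ω ω', (∀ i ≤ 2 * t + 3, W i ω = W i ω') → ω ∈ E → ω' ∈ E) →
      (∀ ω ∈ E, W (2 * t + 2) ω = x ∧ W (2 * t + 3) ω = y) →
      μ (E ∩ {ω | W (2 * t + 4) ω = z}) = μ E * A x y z := by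
    intro t E x y z h1 h2
    have := hstep (2 * t + 2) E x y z h1 h2
    simpa [f] using this
  have stepB : ∀ (t : ℕ) (E : Set Ω) (x y z : Fin (a * b)),
      (∀ ω ω', (∀ i ≤ 2 * t + 4, W i ω = W i ω') → ω ∈ E → ω' ∈ E) →
      (∀ ω ∈ E, W (2 * t + 3) ω = y ∧ W (2 * t + 4) ω = x) →
      μ (E ∩ {ω | W (2 * t + 5) ω = z}) = μ E * B x y z := by
    intro t E x y z h1 h2
    have := hstep (2 * t + 3) E y x z h1 h2
    have h3 : (2 * t + 3) % 2 = 1 := by omega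
    simpa [f, h3] using this
  clear hstep
  have hgood : ∀ t x y, ¬ good x y → μ ({ω | W (2 * t + 2) ω = x} ∩ {ω | W (2 * t + 3) ω = y}) = 0 := by
    intro t x y hxy
    rcases t with _ | t
    · rw [stepU _ x y]
      · rw [hUg _ _ hxy, mul_zero]
      · intro ω ω' h h1
        exact (h 2 (by omega)).symm.trans h1
      · intro ω h; exact h
    · rw [measure_split μ (W (2 * t + 3)) (hW _)]
      refine Finset.sum_eq_zero fun q _ => ?_
      have := stepB t ({ω | W (2 * (t + 1) + 2) ω = x} ∩ {ω | W (2 * t + 3) ω = q}) x q y ?_ ?_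
      · rw [hBg _ _ _ hxy, mul_zero] at this
        rw [Set.inter_right_comm]; exact this
      · rintro ω ω' h ⟨h1, h2⟩
        exact ⟨(h (2 * t + 4) (by omega)).symm.trans h1, (h (2 * t + 3) (by omega)).symm.trans h2⟩
      · rintro ω ⟨h1, h2⟩
        exact ⟨h2, h1⟩
  refine ⟨Ω, mΩ, μ, fun j t => W (2 * t + 2 + j), hμ, fun j t => hW _, ?_, ?_, ?_⟩
  · -- faithfulness
    intro j
    fin_cases j
    · -- Alice
      intro t v
      simp only [Fin.zero_eta, Fin.val_zero, add_zero]
      have hsplit : ∀ t, {ω | ∀ s ≤ t + 1, W (2 * s + 2) ω = v s} =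
          {ω | ∀ s ≤ t, W (2 * s + 2) ω = v s} ∩ {ω | W (2 * t + 4) ω = v (t + 1)} := by
        intro t
        ext ω
        simp only [Set.mem_inter_iff, Set.mem_ofPred_eq]
        constructor
        · intro h; exact ⟨fun s hs => h s (by omega), h (t + 1) le_rfl⟩
        · rintro ⟨h1, h2⟩ s hs
          rcases Nat.lt_or_ge t s with h | h
          · obtain rfl : s = t + 1 := by omega
            exact h2
          · exact h1 s h
      have hdet : ∀ t m, 2 * t + 2 ≤ m → ∀ ω ω', (∀ i ≤ m, W i ω = W i ω') →
          ω ∈ {ω | ∀ s ≤ t, W (2 * s + 2) ω = v s} → ω' ∈ {ω | ∀ s ≤ t, W (2 * s + 2) ω = v s} := by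
        intro t m hm ω ω' h h1 s hs
        rw [← h _ (by omega)]; exact h1 s hs
      -- one Alice step and one Bob step, with Bob's position summed over
      have hA1 : ∀ t y z, μ ({ω | ∀ s ≤ t, W (2 * s + 2) ω = v s} ∩ {ω | W (2 * t + 3) ω = y} ∩
          {ω | W (2 * t + 4) ω = z}) =
          μ ({ω | ∀ s ≤ t, W (2 * s + 2) ω = v s} ∩ {ω | W (2 * t + 3) ω = y}) * A (v t) y z := by
        intro t y z
        apply stepA
        · rintro ω ω' h ⟨h1, h2⟩
          exact ⟨hdet t _ (by omega) ω ω' h h1, (h _ le_rfl).symm.trans h2⟩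
        · rintro ω ⟨h1, h2⟩
          exact ⟨h1 t le_rfl, h2⟩
      have hB1 : ∀ t y z w, μ ({ω | ∀ s ≤ t, W (2 * s + 2) ω = v s} ∩ {ω | W (2 * t + 3) ω = y} ∩
          {ω | W (2 * t + 4) ω = z} ∩ {ω | W (2 * t + 5) ω = w}) =
          μ ({ω | ∀ s ≤ t, W (2 * s + 2) ω = v s} ∩ {ω | W (2 * t + 3) ω = y} ∩
          {ω | W (2 * t + 4) ω = z}) * B z y w := by
        intro t y z w
        apply stepB
        · rintro ω ω' h ⟨⟨h1, h2⟩, h3⟩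
          exact ⟨⟨hdet t _ (by omega) ω ω' h h1, (h _ (by omega)).symm.trans h2⟩,
            (h _ le_rfl).symm.trans h3⟩
        · rintro ω ⟨⟨h1, h2⟩, h3⟩
          exact ⟨h2, h3⟩
      have hcomb : ∀ t, (∀ y, μ ({ω | ∀ s ≤ t, W (2 * s + 2) ω = v s} ∩ {ω | W (2 * t + 3) ω = y}) =
          μ {ω | ∀ s ≤ t, W (2 * s + 2) ω = v s} * U (v t) y) → ∀ w,
          μ ({ω | ∀ s ≤ t + 1, W (2 * s + 2) ω = v s} ∩ {ω | W (2 * t + 5) ω = w}) =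
          μ {ω | ∀ s ≤ t, W (2 * s + 2) ω = v s} *
            ((if v (t + 1) = v t then 0 else ((a * b - 1 : ℕ) : ENNReal)⁻¹) * U (v (t + 1)) w) := by
        intro t ih w
        rw [measure_split μ (W (2 * t + 3)) (hW _), ← k2, Finset.mul_sum]
        refine Finset.sum_congr rfl fun y _ => ?_
        rw [hsplit, Set.inter_right_comm, Set.inter_right_comm _ {ω | W (2 * t + 4) ω = v (t + 1)},
          hB1, hA1, ih]
        ring
      have hlaw : ∀ t y, μ ({ω | ∀ s ≤ t, W (2 * s + 2) ω = v s} ∩ {ω | W (2 * t + 3) ω = y}) =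
          μ {ω | ∀ s ≤ t, W (2 * s + 2) ω = v s} * U (v t) y ∧
          μ {ω | ∀ s ≤ t + 1, W (2 * s + 2) ω = v s} = μ {ω | ∀ s ≤ t, W (2 * s + 2) ω = v s} *
            (if v (t + 1) = v t then 0 else ((a * b - 1 : ℕ) : ENNReal)⁻¹) := by
        have hsec : ∀ t, (∀ y, μ ({ω | ∀ s ≤ t, W (2 * s + 2) ω = v s} ∩ {ω | W (2 * t + 3) ω = y}) =
          μ {ω | ∀ s ≤ t, W (2 * s + 2) ω = v s} * U (v t) y) →
          μ {ω | ∀ s ≤ t + 1, W (2 * s + 2) ω = v s} = μ {ω | ∀ s ≤ t, W (2 * s + 2) ω = v s} *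
            (if v (t + 1) = v t then 0 else ((a * b - 1 : ℕ) : ENNReal)⁻¹) := by
          intro t ih
          rw [measure_split μ (W (2 * t + 5)) (hW _)]
          simp_rw [hcomb t ih]
          rw [← Finset.mul_sum, ← Finset.mul_sum]
          have : ∑ w, U (v (t + 1)) w = 1 := by
            rw [← tsum_fintype (L := SummationFilter.unconditional _)]
            exact (U (v (t + 1))).tsum_coe
          rw [this, mul_one]
        have hfst : ∀ t y, μ ({ω | ∀ s ≤ t, W (2 * s + 2) ω = v s} ∩ {ω | W (2 * t + 3) ω = y}) =
            μ {ω | ∀ s ≤ t, W (2 * s + 2) ω = v s} * U (v t) y := by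
          intro t
          induction t with
          | zero =>
            intro y
            apply stepU
            · exact hdet 0 2 (by omega)
            · intro ω h; exact h 0 le_rfl
          | succ t ih =>
            intro y
            rw [hsec t ih, mul_assoc]
            exact hcomb t ih y
        exact fun t y => ⟨hfst t y, hsec t (hfst t)⟩
      exact (hlaw t v0).2
    · -- Bob
      intro t v
      simp only [Fin.mk_one, Fin.val_one]
      have hsplit : {ω | ∀ s ≤ t + 1, W (2 * s + 2 + 1) ω = v s} =
          {ω | ∀ s ≤ t, W (2 * s + 2 + 1) ω = v s} ∩ {ω | W (2 * t + 5) ω = v (t + 1)} := by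
        ext ω
        simp only [Set.mem_inter_iff, Set.mem_ofPred_eq]
        constructor
        · intro h; exact ⟨fun s hs => h s (by omega), h (t + 1) le_rfl⟩
        · rintro ⟨h1, h2⟩ s hs
          rcases Nat.lt_or_ge t s with h | h
          · obtain rfl : s = t + 1 := by omega
            exact h2
          · exact h1 s h
      have hdet : ∀ m, 2 * t + 3 ≤ m → ∀ ω ω', (∀ i ≤ m, W i ω = W i ω') →
          ω ∈ {ω | ∀ s ≤ t, W (2 * s + 2 + 1) ω = v s} →
          ω' ∈ {ω | ∀ s ≤ t, W (2 * s + 2 + 1) ω = v s} := by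
        intro m hm ω ω' h h1 s hs
        rw [← h _ (by omega)]; exact h1 s hs
      set D := {ω | ∀ s ≤ t, W (2 * s + 2 + 1) ω = v s} with hD
      rw [hsplit, measure_split μ (W (2 * t + 2)) (hW _) (D ∩ _), measure_split μ (W (2 * t + 2)) (hW _) D,
        Finset.sum_mul]
      refine Finset.sum_congr rfl fun x _ => ?_
      by_cases hg : good x (v t)
      · rw [measure_split μ (W (2 * t + 4)) (hW _) (D ∩ _ ∩ _), ← k3 x (v t) (v (t + 1)) hg, Finset.mul_sum]
        refine Finset.sum_congr rfl fun z _ => ?_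
        rw [Set.inter_right_comm D, Set.inter_right_comm (D ∩ _), stepB t _ z (v t), stepA t _ x (v t),
          mul_assoc]
        · rintro ω ω' h ⟨h1, h2⟩
          exact ⟨hdet _ (by omega) ω ω' h h1, (h _ (by omega)).symm.trans h2⟩
        · rintro ω ⟨h1, h2⟩
          exact ⟨h2, h1 t le_rfl⟩
        · rintro ω ω' h ⟨⟨h1, h2⟩, h3⟩
          exact ⟨⟨hdet _ (by omega) ω ω' h h1, (h _ (by omega)).symm.trans h2⟩,
            (h _ (by omega)).symm.trans h3⟩
        · rintro ω ⟨⟨h1, h2⟩, h3⟩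
          exact ⟨h1 t le_rfl, h3⟩
      · have h0 := hgood t x (v t) hg
        have h1 : μ (D ∩ {ω | W (2 * t + 2) ω = x}) = 0 := by
          refine measure_mono_null ?_ h0
          rintro ω ⟨h1, h2⟩
          exact ⟨h2, h1 t le_rfl⟩
        rw [h1, zero_mul]
        refine measure_mono_null ?_ h1
        rintro ω ⟨⟨h1, _⟩, h2⟩
        exact ⟨h1, h2⟩
  · -- avoidance
    have hnull : ∀ i, μ {ω | W (i + 2) ω = W (i + 3) ω} = 0 := by
      intro i
      rw [measure_split μ (W (i + 2)) (hW _)]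
      refine Finset.sum_eq_zero fun x _ => ?_
      rw [measure_split μ (W (i + 1)) (hW _)]
      refine Finset.sum_eq_zero fun y _ => ?_
      have hle : {ω | W (i + 2) ω = W (i + 3) ω} ∩ {ω | W (i + 2) ω = x} ∩ {ω | W (i + 1) ω = y} ⊆
          ({ω | W (i + 2) ω = x} ∩ {ω | W (i + 1) ω = y}) ∩ {ω | W (i + 3) ω = x} := by
        rintro ω ⟨⟨h1, h2⟩, h3⟩
        exact ⟨⟨h2, h3⟩, h1.symm.trans h2⟩
      refine measure_mono_null hle ?_
      have hdet : ∀ ω ω', (∀ j ≤ i + 2, W j ω = W j ω') →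
          ω ∈ {ω | W (i + 2) ω = x} ∩ {ω | W (i + 1) ω = y} →
          ω' ∈ {ω | W (i + 2) ω = x} ∩ {ω | W (i + 1) ω = y} := by
        rintro ω ω' h ⟨h1, h2⟩
        exact ⟨(h _ (by omega)).symm.trans h1, (h _ (by omega)).symm.trans h2⟩
      obtain rfl | ⟨t, rfl⟩ | ⟨t, rfl⟩ : i = 0 ∨ (∃ t, i = 2 * t + 1) ∨ (∃ t, i = 2 * t + 2) := by
        rcases Nat.even_or_odd' i with ⟨c, rfl | rfl⟩
        · rcases c with _ | c
          · left; rfl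
          · right; right; exact ⟨c, by ring⟩
        · right; left; exact ⟨c, rfl⟩
      · rw [stepU _ x x hdet (fun ω h => h.1), hUx, mul_zero]
      · have := stepA t ({ω | W (2 * t + 1 + 2) ω = x} ∩ {ω | W (2 * t + 1 + 1) ω = y}) y x x hdet
          (fun ω h => ⟨h.2, h.1⟩)
        rw [hAy, mul_zero] at this
        exact this
      · have := stepB t ({ω | W (2 * t + 2 + 2) ω = x} ∩ {ω | W (2 * t + 2 + 1) ω = y}) x y x hdet
          (fun ω h => ⟨h.2, h.1⟩)
        rw [hBx, mul_zero] at this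
        exact this
    have hae : ∀ᵐ ω ∂μ, ∀ i, W (i + 2) ω ≠ W (i + 3) ω := by
      rw [ae_all_iff]
      intro i
      rw [ae_iff]
      simpa using hnull i
    filter_upwards [hae] with ω h
    refine ⟨?_, ?_⟩
    · intro i j hij
      fin_cases i <;> fin_cases j
      · exact absurd rfl hij
      · exact h 0
      · exact (h 0).symm
      · exact absurd rfl hij
    · intro t i j
      fin_cases i <;> fin_cases j
      · exact ⟨fun h => absurd h (lt_irrefl _), fun h => absurd h (lt_irrefl _)⟩
      · exact ⟨fun _ => (h (2 * t + 2)).symm, fun h => absurd h (by decide)⟩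
      · exact ⟨fun h => absurd h (by decide), fun _ => (h (2 * t + 1)).symm⟩
      · exact ⟨fun h => absurd h (lt_irrefl _), fun h => absurd h (lt_irrefl _)⟩
  · -- Markov property
    refine ⟨fun j c => if j = 0 then A (c 0) (c 1) else B (c 0) (c 1), ?_⟩
    intro t j v w
    fin_cases j
    · refine stepA t {ω | (∀ i : Fin 2, ∀ s ≤ t, W (2 * s + 2 + i) ω = v i s) ∧
        (∀ i < (0 : Fin 2), W (2 * (t + 1) + 2 + i) ω = v i (t + 1))} (v 0 t) (v 1 t) w ?_ ?_
      · rintro ω ω' h ⟨h1, h2⟩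
        refine ⟨fun i s hs => ?_, fun i hi => absurd hi (by simp)⟩
        rw [← h _ (by have := i.2; omega)]; exact h1 i s hs
      · rintro ω ⟨h1, h2⟩
        exact ⟨h1 0 t le_rfl, h1 1 t le_rfl⟩
    · refine stepB t {ω | (∀ i : Fin 2, ∀ s ≤ t, W (2 * s + 2 + i) ω = v i s) ∧
        (∀ i < (1 : Fin 2), W (2 * (t + 1) + 2 + i) ω = v i (t + 1))} (v 0 (t + 1)) (v 1 t) w ?_ ?_
      · rintro ω ω' h ⟨h1, h2⟩
        refine ⟨fun i s hs => ?_, fun i hi => ?_⟩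
        · rw [← h _ (by have := i.2; omega)]; exact h1 i s hs
        · have hi0 : i = 0 := by omega
          subst hi0
          rw [← h _ (by simp; omega)]; exact h2 0 hi
      · rintro ω ⟨h1, h2⟩
        exact ⟨h1 1 t le_rfl, h2 0 (by decide)⟩
end

section
/- For every integer d ≥ 1 and every k with 1 ≤ k ≤ 2^d, there exists a Markovian avoidance coupling of k walkers on the looped complete graph K_n^* for n = 2^{d+1}, and also for n = 2^{d+1} + 1. -/
open MeasureTheory ProbabilityTheory

/-- The state process driven by the inputs. -/
def stProc {S U : Type} (T : S → U → S) : ℕ → (ℕ → S × U) → S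
  | 0, ω => (ω 0).1
  | t + 1, ω => T (stProc T t ω) (ω (t + 1)).2

lemma stProc_congr {S U : Type} (T : S → U → S) (t : ℕ) (ω ω' : ℕ → S × U)
    (h : ∀ s ≤ t, ω s = ω' s) : stProc T t ω = stProc T t ω' := by
  induction t with
  | zero => simp [stProc, h 0 le_rfl]
  | succ t ih =>
    simp only [stProc]
    rw [ih (fun s hs => h s (by omega)), h (t + 1) le_rfl]

/-- `st` is a chain with transition rule `T` driven by the uniform independent inputs `inp`. -/
structure DrivenChain {S U Ω : Type} [Fintype S] [Fintype U] [MeasurableSpace S] [MeasurableSpace Ω]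
    (T : S → U → S) (μ : Measure Ω) (st : ℕ → Ω → S) (inp : ℕ → Ω → U) : Prop where
  meas_st : ∀ t, Measurable (st t)
  meas_inp : ∀ t u, MeasurableSet {ω | inp t ω = u}
  step : ∀ t ω, st (t + 1) ω = T (st t ω) (inp t ω)
  start : ∀ s, μ {ω | st 0 ω = s} = ((Fintype.card S : ℕ) : ENNReal)⁻¹
  indep : ∀ (t : ℕ) (Φ : (ℕ → S) → Prop), (∀ p q : ℕ → S, (∀ s ≤ t, p s = q s) → Φ p → Φ q) →
        MeasurableSet {ω | Φ (fun s => st s ω)} ∧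
        ∀ u, μ {ω | Φ (fun s => st s ω) ∧ inp t ω = u} =
          μ {ω | Φ (fun s => st s ω)} * ((Fintype.card U : ℕ) : ENNReal)⁻¹

lemma exists_chain_s9 {S U : Type} [Fintype S] [Fintype U] [Nonempty S] [Nonempty U]
    [MeasurableSpace S] [DiscreteMeasurableSpace S] (T : S → U → S) :
    ∃ (Ω : Type) (_ : MeasurableSpace Ω) (μ : Measure Ω) (st : ℕ → Ω → S) (inp : ℕ → Ω → U),
      IsProbabilityMeasure μ ∧ DrivenChain T μ st inp := by
  classical
  let _ : MeasurableSpace U := ⊤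
  have : DiscreteMeasurableSpace U := ⟨fun _ => trivial⟩
  let ν : Measure (S × U) := (PMF.uniformOfFintype (S × U)).toMeasure
  let μ : Measure (ℕ → S × U) := Measure.infinitePi (fun _ : ℕ => ν)
  have hind : iIndepFun (fun (i : ℕ) (ω : ℕ → S × U) => ω i) μ :=
    iIndepFun_infinitePi (P := fun _ : ℕ => ν) (X := fun _ => id) (fun i => measurable_id)
  have hev : ∀ (i : ℕ) (A : Set (S × U)), μ {ω | ω i ∈ A} = ν A := by
    intro i A
    have h1 : MeasurePreserving (Function.eval i) μ ν := measurePreserving_eval_infinitePi _ i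
    exact h1.measure_preimage (MeasurableSet.of_discrete).nullMeasurableSet
  have hmst : ∀ t, Measurable (stProc T t) := by
    intro t
    induction t with
    | zero => exact measurable_fst.comp (measurable_pi_apply 0)
    | succ t ih =>
      exact (Measurable.of_discrete (f := fun p : S × U => T p.1 p.2)).comp
        (ih.prodMk (measurable_snd.comp (measurable_pi_apply (t + 1))))
  refine ⟨ℕ → S × U, inferInstance, μ, stProc T, fun t ω => (ω (t + 1)).2, inferInstance,
    ⟨hmst, ?_, fun t ω => rfl, ?_, ?_⟩⟩
  · intro t u
    exact (measurable_snd.comp (measurable_pi_apply (t + 1))) (MeasurableSet.of_discrete (s := {u}))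
  · intro s
    have : {ω : ℕ → S × U | stProc T 0 ω = s} = {ω | ω 0 ∈ ({s} : Set S) ×ˢ (Set.univ : Set U)} := by
      ext ω; simp [stProc]
    rw [this, hev, PMF.toMeasure_uniformOfFintype_apply _ MeasurableSet.of_discrete]
    have hU : (Fintype.card U : ENNReal) ≠ 0 := by simp
    have hS : (Fintype.card S : ENNReal) ≠ 0 := by simp
    rw [Fintype.card_prod, ← Nat.card_eq_fintype_card (α := ↥(({s} : Set S) ×ˢ (Set.univ : Set U)))]
    have : Nat.card ↥(({s} : Set S) ×ˢ (Set.univ : Set U)) = Fintype.card U := by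
      rw [Nat.card_coe_set_eq, Set.ncard_prod]; simp [Set.ncard_univ]
    rw [this, Nat.cast_mul, ENNReal.div_eq_inv_mul, ENNReal.mul_inv (Or.inl hS) (Or.inl (by simp)),
      mul_assoc, ENNReal.inv_mul_cancel hU (by simp), mul_one]
  · intro t Φ hΦ
    have hI := hind.indepFun_finset (Finset.range (t + 1)) {t + 1} (by simp)
      (fun i => measurable_pi_apply i)
    obtain ⟨d⟩ : Nonempty (S × U) := inferInstance
    let ext' : (Finset.range (t + 1) → S × U) → ℕ → S × U :=
      fun r i => if h : i ∈ Finset.range (t + 1) then r ⟨i, h⟩ else d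
    have hset : {ω | Φ (fun s => stProc T s ω)} =
        (fun (a : ℕ → S × U) (i : Finset.range (t + 1)) => a i) ⁻¹'
          {r | Φ (fun s => stProc T s (ext' r))} := by
      ext ω
      have hq : ∀ s ≤ t, stProc T s ω =
          stProc T s (ext' (fun (i : Finset.range (t + 1)) => ω i)) := by
        intro s hs
        apply stProc_congr
        intro s' hs'
        have : s' < t + 1 := by omega
        simp only [ext', Finset.mem_range, this, dite_true]
      simp only [Set.mem_ofPred_eq, Set.mem_preimage]
      exact ⟨hΦ _ _ hq, hΦ _ _ (fun s hs => (hq s hs).symm)⟩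
    have hmeas : MeasurableSet {ω | Φ (fun s => stProc T s ω)} := by
      rw [hset]
      exact (measurable_pi_lambda _ (fun i => measurable_pi_apply _)) MeasurableSet.of_discrete
    refine ⟨hmeas, ?_⟩
    intro u
    have h2 : {ω : ℕ → S × U | (ω (t + 1)).2 = u} =
        (fun (a : ℕ → S × U) (i : ({t + 1} : Finset ℕ)) => a i) ⁻¹'
          {r | (r ⟨t + 1, by simp⟩).2 = u} := by
      ext ω; simp
    have h3 := hI.measure_inter_preimage_eq_mul {r | Φ (fun s => stProc T s (ext' r))}
      {r | (r ⟨t + 1, by simp⟩).2 = u} MeasurableSet.of_discrete MeasurableSet.of_discrete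
    rw [← hset, ← h2] at h3
    rw [Set.ofPred_and, h3]
    congr 1
    have : {ω : ℕ → S × U | (ω (t + 1)).2 = u} =
        {ω | ω (t + 1) ∈ (Set.univ : Set S) ×ˢ ({u} : Set U)} := by
      ext ω; simp
    rw [this, hev, PMF.toMeasure_uniformOfFintype_apply _ MeasurableSet.of_discrete]
    have hU : (Fintype.card U : ENNReal) ≠ 0 := by simp
    have hS : (Fintype.card S : ENNReal) ≠ 0 := by simp
    rw [Fintype.card_prod, ← Nat.card_eq_fintype_card (α := ↥((Set.univ : Set S) ×ˢ ({u} : Set U)))]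
    have : Nat.card ↥((Set.univ : Set S) ×ˢ ({u} : Set U)) = Fintype.card S := by
      rw [Nat.card_coe_set_eq, Set.ncard_prod]; simp [Set.ncard_univ]
    rw [this, Nat.cast_mul, mul_comm, ENNReal.div_eq_inv_mul,
      ENNReal.mul_inv (Or.inl hU) (Or.inl (by simp)),
      mul_assoc, ENNReal.inv_mul_cancel hS (by simp), mul_one]

/-- One step of the chain, summed over states and inputs. -/
lemma chain_sum {S U Ω : Type} [Fintype S] [Fintype U] [MeasurableSpace S]
    [DiscreteMeasurableSpace S] [MeasurableSpace Ω] (μ : Measure Ω)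
    (st : ℕ → Ω → S) (inp : ℕ → Ω → U)
    (T : S → U → S) (hC : DrivenChain T μ st inp)
    (t : ℕ) (Φ : (ℕ → S) → Prop) (hΦ : ∀ p q : ℕ → S, (∀ s ≤ t, p s = q s) → Φ p → Φ q)
    (Ψ : S → U → Prop) [∀ s u, Decidable (Ψ s u)] :
    μ {ω | Φ (fun s => st s ω) ∧ Ψ (st t ω) (inp t ω)} =
      (∑ s, ∑ u, if Ψ s u then μ {ω | Φ (fun s => st s ω) ∧ st t ω = s} else 0) *
        ((Fintype.card U : ℕ) : ENNReal)⁻¹ := by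
  classical
  have key : ∀ s, MeasurableSet {ω | Φ (fun s => st s ω) ∧ st t ω = s} ∧
      ∀ u, μ {ω | (Φ (fun s => st s ω) ∧ st t ω = s) ∧ inp t ω = u} =
          μ {ω | Φ (fun s => st s ω) ∧ st t ω = s} * ((Fintype.card U : ℕ) : ENNReal)⁻¹ := by
    intro s
    exact hC.indep t (fun p => Φ p ∧ p t = s)
      (fun p q h hp => ⟨hΦ p q h hp.1, by rw [← h t le_rfl]; exact hp.2⟩)
  have hset : {ω | Φ (fun s => st s ω) ∧ Ψ (st t ω) (inp t ω)} =
      ⋃ x ∈ (Finset.univ.filter (fun x : S × U => Ψ x.1 x.2)),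
        {ω | (Φ (fun s => st s ω) ∧ st t ω = x.1) ∧ inp t ω = x.2} := by
    ext ω
    simp only [Set.mem_ofPred_eq, Finset.mem_filter, Finset.mem_univ, true_and, Set.mem_iUnion,
      Prod.exists, exists_prop]
    constructor
    · rintro ⟨h1, h2⟩
      exact ⟨_, _, h2, ⟨h1, rfl⟩, rfl⟩
    · rintro ⟨a, b, h, ⟨h1, rfl⟩, rfl⟩
      exact ⟨h1, h⟩
  rw [hset, measure_biUnion_finset]
  · rw [Finset.sum_filter, ← Finset.univ_product_univ, Finset.sum_product, Finset.sum_mul]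
    refine Finset.sum_congr rfl fun s _ => ?_
    rw [Finset.sum_mul]
    refine Finset.sum_congr rfl fun u _ => ?_
    split_ifs
    · exact (key s).2 u
    · simp
  · rintro ⟨a, b⟩ _ ⟨c, e⟩ _ hne
    refine Set.disjoint_left.2 ?_
    rintro ω ⟨⟨_, h1⟩, h2⟩ ⟨⟨_, h3⟩, h4⟩
    exact hne (Prod.ext (h1.symm.trans h3) (h2.symm.trans h4))
  · rintro ⟨a, b⟩ _
    exact (key a).1.inter (hC.meas_inp t b)

/-- Decomposition of an adapted event according to the current state. -/
lemma chain_total {S Ω : Type} [Fintype S] [MeasurableSpace S]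
    [DiscreteMeasurableSpace S] [MeasurableSpace Ω] (μ : Measure Ω)
    (f : Ω → S) (hf : Measurable f) (A : Set Ω) :
    μ A = ∑ s, μ {ω | ω ∈ A ∧ f ω = s} := by
  have h := sum_measure_preimage_singleton (μ := μ.restrict A) (Finset.univ : Finset S) (f := f)
    (fun y _ => hf MeasurableSet.of_discrete)
  rw [show f ⁻¹' (↑(Finset.univ : Finset S)) = Set.univ by simp, Measure.restrict_apply_univ] at h
  rw [← h]
  refine Finset.sum_congr rfl fun s _ => ?_
  rw [Measure.restrict_apply (hf MeasurableSet.of_discrete), Set.inter_comm]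
  rfl

/-- The transition rule: an input `inl e` makes all walkers move, an input `inr _` freezes them. -/
def stepT {G E : Type} [Add G] {m : ℕ} (D : E → G) : G × E → E ⊕ Fin m → G × E
  | s, Sum.inl e => (s.1 + D s.2, e)
  | s, Sum.inr _ => s

lemma sum_identity {G E : Type} [AddCommGroup G] [Fintype G] [DecidableEq G] [Fintype E] (m : ℕ)
    (D g : E → G)
    (hD : ∀ w : G, (∑ e, if D e = w then (1 : ENNReal) else 0) + (if w = 0 then (m : ENNReal) else 0)
      = 1)
    (mix : E → E → E) (hmg : ∀ e e', g (mix e e') = g e)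
    (hmh : ∀ e e', D (mix e e') - g (mix e e') = D e' - g e')
    (hmm : ∀ e e', mix (mix e e') (mix e' e) = e) (w y z' : G) :
    (∑ z, ∑ e, if z + g e = w ∧ z + D e = z' then
        (∑ e', if D e' - g e' = z - y then (1 : ENNReal) else 0) else 0) +
      (m : ENNReal) * (if w = y then (∑ e', if D e' - g e' = z' - y then (1 : ENNReal) else 0) else 0)
      = ∑ e', if D e' - g e' = z' - w then (1 : ENNReal) else 0 := by
  classical
  have h1 : (∑ z, ∑ e, if z + g e = w ∧ z + D e = z' then
        (∑ e', if D e' - g e' = z - y then (1 : ENNReal) else 0) else 0) =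
      ∑ x : E × E, if D x.1 - g x.1 = z' - w ∧ g x.1 + (D x.2 - g x.2) = w - y then
        (1 : ENNReal) else 0 := by
    rw [Finset.sum_comm, Fintype.sum_prod_type]
    refine Finset.sum_congr rfl fun e _ => ?_
    rw [Finset.sum_eq_single (w - g e)]
    · have e1 : (w - g e + g e = w ∧ w - g e + D e = z') ↔ D e - g e = z' - w := by
        constructor
        · rintro ⟨_, h⟩; rw [← h]; abel
        · intro h; refine ⟨by abel, ?_⟩
          have : w - g e + D e = w + (D e - g e) := by abel
          rw [this, h]; abel
      simp only [e1]
      by_cases h : D e - g e = z' - w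
      · simp only [h, if_true, true_and]
        refine Finset.sum_congr rfl fun e' _ => ?_
        have : (D e' - g e' = w - g e - y) ↔ (g e + (D e' - g e') = w - y) := by
          constructor
          · intro h; rw [h]; abel
          · intro h; rw [sub_right_comm, ← h]; abel
        simp only [this]
      · simp [h]
    · intro z _ hz
      rw [if_neg]
      rintro ⟨h, _⟩
      exact hz (by rw [← h]; abel)
    · simp
  have h2 : (∑ x : E × E, if D x.1 - g x.1 = z' - w ∧ g x.1 + (D x.2 - g x.2) = w - y then
        (1 : ENNReal) else 0) =
      ∑ x : E × E, if D x.2 - g x.2 = z' - w ∧ D x.1 = w - y then (1 : ENNReal) else 0 := by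
    let sw : E × E → E × E := fun x => (mix x.1 x.2, mix x.2 x.1)
    have hsw : Function.Involutive sw := fun x => Prod.ext (hmm _ _) (hmm _ _)
    refine Fintype.sum_equiv hsw.toPerm _ _ fun x => ?_
    have e1 : D (sw x).2 - g (sw x).2 = D x.1 - g x.1 := hmh _ _
    have e2 : D (sw x).1 = g x.1 + (D x.2 - g x.2) := by
      have := hmh x.1 x.2
      rw [hmg] at this
      rw [← this]; simp [sw]
    simp only [Function.Involutive.coe_toPerm, e1, e2]
  rw [h1, h2, Fintype.sum_prod_type]
  have h3 : (∑ x : E, ∑ y_1 : E, if D y_1 - g y_1 = z' - w ∧ D x = w - y then (1 : ENNReal) else 0) =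
      (∑ e', if D e' - g e' = z' - w then (1 : ENNReal) else 0) *
        (∑ e, if D e = w - y then (1 : ENNReal) else 0) := by
    rw [mul_comm, Finset.sum_mul_sum]
    refine Finset.sum_congr rfl fun e _ => Finset.sum_congr rfl fun e' _ => ?_
    by_cases a : D e = w - y <;> by_cases b : D e' - g e' = z' - w <;> simp [a, b]
  have h4 := hD (w - y)
  rw [h3]
  by_cases hw : w = y
  · subst hw
    simp only [sub_self, if_true] at h4 ⊢
    rw [mul_comm (m : ENNReal), ← mul_add, h4, mul_one]
  · rw [if_neg hw]
    rw [if_neg (sub_ne_zero.2 hw), add_zero] at h4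
    rw [h4]; simp

section generic

variable {G E Ω : Type} [AddCommGroup G] [Fintype G] [DecidableEq G] [Fintype E] {m : ℕ}
  [MeasurableSpace (G × E)] [DiscreteMeasurableSpace (G × E)] [MeasurableSpace Ω]

lemma walk_core (D g : E → G)
    (hD : ∀ w : G, (∑ e, if D e = w then (1 : ENNReal) else 0) + (if w = 0 then (m : ENNReal) else 0)
      = 1)
    (mix : E → E → E) (hmg : ∀ e e', g (mix e e') = g e)
    (hmh : ∀ e e', D (mix e e') - g (mix e e') = D e' - g e')
    (hmm : ∀ e e', mix (mix e e') (mix e' e) = e)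
    (μ : Measure Ω) (st : ℕ → Ω → G × E) (inp : ℕ → Ω → E ⊕ Fin m)
    (hC : DrivenChain (stepT D) μ st inp) (v : ℕ → G) (t : ℕ) (z : G) :
    μ {ω | (∀ r ≤ t, (st r ω).1 + g (st r ω).2 = v r) ∧ (st t ω).1 + D (st t ω).2 = z} =
      ((Fintype.card (G × E) : ℕ) : ENNReal)⁻¹ * (((Fintype.card (E ⊕ Fin m) : ℕ) : ENNReal)⁻¹) ^ t *
        ∑ e', if D e' - g e' = z - v t then (1 : ENNReal) else 0 := by
  classical
  induction t generalizing z with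
  | zero =>
    rw [chain_total μ (st 0) (hC.meas_st 0)]
    have : ∀ s : G × E, μ {ω | ω ∈ {ω | (∀ r ≤ 0, (st r ω).1 + g (st r ω).2 = v r) ∧
        (st 0 ω).1 + D (st 0 ω).2 = z} ∧ st 0 ω = s} =
        if s.1 + g s.2 = v 0 ∧ s.1 + D s.2 = z then
          ((Fintype.card (G × E) : ℕ) : ENNReal)⁻¹ else 0 := by
      intro s
      split_ifs with h
      · rw [← hC.start s]
        congr 1
        ext ω
        simp only [Set.mem_ofPred_eq, Nat.le_zero, forall_eq]
        constructor
        · exact fun h => h.2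
        · rintro h'; rw [h']; exact ⟨h, rfl⟩
      · convert measure_empty (μ := μ)
        ext ω
        simp only [Set.mem_ofPred_eq, Nat.le_zero, forall_eq, Set.mem_empty_iff_false, iff_false]
        rintro ⟨h1, h2⟩; rw [h2] at h1; exact h h1
    simp only [this]
    rw [Fintype.sum_prod_type, Finset.sum_comm, pow_zero, mul_one, Finset.mul_sum]
    refine Finset.sum_congr rfl fun e _ => ?_
    rw [Finset.sum_eq_single (v 0 - g e)]
    · have : (v 0 - g e + g e = v 0 ∧ v 0 - g e + D e = z) ↔ D e - g e = z - v 0 := by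
        constructor
        · rintro ⟨_, h⟩; rw [← h]; abel
        · intro h; refine ⟨by abel, ?_⟩
          have : v 0 - g e + D e = v 0 + (D e - g e) := by abel
          rw [this, h]; abel
      simp only [this]
      split_ifs <;> simp
    · intro x _ hx
      rw [if_neg]
      rintro ⟨h, _⟩
      exact hx (by rw [← h]; abel)
    · simp
  | succ t ih =>
    set n' := ((Fintype.card (E ⊕ Fin m) : ℕ) : ENNReal)⁻¹ with hn'
    set Φ : (ℕ → G × E) → Prop := fun p => ∀ r ≤ t, (p r).1 + g (p r).2 = v r with hΦ
    have hset : {ω | (∀ r ≤ t + 1, (st r ω).1 + g (st r ω).2 = v r) ∧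
          (st (t + 1) ω).1 + D (st (t + 1) ω).2 = z} =
        {ω | Φ (fun s => st s ω) ∧ (fun s u =>
          (stepT D s u).1 + g (stepT D s u).2 = v (t + 1) ∧
          (stepT D s u).1 + D (stepT D s u).2 = z) (st t ω) (inp t ω)} := by
      ext ω
      simp only [Set.mem_ofPred_eq, hΦ, hC.step t ω]
      constructor
      · rintro ⟨h1, h2⟩
        refine ⟨fun r hr => h1 r (by omega), ?_, h2⟩
        rw [← hC.step t ω]; exact h1 (t + 1) le_rfl
      · rintro ⟨h1, h2, h3⟩
        refine ⟨fun r hr => ?_, h3⟩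
        rcases Nat.lt_or_ge t r with h | h
        · obtain rfl : r = t + 1 := by omega
          rw [hC.step t ω]; exact h2
        · exact h1 r h
    set W : G × E → ENNReal := fun s => μ {ω | Φ (fun s => st s ω) ∧ st t ω = s} with hW
    have hW0 : ∀ s, s.1 + g s.2 ≠ v t → W s = 0 := by
      intro s hs
      simp only [hW]
      convert measure_empty (μ := μ)
      ext ω
      simp only [Set.mem_ofPred_eq, Set.mem_empty_iff_false, iff_false]
      rintro ⟨h1, h2⟩
      have : (st t ω).1 + g (st t ω).2 = v t := h1 t le_rfl
      rw [h2] at this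
      exact hs this
    have hP : ∀ z, (∑ s : G × E, if s.1 + D s.2 = z then W s else 0) =
        ((Fintype.card (G × E) : ℕ) : ENNReal)⁻¹ * n' ^ t *
        ∑ e', if D e' - g e' = z - v t then (1 : ENNReal) else 0 := by
      intro z
      rw [← ih z, chain_total μ (st t) (hC.meas_st t)]
      refine Finset.sum_congr rfl fun s _ => ?_
      split_ifs with h
      · simp only [hW]
        congr 1
        ext ω
        simp only [Set.mem_ofPred_eq, hΦ]
        constructor
        · rintro ⟨h1, h2⟩; exact ⟨⟨h1, by rw [h2]; exact h⟩, h2⟩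
        · rintro ⟨⟨h1, _⟩, h2⟩; exact ⟨h1, h2⟩
      · symm
        convert measure_empty (μ := μ)
        ext ω
        simp only [Set.mem_ofPred_eq, Set.mem_empty_iff_false, iff_false]
        rintro ⟨⟨h1, h3⟩, h2⟩; rw [h2] at h3; exact h h3
    rw [hset, chain_sum μ st inp (stepT D) hC t Φ
      (fun p q h hp r hr => by rw [← h r hr]; exact hp r hr)
      (fun s u => (stepT D s u).1 + g (stepT D s u).2 = v (t + 1) ∧
          (stepT D s u).1 + D (stepT D s u).2 = z)]
    simp only [Fintype.sum_sum_type, stepT]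
    rw [Finset.sum_add_distrib]
    have hA : (∑ s : G × E, ∑ e, if s.1 + D s.2 + g e = v (t + 1) ∧ s.1 + D s.2 + D e = z then
        W s else 0) = ((Fintype.card (G × E) : ℕ) : ENNReal)⁻¹ * n' ^ t *
        (∑ z', ∑ e, if z' + g e = v (t + 1) ∧ z' + D e = z then
        (∑ e', if D e' - g e' = z' - v t then (1 : ENNReal) else 0) else 0) := by
      rw [Finset.mul_sum]
      simp only [Finset.mul_sum (Finset.univ : Finset E), mul_ite, mul_zero]
      have : ∀ s : G × E, (∑ e, if s.1 + D s.2 + g e = v (t + 1) ∧ s.1 + D s.2 + D e = z then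
          W s else 0) = ∑ z', ∑ e, if z' + g e = v (t + 1) ∧ z' + D e = z then
            (if s.1 + D s.2 = z' then W s else 0) else 0 := by
        intro s
        rw [Finset.sum_eq_single (s.1 + D s.2)]
        · simp
        · intro b _ hb
          refine Finset.sum_eq_zero fun e _ => ?_
          rw [if_neg (Ne.symm hb)]; simp
        · simp
      simp only [this]
      rw [Finset.sum_comm]
      refine Finset.sum_congr rfl fun z' _ => ?_
      rw [Finset.sum_comm]
      refine Finset.sum_congr rfl fun e _ => ?_
      split_ifs with h
      · rw [hP z', Finset.mul_sum]
        refine Finset.sum_congr rfl fun e' _ => ?_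
        simp
      · simp
    have hB : (∑ s : G × E, ∑ _i : Fin m, if s.1 + g s.2 = v (t + 1) ∧ s.1 + D s.2 = z then
        W s else 0) = ((Fintype.card (G × E) : ℕ) : ENNReal)⁻¹ * n' ^ t *
        ((m : ENNReal) * (if v (t + 1) = v t then
          (∑ e', if D e' - g e' = z - v t then (1 : ENNReal) else 0) else 0)) := by
      simp only [Finset.sum_const, Finset.card_univ, Fintype.card_fin, nsmul_eq_mul]
      rw [← Finset.mul_sum, mul_left_comm]
      congr 1
      by_cases hv : v (t + 1) = v t
      · rw [if_pos hv, ← hP z]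
        refine Finset.sum_congr rfl fun s _ => ?_
        by_cases h : s.1 + g s.2 = v t
        · simp [hv, h]
        · simp [hv, h, hW0 s h]
      · rw [if_neg hv, mul_zero]
        refine Finset.sum_eq_zero fun s _ => ?_
        by_cases h : s.1 + g s.2 = v t
        · rw [if_neg]; rintro ⟨h1, _⟩; exact hv (h1.symm.trans h)
        · simp [hW0 s h]
    refine Eq.trans (congrArg (· * n') (congrArg₂ (· + ·) hA hB)) ?_
    rw [← mul_add, sum_identity m D g hD mix hmg hmh hmm, pow_succ]
    ring

lemma walk_final (D g : E → G)
    (hD : ∀ w : G, (∑ e, if D e = w then (1 : ENNReal) else 0) + (if w = 0 then (m : ENNReal) else 0)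
      = 1)
    (mix : E → E → E) (hmg : ∀ e e', g (mix e e') = g e)
    (hmh : ∀ e e', D (mix e e') - g (mix e e') = D e' - g e')
    (hmm : ∀ e e', mix (mix e e') (mix e' e) = e)
    (μ : Measure Ω) (st : ℕ → Ω → G × E) (inp : ℕ → Ω → E ⊕ Fin m)
    (hC : DrivenChain (stepT D) μ st inp) (v : ℕ → G) (t : ℕ) :
    μ {ω | ∀ r ≤ t, (st r ω).1 + g (st r ω).2 = v r} =
      ((Fintype.card (G × E) : ℕ) : ENNReal)⁻¹ * (((Fintype.card (E ⊕ Fin m) : ℕ) : ENNReal)⁻¹) ^ t *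
        (Fintype.card E : ENNReal) := by
  classical
  let _ : MeasurableSpace G := ⊤
  have : DiscreteMeasurableSpace G := ⟨fun _ => trivial⟩
  rw [chain_total μ (fun ω => (st t ω).1 + D (st t ω).2)
    ((Measurable.of_discrete (f := fun s : G × E => s.1 + D s.2)).comp (hC.meas_st t))]
  have h1 := walk_core D g hD mix hmg hmh hmm μ st inp hC v t
  simp only [Set.mem_ofPred_eq]
  simp only [h1]
  rw [← Finset.mul_sum, Finset.sum_comm]
  congr 1
  have : ∀ e : E, (∑ z : G, if D e - g e = z - v t then (1 : ENNReal) else 0) = 1 := by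
    intro e
    rw [Finset.sum_eq_single (D e - g e + v t)]
    · simp
    · intro b _ hb
      rw [if_neg]
      intro h; exact hb (by rw [h]; abel)
    · simp
  simp [this]

end generic

lemma pmf_of_weights {G : Type} [Fintype G] [Nonempty G] (wt : G → ENNReal)
    (hfin : ∀ w, wt w ≠ ⊤) : ∃ p : PMF G, ∀ w, wt w = (∑ w', wt w') * p w := by
  by_cases h0 : (∑ w', wt w') = 0
  · refine ⟨PMF.pure (Classical.arbitrary G), fun w => ?_⟩
    rw [h0, zero_mul]
    exact (Finset.sum_eq_zero_iff.1 h0) w (Finset.mem_univ _)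
  · have htop : (∑ w', wt w') ≠ ⊤ := by
      rw [ENNReal.sum_ne_top]; exact fun w _ => hfin w
    have h0' : (∑' w', wt w') ≠ 0 := by rwa [tsum_fintype]
    have ht' : (∑' w', wt w') ≠ ⊤ := by rwa [tsum_fintype]
    refine ⟨PMF.normalize wt h0' ht', fun w => ?_⟩
    rw [PMF.normalize_apply, tsum_fintype, mul_left_comm, ENNReal.mul_inv_cancel h0 htop, mul_one]

section generic2

variable {G E Ω : Type} [AddCommGroup G] [Fintype G] [Fintype E] {m k : ℕ}

open Classical in
lemma cond_uniform (D : E → G) (g : Fin k → E → G) (j0 : Fin k) (hg0 : ∀ e, g j0 e = 0)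
    [MeasurableSpace (G × E)] [DiscreteMeasurableSpace (G × E)] [MeasurableSpace Ω]
    (μ : Measure Ω) (st : ℕ → Ω → G × E) (inp : ℕ → Ω → E ⊕ Fin m)
    (hC : DrivenChain (stepT D) μ st inp) (v : Fin k → ℕ → G) (t : ℕ) :
    ∃ c : ENNReal, ∀ s : G × E,
      μ {ω | (∀ i, ∀ r ≤ t, (st r ω).1 + g i (st r ω).2 = v i r) ∧ st t ω = s} =
        if ∀ i, s.1 + g i s.2 = v i t then c else 0 := by
  have hzero : ∀ (t : ℕ) (s : G × E), ¬ (∀ i, s.1 + g i s.2 = v i t) →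
      μ {ω | (∀ i, ∀ r ≤ t, (st r ω).1 + g i (st r ω).2 = v i r) ∧ st t ω = s} = 0 := by
    intro t s hs
    convert measure_empty (μ := μ)
    ext ω
    simp only [Set.mem_ofPred_eq, Set.mem_empty_iff_false, iff_false]
    rintro ⟨h1, h2⟩
    exact hs fun i => by rw [← h2]; exact h1 i t le_rfl
  induction t with
  | zero =>
    refine ⟨((Fintype.card (G × E) : ℕ) : ENNReal)⁻¹, fun s => ?_⟩
    split_ifs with h
    · rw [← hC.start s]
      congr 1
      ext ω
      simp only [Set.mem_ofPred_eq, Nat.le_zero, forall_eq]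
      exact ⟨fun h => h.2, fun h' => ⟨by rw [h']; exact h, h'⟩⟩
    · exact hzero 0 s h
  | succ t ih =>
    obtain ⟨c, hc⟩ := ih
    let Φ : (ℕ → G × E) → Prop := fun p => ∀ i, ∀ r ≤ t, (p r).1 + g i (p r).2 = v i r
    let W : G × E → ENNReal := fun s => μ {ω | Φ (fun s => st s ω) ∧ st t ω = s}
    have hWc : ∀ s, W s = if ∀ i, s.1 + g i s.2 = v i t then c else 0 := hc
    refine ⟨((∑ s : G × E, if s.1 + D s.2 = v j0 (t + 1) then W s else 0) +
      m * (if ∀ i, v i (t + 1) = v i t then c else 0)) *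
        ((Fintype.card (E ⊕ Fin m) : ℕ) : ENNReal)⁻¹, fun s' => ?_⟩
    by_cases h : ∀ i, s'.1 + g i s'.2 = v i (t + 1)
    · rw [if_pos h]
      have hset : {ω | (∀ i, ∀ r ≤ t + 1, (st r ω).1 + g i (st r ω).2 = v i r) ∧
            st (t + 1) ω = s'} =
          {ω | Φ (fun s => st s ω) ∧ stepT D (st t ω) (inp t ω) = s'} := by
        ext ω
        simp only [Set.mem_ofPred_eq, ← hC.step t ω]
        constructor
        · rintro ⟨h1, h2⟩
          exact ⟨fun i r hr => h1 i r (by omega), h2⟩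
        · rintro ⟨h1, h3⟩
          refine ⟨fun i r hr => ?_, h3⟩
          rcases Nat.lt_or_ge t r with h' | h'
          · obtain rfl : r = t + 1 := by omega
            rw [h3]; exact h i
          · exact h1 i r h'
      rw [hset, chain_sum μ st inp (stepT D) hC t Φ
        (fun p q h hp i r hr => by rw [← h r hr]; exact hp i r hr) (fun s u => stepT D s u = s')]
      congr 1
      simp only [Fintype.sum_sum_type]
      rw [Finset.sum_add_distrib]
      congr 1
      · refine Finset.sum_congr rfl fun s _ => ?_
        have hv : v j0 (t + 1) = s'.1 := by rw [← h j0, hg0, add_zero]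
        rw [hv, Finset.sum_eq_single s'.2]
        · by_cases h' : s.1 + D s.2 = s'.1
          · rw [if_pos h', if_pos]
            exact Prod.ext h' rfl
          · rw [if_neg h', if_neg]
            intro h''; exact h' (by rw [← h'']; rfl)
        · intro b _ hb
          rw [if_neg]
          intro h''; exact hb (by rw [← h'']; rfl)
        · simp
      · rw [Finset.sum_eq_single s']
        · have : (∑ x : Fin m, if stepT D s' (Sum.inr x) = s' then
              μ {ω | Φ (fun s => st s ω) ∧ st t ω = s'} else 0) = ∑ x : Fin m, W s' :=
            Finset.sum_congr rfl fun x _ => if_pos rfl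
          rw [this, Finset.sum_const, Finset.card_univ, Fintype.card_fin, nsmul_eq_mul, hWc]
          simp only [h]
        · intro b _ hb
          exact Finset.sum_eq_zero fun x _ => if_neg hb
        · simp
    · rw [if_neg h]
      exact hzero (t + 1) s' h

open Classical in
/-- Weights of the transition rule of walker `j` in configuration `q`. -/
noncomputable def wgt (m : ℕ) (D : E → G) (g : Fin k → E → G) (j0 j : Fin k) (q : Fin k → G)
    (w : G) : ENNReal :=
  if j = j0 then
    ∑ s : G × E, ∑ u : E ⊕ Fin m, if (∀ i, s.1 + g i s.2 = q i) ∧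
      (stepT D s u).1 + g j (stepT D s u).2 = w then 1 else 0
  else if 0 < m ∧ ∃ e, q j - q j0 = g j e then
    if w = q j then 1 else 0
  else ∑ e, if (∀ i < j, q j0 + g i e = q i) ∧ q j0 + g j e = w then 1 else 0

lemma wgt_ne_top (D : E → G) (g : Fin k → E → G) (j0 j : Fin k) (q : Fin k → G)
    (w : G) : wgt m D g j0 j q w ≠ ⊤ := by
  classical
  unfold wgt
  split_ifs <;> simp only [ENNReal.sum_ne_top, ne_eq, ENNReal.one_ne_top, ENNReal.zero_ne_top,
    not_false_eq_true] <;> intros <;> split_ifs <;> simp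

open Classical in
lemma markov_sum (D : E → G) (g : Fin k → E → G) (j0 : Fin k) (hj0 : ∀ i, j0 ≤ i)
    (hg0 : ∀ e, g j0 e = 0) (H5 : 0 < m → ∀ j e e', g j e + (D e' - g j e') ≠ 0)
    (W : G × E → ENNReal) (a b : Fin k → G) (c : ENNReal)
    (hW : ∀ s, W s = if ∀ i, s.1 + g i s.2 = a i then c else 0) (j : Fin k) :
    ∃ F : ENNReal, ∀ w, (∑ s : G × E, ∑ u : E ⊕ Fin m,
      if (∀ i < j, (stepT D s u).1 + g i (stepT D s u).2 = b i) ∧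
        (stepT D s u).1 + g j (stepT D s u).2 = w then W s else 0) =
      F * wgt m D g j0 j (fun i => if i < j then b i else a i) w := by
  have hW0 : ∀ s, W s ≠ 0 → ∀ i, s.1 + g i s.2 = a i := by
    intro s hs
    by_contra h
    exact hs (by rw [hW, if_neg h])
  by_cases hj : j = j0
  · subst hj
    have hlt : ∀ i, ¬ i < j := fun i => not_lt.2 (hj0 i)
    refine ⟨c, fun w => ?_⟩
    simp only [wgt, hlt, if_true, if_false, false_imp_iff, implies_true, true_and]
    rw [Finset.mul_sum]
    refine Finset.sum_congr rfl fun s _ => ?_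
    rw [Finset.mul_sum]
    refine Finset.sum_congr rfl fun u _ => ?_
    rw [hW]
    by_cases h1 : ∀ i, s.1 + g i s.2 = a i <;>
      by_cases h2 : (stepT D s u).1 + g j (stepT D s u).2 = w <;> simp [h1, h2]
  have hlt : j0 < j := lt_of_le_of_ne (hj0 j) (Ne.symm hj)
  by_cases hfr : 0 < m ∧ ∃ e, a j - b j0 = g j e
  · refine ⟨∑ s, (m : ENNReal) * (if ∀ i < j, s.1 + g i s.2 = b i then W s else 0), fun w => ?_⟩
    have hw : wgt m D g j0 j (fun i => if i < j then b i else a i) w = if w = a j then 1 else 0 := by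
      unfold wgt
      rw [if_neg hj, if_pos]
      · simp
      · simpa [hlt] using hfr
    rw [hw, Finset.sum_mul]
    refine Finset.sum_congr rfl fun s _ => ?_
    rw [Fintype.sum_sum_type, Finset.sum_eq_zero, zero_add]
    · have : ∀ x : Fin m, (if (∀ i < j, (stepT D s (Sum.inr x : E ⊕ Fin m)).1 +
            g i (stepT D s (Sum.inr x : E ⊕ Fin m)).2 = b i) ∧
            (stepT D s (Sum.inr x : E ⊕ Fin m)).1 + g j (stepT D s (Sum.inr x : E ⊕ Fin m)).2 = w
            then W s else 0) =
          (if ∀ i < j, s.1 + g i s.2 = b i then W s else 0) * if w = a j then 1 else 0 := by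
        intro x
        by_cases h0 : W s = 0
        · simp [h0]
        · have h3 := hW0 s h0 j
          by_cases h1 : ∀ i < j, s.1 + g i s.2 = b i
          · by_cases h2 : w = a j
            · rw [if_pos h1, if_pos h2, mul_one]
              exact if_pos ⟨h1, h3.trans h2.symm⟩
            · rw [if_neg h2, mul_zero]
              exact if_neg (fun h => h2 (h.2.symm.trans h3))
          · rw [if_neg h1, zero_mul]
            exact if_neg (fun h => h1 h.1)
      rw [Finset.sum_congr rfl fun x _ => this x, Finset.sum_const, Finset.card_univ,
        Fintype.card_fin, nsmul_eq_mul, mul_assoc]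
    · intro e _
      by_cases h0 : W s = 0
      · simp [h0]
      · rw [if_neg]
        rintro ⟨h1, _⟩
        have h2 : s.1 + D s.2 + g j0 e = b j0 := h1 j0 hlt
        rw [hg0, add_zero] at h2
        have h3 := hW0 s h0 j
        obtain ⟨hm, e0, he0⟩ := hfr
        apply H5 hm j e0 s.2
        rw [← he0, ← h2, ← h3]; abel
  · refine ⟨∑ s, if s.1 + D s.2 = b j0 then W s else 0, fun w => ?_⟩
    have hw : wgt m D g j0 j (fun i => if i < j then b i else a i) w =
        ∑ e, if (∀ i < j, b j0 + g i e = b i) ∧ b j0 + g j e = w then 1 else 0 := by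
      unfold wgt
      rw [if_neg hj, if_neg]
      · refine Finset.sum_congr rfl fun e _ => ?_
        congr 1
        simp only [hlt, if_true, eq_iff_iff]
        refine and_congr_left fun _ => forall_congr' fun i => forall_congr' fun hi => ?_
        rw [if_pos hi]
      · simpa [hlt] using hfr
    rw [hw, Finset.sum_mul]
    refine Finset.sum_congr rfl fun s _ => ?_
    rw [Fintype.sum_sum_type, add_comm, Finset.sum_eq_zero, zero_add, Finset.mul_sum]
    · refine Finset.sum_congr rfl fun e _ => ?_
      by_cases h : s.1 + D s.2 = b j0
      · have h' : ∀ z, (stepT D s (Sum.inl e : E ⊕ Fin m)).1 + z = b j0 + z := fun z => by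
          rw [← h]; rfl
        have h'' : (stepT D s (Sum.inl e : E ⊕ Fin m)).2 = e := rfl
        simp only [h, h', h'', if_true, mul_ite, mul_one, mul_zero]
      · rw [if_neg h, zero_mul]
        refine if_neg ?_
        rintro ⟨h1, _⟩
        have : s.1 + D s.2 + g j0 e = b j0 := h1 j0 hlt
        rw [hg0, add_zero] at this
        exact h this
    · intro x _
      by_cases h0 : W s = 0
      · simp [h0]
      · refine if_neg ?_
        rintro ⟨h1, _⟩
        have h2 : s.1 + g j0 s.2 = b j0 := h1 j0 hlt
        rw [hg0, add_zero] at h2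
        apply hfr
        refine ⟨Fin.pos x, s.2, ?_⟩
        rw [← hW0 s h0 j, ← h2]; abel

lemma markov_core (D : E → G) (g : Fin k → E → G) (j0 : Fin k) (hj0 : ∀ i, j0 ≤ i)
    (hg0 : ∀ e, g j0 e = 0) (H5 : 0 < m → ∀ j e e', g j e + (D e' - g j e') ≠ 0)
    [MeasurableSpace (G × E)] [DiscreteMeasurableSpace (G × E)] [MeasurableSpace Ω]
    (μ : Measure Ω) (st : ℕ → Ω → G × E) (inp : ℕ → Ω → E ⊕ Fin m)
    (hC : DrivenChain (stepT D) μ st inp) :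
    ∃ f : Fin k → (Fin k → G) → PMF G,
    ∀ (t : ℕ) (j : Fin k) (v : Fin k → ℕ → G) (w : G),
      μ {ω | ((∀ i, ∀ r ≤ t, (st r ω).1 + g i (st r ω).2 = v i r) ∧
              (∀ i < j, (st (t + 1) ω).1 + g i (st (t + 1) ω).2 = v i (t + 1))) ∧
                (st (t + 1) ω).1 + g j (st (t + 1) ω).2 = w} =
        μ {ω | (∀ i, ∀ r ≤ t, (st r ω).1 + g i (st r ω).2 = v i r) ∧
              (∀ i < j, (st (t + 1) ω).1 + g i (st (t + 1) ω).2 = v i (t + 1))} *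
          f j (fun i => if i < j then v i (t + 1) else v i t) w := by
  classical
  have hp : ∀ j (q : Fin k → G), ∃ p : PMF G, ∀ w, wgt m D g j0 j q w =
      (∑ w', wgt m D g j0 j q w') * p w := fun j q =>
    pmf_of_weights _ (fun w => wgt_ne_top D g j0 j q w)
  choose f hf using hp
  refine ⟨f, fun t j v w => ?_⟩
  let _ : MeasurableSpace G := ⊤
  have : DiscreteMeasurableSpace G := ⟨fun _ => trivial⟩
  obtain ⟨c, hc⟩ := cond_uniform D g j0 hg0 μ st inp hC v t
  obtain ⟨F, hF⟩ := markov_sum (m := m) D g j0 hj0 hg0 H5 _ (fun i => v i t) (fun i => v i (t + 1)) c hc j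
  have key : ∀ w, μ {ω | ((∀ i, ∀ r ≤ t, (st r ω).1 + g i (st r ω).2 = v i r) ∧
              (∀ i < j, (st (t + 1) ω).1 + g i (st (t + 1) ω).2 = v i (t + 1))) ∧
                (st (t + 1) ω).1 + g j (st (t + 1) ω).2 = w} =
      F * wgt m D g j0 j (fun i => if i < j then v i (t + 1) else v i t) w *
        ((Fintype.card (E ⊕ Fin m) : ℕ) : ENNReal)⁻¹ := by
    intro w
    rw [← hF w]
    have := chain_sum μ st inp (stepT D) hC t
      (fun p => ∀ i, ∀ r ≤ t, (p r).1 + g i (p r).2 = v i r)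
      (fun p q h hp i r hr => by rw [← h r hr]; exact hp i r hr)
      (fun s u => (∀ i < j, (stepT D s u).1 + g i (stepT D s u).2 = v i (t + 1)) ∧
        (stepT D s u).1 + g j (stepT D s u).2 = w)
    refine Eq.trans ?_ (Eq.trans this ?_)
    · congr 1
      ext ω
      simp only [Set.mem_ofPred_eq, ← hC.step t ω, and_assoc]
    · congr
  have htot := chain_total μ (fun ω => (st (t + 1) ω).1 + g j (st (t + 1) ω).2)
    ((Measurable.of_discrete (f := fun s : G × E => s.1 + g j s.2)).comp (hC.meas_st (t + 1)))
    {ω | (∀ i, ∀ r ≤ t, (st r ω).1 + g i (st r ω).2 = v i r) ∧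
              (∀ i < j, (st (t + 1) ω).1 + g i (st (t + 1) ω).2 = v i (t + 1))}
  simp only [Set.mem_ofPred_eq] at htot
  simp only [key] at htot
  rw [htot, key w, hf, ← Finset.sum_mul, ← Finset.mul_sum]
  ring

end generic2

theorem generic_coupling {G E : Type} [AddCommGroup G] [Fintype G] [Fintype E] [DecidableEq G]
    [Nonempty E] {m k n : ℕ} (hk : 0 < k) (hn : Fintype.card G = n) (hU : Fintype.card E + m = n)
    (D : E → G) (g : Fin k → E → G)
    (hD : ∀ w : G, (∑ e, if D e = w then (1 : ENNReal) else 0) + (if w = 0 then (m : ENNReal) else 0)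
      = 1)
    (mix : Fin k → E → E → E) (hmg : ∀ j e e', g j (mix j e e') = g j e)
    (hmh : ∀ j e e', D (mix j e e') - g j (mix j e e') = D e' - g j e')
    (hmm : ∀ j e e', mix j (mix j e e') (mix j e' e) = e)
    (H3 : ∀ i j, i ≠ j → ∀ e, g i e ≠ g j e)
    (H4 : ∀ i j, i < j → ∀ e e', g i e' + (D e - g j e) ≠ 0)
    (hg0 : ∀ e, g ⟨0, hk⟩ e = 0) : MarkovianAvoidanceCouplingLooped n k := by
  classical
  have H5 : 0 < m → ∀ j e e', g j e + (D e' - g j e') ≠ 0 := by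
    intro hm j e e' h
    have h1 : D (mix j e e') = 0 := by
      rw [← hmh j e e', hmg] at h
      rw [← h]; abel
    have h2 := hD 0
    rw [if_pos rfl] at h2
    have h3 : (1 : ENNReal) ≤ ∑ e, if D e = 0 then (1 : ENNReal) else 0 := by
      refine le_trans ?_ (Finset.single_le_sum (f := fun e => if D e = 0 then (1 : ENNReal) else 0)
        (fun _ _ => zero_le) (Finset.mem_univ (mix j e e')))
      simp [h1]
    have h4 : (1 : ENNReal) ≤ m := by exact_mod_cast hm
    have h5 : (1 : ENNReal) + 1 ≤ 1 := by
      calc (1 : ENNReal) + 1 ≤ _ := add_le_add h3 h4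
        _ = 1 := h2
    norm_num at h5
  let _ : MeasurableSpace (G × E) := ⊤
  have : DiscreteMeasurableSpace (G × E) := ⟨fun _ => trivial⟩
  obtain ⟨Ω, mΩ, μ, st, inp, hμ, hC⟩ := exists_chain_s9 (stepT (m := m) D)
  have eqv : G ≃ Fin n := Fintype.equivFinOfCardEq hn
  refine ⟨Ω, mΩ, μ, fun j t ω => eqv ((st t ω).1 + g j (st t ω).2), hμ, ?_, ?_, ?_, ?_⟩
  · intro j t
    exact (Measurable.of_discrete (f := fun s : G × E => eqv (s.1 + g j s.2))).comp (hC.meas_st t)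
  · intro j t v
    have h := walk_final D (g j) hD (mix j) (hmg j) (hmh j) (hmm j) μ st inp hC
      (fun r => eqv.symm (v r))
    simp only [← Equiv.eq_symm_apply]
    rw [h (t + 1), h t, pow_succ]
    have hc : Fintype.card (E ⊕ Fin m) = n := by simp [hU]
    rw [hc]
    ring
  · refine Filter.Eventually.of_forall fun ω => ⟨?_, ?_⟩
    · intro i j hij h
      exact H3 i j hij _ (add_left_cancel (eqv.injective h))
    · intro t i j
      refine ⟨fun hij h => H3 j i (ne_of_gt hij) _ (add_left_cancel (eqv.injective h)),
        fun hij h => ?_⟩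
      have h := eqv.injective h
      rw [hC.step t ω] at h
      cases hu : inp t ω with
      | inl e =>
        rw [hu] at h
        have h' : (st t ω).1 + D (st t ω).2 + g j e = (st t ω).1 + g i (st t ω).2 := h
        apply H4 j i hij (st t ω).2 e
        have h'' : (st t ω).1 + (D (st t ω).2 + g j e) = (st t ω).1 + g i (st t ω).2 := by
          rw [← h']; abel
        have h3 := add_left_cancel h''
        rw [← h3]; abel
      | inr x =>
        rw [hu] at h
        exact H3 j i (ne_of_lt hij) _ (add_left_cancel h)
  · obtain ⟨f, hf⟩ := markov_core D g ⟨0, hk⟩ (fun i => Nat.zero_le i.1) hg0 H5 μ st inp hC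
    refine ⟨fun j q => (f j (fun i => eqv.symm (q i))).map eqv, fun t j v w => ?_⟩
    have h := hf t j (fun i r => eqv.symm (v i r)) (eqv.symm w)
    simp only [← Equiv.eq_symm_apply]
    rw [h]
    congr 1
    rw [PMF.map_apply, tsum_eq_single (eqv.symm w)]
    · simp only [Equiv.apply_symm_apply, if_true]
      congr 2
      funext i
      split_ifs <;> rfl
    · intro b hb
      rw [if_neg]
      intro h'; exact hb (by rw [h']; simp)

/-- The binary digits of `2 * j`. -/
def dbit (j : ℕ) : ℕ → Bool
  | 0 => false
  | r + 1 => j.testBit r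

lemma dbit_zero (r : ℕ) : dbit 0 r = false := by
  cases r <;> simp [dbit]

lemma dbit_ext {d i j : ℕ} (hi : i < 2 ^ d) (hj : j < 2 ^ d)
    (h : ∀ r < d + 1, dbit i r = dbit j r) : i = j := by
  apply Nat.eq_of_testBit_eq
  intro r
  by_cases hr : r < d
  · exact h (r + 1) (by omega)
  · have : 2 ^ d ≤ 2 ^ r := Nat.pow_le_pow_right (by norm_num) (by omega)
    rw [Nat.testBit_lt_two_pow (by omega), Nat.testBit_lt_two_pow (by omega)]

lemma dbit_low {d i j : ℕ} (hi : i < 2 ^ d) (hj : j < 2 ^ d) (hij : i ≠ j) :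
    ∃ r < d + 1, dbit i r = dbit j r ∧ dbit i (r + 1) ≠ dbit j (r + 1) := by
  have hex : ∃ r, dbit i r ≠ dbit j r := by
    by_contra h
    push Not at h
    exact hij (dbit_ext hi hj fun r _ => h r)
  have hex' : ∃ r < d + 1, dbit i r ≠ dbit j r := by
    by_contra h
    push Not at h
    exact hij (dbit_ext hi hj h)
  classical
  have h1 := Nat.find_spec hex
  have h2 : Nat.find hex < d + 1 := by
    obtain ⟨r, hr, hr'⟩ := hex'
    exact lt_of_le_of_lt (Nat.find_min' hex hr') hr
  cases hf : Nat.find hex with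
  | zero => rw [hf] at h1; exact absurd rfl h1
  | succ r =>
    rw [hf] at h1 h2
    refine ⟨r, by omega, ?_, h1⟩
    have := Nat.find_min hex (m := r) (by omega)
    push Not at this
    exact this

lemma dbit_high {d i j : ℕ} (hj : j < 2 ^ d) (hij : i < j) :
    ∃ r < d + 1, dbit i r = false ∧ dbit j r = true ∧ dbit i (r + 1) = dbit j (r + 1) := by
  have hne : i ^^^ j ≠ 0 := by
    intro h
    rw [Nat.xor_eq_zero_iff] at h
    omega
  obtain ⟨r, hr, hr'⟩ := Nat.exists_most_significant_bit hne
  have hhi : ∀ s, r < s → i.testBit s = j.testBit s := by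
    intro s hs
    have := hr' s hs
    rw [Nat.testBit_xor] at this
    simpa using this
  rw [Nat.testBit_xor] at hr
  have hcase : i.testBit r = false ∧ j.testBit r = true := by
    cases h1 : i.testBit r <;> cases h2 : j.testBit r
    · simp [h1, h2] at hr
    · simp
    · have := Nat.lt_of_testBit r h2 h1 (fun s hs => (hhi s hs).symm)
      omega
    · simp [h1, h2] at hr
  refine ⟨r + 1, ?_, hcase.1, hcase.2, hhi (r + 1) (by omega)⟩
  by_contra h
  have : 2 ^ d ≤ 2 ^ r := Nat.pow_le_pow_right (by norm_num) (by omega)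
  have h3 := Nat.testBit_lt_two_pow (x := j) (i := r) (by omega)
  rw [hcase.2] at h3
  exact absurd h3 (by simp)

/-- The permutation coordinate exchange. -/
def mixf (d j : ℕ) (e e' : Fin (d + 1) → Bool) : Fin (d + 1) → Bool :=
  fun r => if dbit j r then e r else e' r

lemma mixf_mixf (d j : ℕ) (e e' : Fin (d + 1) → Bool) :
    mixf d j (mixf d j e e') (mixf d j e' e) = e := by
  funext r
  unfold mixf
  split_ifs <;> rfl

lemma caseA (d k : ℕ) (hk : 1 ≤ k) (hk' : k ≤ 2 ^ d) :
    MarkovianAvoidanceCouplingLooped (2 ^ (d + 1)) k := by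
  let D : (Fin (d + 1) → Bool) → (Fin (d + 1) → ZMod 2) := fun e r => if e r then 1 else 0
  let g : Fin k → (Fin (d + 1) → Bool) → (Fin (d + 1) → ZMod 2) := fun j e r =>
    (if dbit j r then (if e r then 1 else 0) + 1 else 0) + (if dbit j (r + 1) then 1 else 0)
  refine generic_coupling (G := Fin (d + 1) → ZMod 2) (E := Fin (d + 1) → Bool) (m := 0) hk
    ?_ ?_ D g ?_ (fun j => mixf d j) ?_ ?_ ?_ ?_ ?_ ?_
  · simp [ZMod.card]
  · simp
  · intro w
    have : ∀ e, (D e = w) ↔ (fun r => decide (w r = 1)) = e := by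
      intro e
      constructor
      · rintro rfl
        funext r
        simp [D]
      · rintro rfl
        funext r
        have h2 : ∀ x : ZMod 2, (if decide (x = 1) = true then (1 : ZMod 2) else 0) = x := by decide
        exact h2 (w r)
    simp [this]
  · intro j e e'
    funext r
    simp only [g, mixf]
    split_ifs <;> simp_all
  · intro j e e'
    funext r
    simp only [g, D, mixf, Pi.sub_apply]
    by_cases h : dbit j r
    · simp only [h, if_true]; abel
    · simp [h]
  · intro j e e'
    exact mixf_mixf _ _ _ _
  · intro i j hij e h
    obtain ⟨r, hr, h1, h2⟩ := dbit_low (d := d) (lt_of_lt_of_le i.2 hk') (lt_of_lt_of_le j.2 hk')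
      (fun h => hij (Fin.ext h))
    have h3 := congrFun h ⟨r, hr⟩
    simp only [g, h1] at h3
    have h4 := add_left_cancel h3
    revert h2 h4
    cases dbit i (r + 1) <;> cases dbit j (r + 1) <;> simp
  · intro i j hij e e' h
    obtain ⟨r, hr, h1, h2, h3⟩ := dbit_high (d := d) (i := i) (lt_of_lt_of_le j.2 hk') hij
    have h4 := congrFun h ⟨r, hr⟩
    simp only [g, D, Pi.add_apply, Pi.sub_apply, Pi.zero_apply, h1, h2, h3, if_true] at h4
    have h5 : ∀ x y : Bool, ((if false = true then (if e' ⟨r, hr⟩ then (1 : ZMod 2) else 0) + 1 else 0)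
        + (if x then 1 else 0)) + ((if y then 1 else 0) -
        (((if y then 1 else 0) + 1) + (if x then 1 else 0))) ≠ 0 := by
      simp only [Bool.false_eq_true, if_false]
      decide
    exact h5 _ _ h4
  · intro e
    funext r
    simp [g, dbit_zero]

lemma digits_zero (p : ℕ) (a : Fin p → ℤ) (ha : ∀ r, |a r| ≤ 1) (h : ∑ r, a r * 2 ^ (r : ℕ) = 0) :
    ∀ r, a r = 0 := by
  induction p with
  | zero => intro r; exact r.elim0
  | succ p ih =>
    rw [Fin.sum_univ_succ] at h
    simp only [Fin.val_zero, pow_zero, mul_one, Fin.val_succ, pow_succ, ← mul_assoc] at h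
    rw [← Finset.sum_mul] at h
    have h0 := abs_le.1 (ha 0)
    have h1 : a 0 = 0 := by omega
    have h2 := ih (fun r => a r.succ) (fun r => ha _) (by omega)
    intro r
    refine Fin.cases h1 h2 r

lemma geom_two (p : ℕ) : ∑ r : Fin p, (2 : ℤ) ^ (r : ℕ) = 2 ^ p - 1 := by
  induction p with
  | zero => simp
  | succ p ih =>
    rw [Fin.sum_univ_castSucc]
    simp only [Fin.val_castSucc, Fin.val_last, ih]
    ring

lemma digits_mod (p : ℕ) (a : Fin p → ℤ) (ha : ∀ r, |a r| ≤ 1)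
    (h : ((2 ^ p + 1 : ℕ) : ℤ) ∣ ∑ r, a r * 2 ^ (r : ℕ)) : ∀ r, a r = 0 := by
  apply digits_zero p a ha
  apply Int.eq_zero_of_abs_lt_dvd h
  calc |∑ r, a r * 2 ^ (r : ℕ)| ≤ ∑ r, |a r * 2 ^ (r : ℕ)| := Finset.abs_sum_le_sum_abs _ _
    _ ≤ ∑ r : Fin p, (2 : ℤ) ^ (r : ℕ) := by
      refine Finset.sum_le_sum fun r _ => ?_
      rw [abs_mul, abs_of_nonneg (a := (2 : ℤ) ^ (r : ℕ)) (by positivity)]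
      exact mul_le_of_le_one_left (by positivity) (ha r)
    _ < _ := by rw [geom_two]; push_cast; omega

lemma dbit_sum (d j : ℕ) (hj : j < 2 ^ d) :
    ∑ r : Fin (d + 1), (if dbit j r then (2 : ℤ) ^ (r : ℕ) else 0) = 2 * j := by
  have h : ∀ d, ∑ r : Fin d, (if j.testBit r then (2 : ℤ) ^ (r : ℕ) else 0) = ((j % 2 ^ d : ℕ) : ℤ) := by
    intro d
    induction d with
    | zero => simp [Nat.mod_one]
    | succ d ih =>
      rw [Fin.sum_univ_castSucc, Nat.mod_pow_succ]
      simp only [Fin.val_castSucc, Fin.val_last, ih]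
      have h1 : j.testBit d = decide (j / 2 ^ d % 2 = 1) := by
        rw [Nat.testBit_eq_decide_div_mod_eq]
      rw [h1]
      rcases Nat.mod_two_eq_zero_or_one (j / 2 ^ d) with h2 | h2 <;> simp [h2]
  rw [Fin.sum_univ_succ]
  have h2 := h d
  rw [Nat.mod_eq_of_lt hj] at h2
  rw [← h2, Finset.mul_sum]
  have h0 : dbit j (0 : Fin (d + 1)).val = false := rfl
  rw [h0]
  simp only [Bool.false_eq_true, if_false, zero_add]
  refine Finset.sum_congr rfl fun r _ => ?_
  have h1 : dbit j r.succ.val = j.testBit r := rfl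
  rw [h1]
  by_cases h3 : j.testBit r
  · rw [if_pos h3, if_pos h3, Fin.val_succ]; ring
  · rw [if_neg h3, if_neg h3]; ring

/-- The sign of a Boolean. -/
def sgb (b : Bool) : ℤ := if b then 1 else -1

lemma caseB (d k : ℕ) (hk : 1 ≤ k) (hk' : k ≤ 2 ^ d) :
    MarkovianAvoidanceCouplingLooped (2 ^ (d + 1) + 1) k := by
  let D : (Fin (d + 1) → Bool) → ZMod (2 ^ (d + 1) + 1) := fun e =>
    ((∑ r, sgb (e r) * 2 ^ (r : ℕ) : ℤ) : ZMod (2 ^ (d + 1) + 1))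
  let g : Fin k → (Fin (d + 1) → Bool) → ZMod (2 ^ (d + 1) + 1) := fun j e =>
    ((∑ r : Fin (d + 1), (if dbit j r then sgb (e r) else 0) * 2 ^ (r : ℕ) : ℤ) :
      ZMod (2 ^ (d + 1) + 1))
  have hDg : ∀ j e, D e - g j e =
      ((∑ r : Fin (d + 1), (if dbit j r then 0 else sgb (e r)) * 2 ^ (r : ℕ) : ℤ) :
      ZMod (2 ^ (d + 1) + 1)) := by
    intro j e
    simp only [D, g]
    rw [← Int.cast_sub, ← Finset.sum_sub_distrib]
    congr 1
    refine Finset.sum_congr rfl fun r _ => ?_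
    split_ifs <;> ring
  have hinj : Function.Injective D := by
    intro e e' h
    simp only [D] at h
    rw [← sub_eq_zero, ← Int.cast_sub, ZMod.intCast_zmod_eq_zero_iff_dvd, ← Finset.sum_sub_distrib]
      at h
    have h1 : ∑ r, (sgb (e r) * 2 ^ (r : ℕ) - sgb (e' r) * 2 ^ (r : ℕ)) =
        2 * ∑ r : Fin (d + 1), ((if e r then 1 else 0) - (if e' r then 1 else 0)) *
          (2 : ℤ) ^ (r : ℕ) := by
      rw [Finset.mul_sum]
      refine Finset.sum_congr rfl fun r _ => ?_
      cases e r <;> cases e' r <;> simp [sgb] <;> ring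
    rw [h1] at h
    have hcop : IsCoprime (((2 ^ (d + 1) + 1 : ℕ) : ℤ)) 2 := ⟨1, -2 ^ d, by push_cast; ring⟩
    have h2 := digits_mod (d + 1) _ (fun r => by
      cases e r <;> cases e' r <;> simp) (hcop.dvd_of_dvd_mul_left h)
    funext r
    have := h2 r
    revert this
    cases e r <;> cases e' r <;> simp
  have hne : ∀ e, D e ≠ 0 := by
    intro e h
    simp only [D] at h
    rw [ZMod.intCast_zmod_eq_zero_iff_dvd] at h
    have := digits_mod (d + 1) _ (fun r => by cases e r <;> simp [sgb]) h 0
    revert this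
    cases e 0 <;> simp [sgb]
  refine generic_coupling (G := ZMod (2 ^ (d + 1) + 1)) (E := Fin (d + 1) → Bool) (m := 1) hk
    ?_ ?_ D g ?_ (fun j => mixf d j) ?_ ?_ ?_ ?_ ?_ ?_
  · simp [ZMod.card]
  · simp
  · intro w
    by_cases hw : w = 0
    · subst hw; simp [hne]
    · have himg : Finset.univ.image D = Finset.univ.erase 0 := by
        apply Finset.eq_of_subset_of_card_le
        · intro x hx
          obtain ⟨e, _, rfl⟩ := Finset.mem_image.1 hx
          simp [hne]
        · rw [Finset.card_image_of_injective _ hinj, Finset.card_erase_of_mem (Finset.mem_univ _)]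
          simp [ZMod.card]
      have : w ∈ Finset.univ.image D := by rw [himg]; simp [hw]
      obtain ⟨e0, _, rfl⟩ := Finset.mem_image.1 this
      simp [hinj.eq_iff, hne]
  · intro j e e'
    simp only [g, mixf]
    congr 1
    refine Finset.sum_congr rfl fun r _ => ?_
    split_ifs <;> rfl
  · intro j e e'
    rw [hDg, hDg]
    congr 1
    refine Finset.sum_congr rfl fun r _ => ?_
    simp only [mixf]
    split_ifs <;> rfl
  · intro j e e'
    exact mixf_mixf _ _ _ _
  · intro i j hij e h
    apply hij
    apply Fin.ext
    apply dbit_ext (d := d) (lt_of_lt_of_le i.2 hk') (lt_of_lt_of_le j.2 hk')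
    simp only [g] at h
    rw [← sub_eq_zero, ← Int.cast_sub, ZMod.intCast_zmod_eq_zero_iff_dvd, ← Finset.sum_sub_distrib]
      at h
    simp only [← sub_mul] at h
    have h2 := digits_mod (d + 1) _ (fun r => by
      cases e r <;> cases dbit i r <;> cases dbit j r <;> simp [sgb]) h
    intro r hr
    have := h2 ⟨r, hr⟩
    revert this
    simp only []
    cases e ⟨r, hr⟩ <;> cases dbit i r <;> cases dbit j r <;> simp [sgb]
  · intro i j hij e e' h
    rw [hDg] at h
    simp only [g] at h
    rw [← Int.cast_add, ZMod.intCast_zmod_eq_zero_iff_dvd, ← Finset.sum_add_distrib] at h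
    simp only [← add_mul] at h
    have hlt : (i : ℕ) < j := hij
    have h0 := Int.eq_zero_of_abs_lt_dvd h (by
      calc |∑ r : Fin (d + 1), ((if dbit i r then sgb (e' r) else 0) +
            (if dbit j r then 0 else sgb (e r))) * (2 : ℤ) ^ (r : ℕ)|
          ≤ ∑ r : Fin (d + 1), |((if dbit i r then sgb (e' r) else 0) +
            (if dbit j r then 0 else sgb (e r))) * (2 : ℤ) ^ (r : ℕ)| :=
            Finset.abs_sum_le_sum_abs _ _
        _ ≤ ∑ r : Fin (d + 1), ((if dbit i r then (2 : ℤ) ^ (r : ℕ) else 0) +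
            ((2 : ℤ) ^ (r : ℕ) - (if dbit j r then (2 : ℤ) ^ (r : ℕ) else 0))) := by
          refine Finset.sum_le_sum fun r _ => ?_
          rw [abs_mul, abs_of_nonneg (a := (2 : ℤ) ^ (r : ℕ)) (by positivity)]
          have hp : (0 : ℤ) ≤ 2 ^ (r : ℕ) := by positivity
          generalize (2 : ℤ) ^ (r : ℕ) = P at hp
          cases dbit i r <;> cases dbit j r <;> cases e r <;> cases e' r <;> simp [sgb] <;> linarith
        _ < _ := by
          rw [Finset.sum_add_distrib, Finset.sum_sub_distrib, geom_two,
            dbit_sum d i (lt_of_lt_of_le i.2 hk'), dbit_sum d j (lt_of_lt_of_le j.2 hk')]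
          push_cast
          omega)
    rw [Fin.sum_univ_succ] at h0
    simp only [Fin.val_zero, pow_zero, mul_one, Fin.val_succ, pow_succ, ← mul_assoc] at h0
    rw [← Finset.sum_mul] at h0
    have h1 : ∀ x : ℕ, dbit x 0 = false := fun _ => rfl
    simp only [h1, Bool.false_eq_true, if_false, zero_add] at h0
    have h2 : sgb (e 0) = 1 ∨ sgb (e 0) = -1 := by cases e 0 <;> simp [sgb]
    omega
  · intro e
    simp [g, dbit_zero]

/-- For every `d ≥ 1` and every `k` with `1 ≤ k ≤ 2^d`, there is a Markovian
avoidance coupling of `k` walkers on `K_n^*` both for `n = 2^(d+1)` and for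
`n = 2^(d+1) + 1`. -/
theorem markovian_avoidance_coupling_looped_powers_of_two
    (d k : ℕ) (hd : 1 ≤ d) (hk : 1 ≤ k) (hk' : k ≤ 2 ^ d) :
    MarkovianAvoidanceCouplingLooped (2 ^ (d + 1)) k ∧
    MarkovianAvoidanceCouplingLooped (2 ^ (d + 1) + 1) k := by
  exact ⟨caseA d k hk hk', caseB d k hk hk'⟩
end

section
/- For every integer d ≥ 1 and every k with 1 ≤ k ≤ 2^d, there exists a Markovian avoidance coupling of k walkers on the (loopless) complete graph K_n for n = 2^{d+1} + 1. -/
open MeasureTheory ProbabilityTheory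

namespace AvCoup

/-- Sign of a coin. -/
def sg (b : Bool) : ℤ := if b then 1 else -1

/-- signed sum of powers of two -/
def S {m : ℕ} (e : Fin m → ℤ) : ℤ := ∑ r, e r * 2 ^ (r : ℕ)

lemma S_succ {m : ℕ} (e : Fin (m + 1) → ℤ) : S e = e 0 + 2 * S (fun r => e r.succ) := by
  unfold S
  rw [Fin.sum_univ_succ, Finset.mul_sum]
  simp only [Fin.val_zero, pow_zero, mul_one, Fin.val_succ]
  congr 1
  apply Finset.sum_congr rfl
  intro r _
  ring

lemma S_zero_imp : ∀ (m : ℕ) (e : Fin m → ℤ), (∀ r, |e r| ≤ 1) → S e = 0 → ∀ r, e r = 0 := by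
  intro m
  induction m with
  | zero => intro e _ _ r; exact r.elim0
  | succ m ih =>
    intro e he h
    rw [S_succ] at h
    have h0 := abs_le.1 (he 0)
    have e0 : e 0 = 0 := by omega
    have := ih (fun r => e r.succ) (fun r => he _) (by omega)
    intro r
    refine Fin.cases e0 this r

lemma S_abs : ∀ (m : ℕ) (e : Fin m → ℤ), |S e| ≤ S (fun r => |e r|) := by
  intro m e
  unfold S
  refine (Finset.abs_sum_le_sum_abs _ _).trans (le_of_eq ?_)
  apply Finset.sum_congr rfl
  intro r _
  rw [abs_mul, abs_pow]; simp

lemma S_mono {m : ℕ} {e e' : Fin m → ℤ} (h : ∀ r, e r ≤ e' r) : S e ≤ S e' := by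
  unfold S
  exact Finset.sum_le_sum fun r _ => mul_le_mul_of_nonneg_right (h r) (by positivity)

lemma S_one : ∀ m : ℕ, S (fun _ : Fin m => (1 : ℤ)) = 2 ^ m - 1 := by
  intro m
  induction m with
  | zero => simp [S]
  | succ m ih => rw [S_succ, ih]; ring

lemma S_add {m : ℕ} (e e' : Fin m → ℤ) : S (fun r => e r + e' r) = S e + S e' := by
  simp [S, add_mul, Finset.sum_add_distrib]

lemma S_sub {m : ℕ} (e e' : Fin m → ℤ) : S (fun r => e r - e' r) = S e - S e' := by
  simp [S, sub_mul, Finset.sum_sub_distrib]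

lemma S_bits : ∀ (m v : ℕ), v < 2 ^ m →
    S (fun r : Fin m => if v.testBit r then (1 : ℤ) else 0) = v := by
  intro m
  induction m with
  | zero => intro v hv; simp [S]; omega
  | succ m ih =>
    intro v hv
    rw [S_succ]
    have := ih (v / 2) (by rw [pow_succ] at hv; omega)
    simp only [Fin.val_succ, Nat.testBit_succ]
    rw [this]
    simp only [Fin.val_zero, Nat.testBit_zero]
    by_cases h : v % 2 = 1
    · simp [h]; omega
    · simp [h]; omega

/-- nonzero modulo `2^m+1` -/
lemma S_cast_ne {m : ℕ} (e : Fin m → ℤ) (he : S e ≠ 0) (hb : |S e| < 2 ^ m + 1) :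
    ((S e : ℤ) : ZMod (2 ^ m + 1)) ≠ 0 := by
  intro h
  rw [ZMod.intCast_zmod_eq_zero_iff_dvd] at h
  apply he
  apply Int.eq_zero_of_abs_lt_dvd h
  push_cast
  exact hb

lemma S_cast_ne' {m : ℕ} (e : Fin m → ℤ) (he : ∀ r, |e r| ≤ 1) (h : ∃ r, e r ≠ 0) :
    ((S e : ℤ) : ZMod (2 ^ m + 1)) ≠ 0 := by
  apply S_cast_ne
  · intro h0
    obtain ⟨r, hr⟩ := h
    exact hr (S_zero_imp m e he h0 r)
  · have := S_abs m e
    have h2 := S_mono he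
    rw [S_one] at h2
    linarith

lemma sg_abs (b : Bool) : |sg b| = 1 := by cases b <;> simp [sg]

lemma sg_ne (b : Bool) : sg b ≠ 0 := by cases b <;> simp [sg]

/-- partial signed sums -/
def Q {m : ℕ} (c : Fin m → Bool) (β : Fin m → Bool) : ℤ :=
  S (fun r => if c r then sg (β r) else 0)

/-- code of a walker -/
def code {m : ℕ} (j : ℕ) : Fin m → Bool := fun r => (2 * j - 1).testBit r

lemma code_zero {m : ℕ} : (code 0 : Fin m → Bool) = fun _ => false := by
  funext r; simp [code]

lemma Q_zero {m : ℕ} (β : Fin m → Bool) : Q (code 0) β = 0 := by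
  simp [Q, code_zero, S]

lemma code_odd {d : ℕ} {j : ℕ} (hj : 1 ≤ j) : (code j : Fin (d + 1) → Bool) 0 = true := by
  simp [code, Nat.testBit_zero]; omega

lemma code_ne {d i j : ℕ} (hi : i < 2 ^ d) (hj : j < 2 ^ d) (h : i ≠ j) :
    ∃ r : Fin (d + 1), code i r ≠ code j r := by
  by_contra hc
  push Not at hc
  have h1 := S_bits (d + 1) (2 * i - 1) (by rw [pow_succ]; omega)
  have h2 := S_bits (d + 1) (2 * j - 1) (by rw [pow_succ]; omega)
  simp only [code] at hc
  simp only [hc] at h1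
  rw [h1] at h2
  omega

lemma code_not_full {d i : ℕ} (hi : i < 2 ^ d) :
    ∃ r : Fin (d + 1), code i r = false := by
  by_contra hc
  simp only [Bool.not_eq_false, not_exists] at hc
  have h1 := S_bits (d + 1) (2 * i - 1) (by rw [pow_succ]; omega)
  simp only [code] at hc
  simp only [hc] at h1
  simp only [if_true] at h1
  rw [S_one, pow_succ] at h1
  have : (1:ℤ) ≤ 2 ^ d := one_le_pow₀ (by norm_num)
  have h3 : (i : ℤ) < 2 ^ d := by exact_mod_cast hi
  omega

lemma avoid_same {d i j : ℕ} (hi : i < 2 ^ d) (hj : j < 2 ^ d) (h : i ≠ j)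
    (β : Fin (d + 1) → Bool) :
    ((Q (code i) β : ℤ) : ZMod (2 ^ (d + 1) + 1)) ≠ ((Q (code j) β : ℤ) : ZMod (2 ^ (d + 1) + 1)) := by
  rw [← sub_ne_zero, ← Int.cast_sub]
  unfold Q
  rw [← S_sub]
  apply S_cast_ne'
  · intro r
    have := sg_abs (β r)
    split_ifs <;> simp [this]
  · obtain ⟨r, hr⟩ := code_ne hi hj h
    refine ⟨r, ?_⟩
    have := sg_ne (β r)
    split_ifs with h1 h2 h2 <;> simp_all

lemma full_ne {m : ℕ} (hm : 0 < m) (β : Fin m → Bool) :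
    ((S (fun r => sg (β r)) : ℤ) : ZMod (2 ^ m + 1)) ≠ 0 := by
  apply S_cast_ne'
  · intro r; exact (sg_abs _).le
  · exact ⟨⟨0, hm⟩, sg_ne _⟩

lemma full_inj {m : ℕ} (β β' : Fin m → Bool)
    (h : ((S (fun r => sg (β r)) : ℤ) : ZMod (2 ^ m + 1)) = ((S (fun r => sg (β' r)) : ℤ) : ZMod (2 ^ m + 1))) :
    β = β' := by
  by_contra hne
  obtain ⟨r, hr⟩ := Function.ne_iff.1 hne
  let e : Fin m → ℤ := fun r => if β r = β' r then 0 else sg (β r)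
  have he : S (fun r => sg (β r)) - S (fun r => sg (β' r)) = 2 * S e := by
    rw [← S_sub]
    unfold S
    rw [Finset.mul_sum]
    apply Finset.sum_congr rfl
    intro r _
    simp only [e]
    cases β r <;> cases β' r <;> simp [sg]
  have h1 : ((S e : ℤ) : ZMod (2 ^ m + 1)) ≠ 0 := by
    apply S_cast_ne'
    · intro r; simp only [e]; split_ifs
      · simp
      · exact (sg_abs _).le
    · exact ⟨r, by simp [e, hr, sg_ne]⟩
  have h2 : ((2 * S e : ℤ) : ZMod (2 ^ m + 1)) = 0 := by
    rw [← he, Int.cast_sub, h, sub_self]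
  rw [Ne, ZMod.intCast_zmod_eq_zero_iff_dvd] at h1
  rw [ZMod.intCast_zmod_eq_zero_iff_dvd] at h2
  by_cases hm : m = 0
  · subst hm; exact r.elim0
  · apply h1
    refine IsCoprime.dvd_of_dvd_mul_left ?_ h2
    push_cast
    refine ⟨1, -2 ^ (m - 1), ?_⟩
    obtain ⟨k, rfl⟩ := Nat.exists_eq_succ_of_ne_zero hm
    simp [pow_succ]

lemma full_surj {m : ℕ} (hm : 0 < m) (y : ZMod (2 ^ m + 1)) (hy : y ≠ 0) :
    ∃ β : Fin m → Bool, ((S (fun r => sg (β r)) : ℤ) : ZMod (2 ^ m + 1)) = y := by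
  classical
  let F : (Fin m → Bool) → {y : ZMod (2 ^ m + 1) // y ≠ 0} := fun β => ⟨_, full_ne hm β⟩
  have hF : Function.Injective F := by
    intro a b h
    exact full_inj a b (congrArg Subtype.val h)
  have hb : Function.Bijective F := by
    rw [Fintype.bijective_iff_injective_and_card]
    refine ⟨hF, ?_⟩
    rw [Fintype.card_subtype_compl, ZMod.card]
    simp
  obtain ⟨β, hβ⟩ := hb.2 ⟨y, hy⟩
  exact ⟨β, congrArg Subtype.val hβ⟩

lemma avoid_next {d i j : ℕ} (hi : i < 2 ^ d) (h : j < i)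
    (β β' : Fin (d + 1) → Bool) :
    ((S (fun r => sg (β r)) + Q (code j) β' : ℤ) : ZMod (2 ^ (d + 1) + 1)) ≠
      ((Q (code i) β : ℤ) : ZMod (2 ^ (d + 1) + 1)) := by
  rw [← sub_ne_zero, ← Int.cast_sub]
  have hQ : S (fun r => sg (β r)) + Q (code j) β' - Q (code i) β =
      S (fun r => (if code i r then 0 else sg (β r)) + if code j r then sg (β' r) else 0) := by
    unfold Q
    rw [← S_add, ← S_sub]
    congr 1
    funext r
    split_ifs <;> ring
  rw [hQ]
  rcases Nat.eq_zero_or_pos j with rfl | hj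
  · apply S_cast_ne'
    · intro r
      have := sg_abs (β r)
      simp only [code_zero]
      split_ifs <;> simp_all
    · obtain ⟨r, hr⟩ := code_not_full hi
      exact ⟨r, by simp [hr, code_zero, sg_ne]⟩
  · apply S_cast_ne
    · rw [S_succ, code_odd hj, code_odd (by omega : 1 ≤ i)]
      simp only [if_true, zero_add]
      have : sg (β' 0) = 1 ∨ sg (β' 0) = -1 := by cases β' 0 <;> simp [sg]
      omega
    · have h1 := S_bits (d + 1) (2 * i - 1) (by rw [pow_succ]; omega)
      have h2 := S_bits (d + 1) (2 * j - 1) (by rw [pow_succ]; omega)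
      refine lt_of_le_of_lt (S_abs _ _) ?_
      have h3 : S (fun r : Fin (d + 1) => |(if code i r then 0 else sg (β r)) + if code j r then sg (β' r) else 0|)
          ≤ S (fun r : Fin (d + 1) => 1 - (if (2 * i - 1).testBit r then (1 : ℤ) else 0) +
             (if (2 * j - 1).testBit r then (1 : ℤ) else 0)) := by
        apply S_mono
        intro r
        simp only [code]
        refine (abs_add_le _ _).trans ?_
        have ha := sg_abs (β r)
        have hb := sg_abs (β' r)
        by_cases hx : (2 * i - 1).testBit (r : ℕ) = true <;>
          by_cases hy : (2 * j - 1).testBit (r : ℕ) = true <;>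
          simp [hx, hy, ha, hb]
      rw [S_add, S_sub, h1, h2, S_one] at h3
      omega

end AvCoup

namespace AvCoup

/-- coin space -/
abbrev Om (m : ℕ) : Type := ℕ × Fin m → Bool

/-- the product of fair coins -/
noncomputable def mu (m : ℕ) : Measure (Om m) :=
  Measure.infinitePi (fun _ => (PMF.uniformOfFintype Bool).toMeasure)

instance (m : ℕ) : IsProbabilityMeasure (mu m) := by unfold mu; infer_instance

lemma coin_flip (b : Bool) :
    ((PMF.uniformOfFintype Bool).toMeasure).map (fun a => xor a b) =
      (PMF.uniformOfFintype Bool).toMeasure := by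
  refine Measure.ext_of_singleton fun a => ?_
  rw [Measure.map_apply (measurable_of_finite _) (measurableSet_singleton a)]
  have : (fun a => xor a b) ⁻¹' {a} = {xor a b} := by
    ext x; cases a <;> cases b <;> cases x <;> simp
  rw [this, PMF.toMeasure_apply_singleton _ _ (measurableSet_singleton _),
    PMF.toMeasure_apply_singleton _ _ (measurableSet_singleton _)]
  simp

lemma flip_map {m : ℕ} (g : ℕ × Fin m → Bool) :
    (mu m).map (fun ω p => xor (ω p) (g p)) = mu m := by
  unfold mu
  rw [Measure.infinitePi_map_pi _ (f := fun p a => xor a (g p)) (fun i => measurable_of_finite _)]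
  simp only [coin_flip]

/-- measurable events not depending on the coins `(s r, r)` -/
def Ind {m : ℕ} (s : Fin m → ℕ) (A : Set (Om m)) : Prop :=
  MeasurableSet A ∧ ∀ ω ω' : Om m, (∀ p : ℕ × Fin m, p.1 ≠ s p.2 → ω p = ω' p) → ω ∈ A → ω' ∈ A

lemma meas_B {m : ℕ} (s : Fin m → ℕ) (β : Fin m → Bool) :
    MeasurableSet {ω : Om m | (fun r => ω (s r, r)) = β} := by
  have : Measurable (fun ω : Om m => (fun r => ω (s r, r))) := by fun_prop
  exact this (measurableSet_singleton β)

lemma core_eq {m : ℕ} (s : Fin m → ℕ) {A : Set (Om m)} (hA : Ind s A) (β β' : Fin m → Bool) :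
    mu m (A ∩ {ω | (fun r => ω (s r, r)) = β}) = mu m (A ∩ {ω | (fun r => ω (s r, r)) = β'}) := by
  let g : ℕ × Fin m → Bool := fun p => if p.1 = s p.2 then xor (β p.2) (β' p.2) else false
  have hT : Measurable (fun (ω : Om m) (p : ℕ × Fin m) => xor (ω p) (g p)) := by
    refine measurable_pi_lambda _ fun p => ?_
    exact (measurable_of_finite (fun a => xor a (g p))).comp (measurable_pi_apply p)
  conv_rhs => rw [← flip_map g]
  rw [Measure.map_apply hT (hA.1.inter (meas_B s β'))]
  congr 1
  ext ω
  simp only [Set.mem_inter_iff, Set.mem_ofPred_eq, Set.mem_preimage]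
  have hx : ∀ p : ℕ × Fin m, p.1 ≠ s p.2 → ω p = xor (ω p) (g p) := by
    intro p hp; simp [g, hp]
  constructor
  · rintro ⟨h1, h2⟩
    refine ⟨hA.2 _ _ hx h1, ?_⟩
    funext r
    have := congrFun h2 r
    simp only [g, if_true]
    rw [this]
    cases β r <;> cases β' r <;> rfl
  · rintro ⟨h1, h2⟩
    refine ⟨hA.2 _ _ (fun p hp => (hx p hp).symm) h1, ?_⟩
    funext r
    have := congrFun h2 r
    simp only [g, if_true] at this
    revert this
    cases β r <;> cases β' r <;> cases ω (s r, r) <;> simp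

lemma sum_fin {m : ℕ} (s : Fin m → ℕ) {A : Set (Om m)} (hA : MeasurableSet A)
    (E : Finset (Fin m → Bool)) :
    mu m (A ∩ {ω | (fun r => ω (s r, r)) ∈ E}) =
      ∑ β ∈ E, mu m (A ∩ {ω | (fun r => ω (s r, r)) = β}) := by
  rw [← measure_biUnion_finset]
  · congr 1
    ext ω
    simp
  · intro a _ b _ hab
    rw [Function.onFun, Set.disjoint_left]
    rintro ω ⟨_, h1⟩ ⟨_, h2⟩
    exact hab (h1.symm.trans h2)
  · intro b _
    exact hA.inter (meas_B s b)

lemma core {m : ℕ} (s : Fin m → ℕ) {A : Set (Om m)} (hA : Ind s A) (β : Fin m → Bool) :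
    mu m (A ∩ {ω | (fun r => ω (s r, r)) = β}) = mu m A * ((2 ^ m : ℕ) : ENNReal)⁻¹ := by
  have h := sum_fin s hA.1 Finset.univ
  simp only [Finset.mem_univ, Set.ofPred_true, Set.inter_univ] at h
  rw [Finset.sum_congr rfl (fun β' _ => core_eq s hA β' β)] at h
  rw [Finset.sum_const, Finset.card_univ, Fintype.card_fun, Fintype.card_bool, Fintype.card_fin,
    nsmul_eq_mul] at h
  rw [h, mul_comm, ← mul_assoc, ENNReal.inv_mul_cancel, one_mul]
  · simp
  · simp

lemma core_fin {m : ℕ} (s : Fin m → ℕ) {A : Set (Om m)} (hA : Ind s A)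
    (E : Finset (Fin m → Bool)) :
    mu m (A ∩ {ω | (fun r => ω (s r, r)) ∈ E}) =
      E.card * (mu m A * ((2 ^ m : ℕ) : ENNReal)⁻¹) := by
  rw [sum_fin s hA.1, Finset.sum_congr rfl (fun β _ => core s hA β)]
  simp

open Classical in
/-- law of `g` under the uniform distribution on `E` -/
noncomputable def law {G α : Type} (a : α) (E : Finset G) (g : G → α) : PMF α :=
  if h : E.Nonempty then (PMF.uniformOfFinset E h).map g else PMF.pure a

open Classical in
lemma law_core {m : ℕ} {α : Type} (a : α) (s : Fin m → ℕ) {A : Set (Om m)} (hA : Ind s A)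
    (E : Finset (Fin m → Bool)) (g : (Fin m → Bool) → α) (w : α) :
    mu m (A ∩ {ω | (fun r => ω (s r, r)) ∈ E ∧ g (fun r => ω (s r, r)) = w}) =
      mu m (A ∩ {ω | (fun r => ω (s r, r)) ∈ E}) * law a E g w := by
  by_cases h : E.Nonempty
  · have : {ω : Om m | (fun r => ω (s r, r)) ∈ E ∧ g (fun r => ω (s r, r)) = w} =
      {ω : Om m | (fun r => ω (s r, r)) ∈ E.filter (fun β => g β = w)} := by
      ext ω; simp
    rw [this, core_fin s hA, core_fin s hA, law, dif_pos h, PMF.map_apply, tsum_fintype]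
    have h2 : ∀ β, (if w = g β then PMF.uniformOfFinset E h β else 0) =
        if β ∈ E.filter (fun β => g β = w) then (E.card : ENNReal)⁻¹ else 0 := by
      intro β
      rw [PMF.uniformOfFinset_apply]
      by_cases h1 : β ∈ E <;> by_cases h2 : g β = w <;> simp [h1, h2, eq_comm]
    rw [Finset.sum_congr rfl (fun β _ => h2 β), Finset.sum_ite_mem, Finset.univ_inter,
      Finset.sum_const, nsmul_eq_mul]
    have hc : (E.card : ENNReal) * (E.card : ENNReal)⁻¹ = 1 := by
      apply ENNReal.mul_inv_cancel
      · simpa using h.ne_empty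
      · simp
    calc _ = (E.card * (E.card : ENNReal)⁻¹) * (((E.filter (fun β => g β = w)).card : ENNReal) *
          (mu m A * ((2 ^ m : ℕ) : ENNReal)⁻¹)) := by rw [hc, one_mul]
      _ = _ := by ring
  · rw [Finset.not_nonempty_iff_eq_empty] at h
    subst h
    simp

end AvCoup

namespace AvCoup

/-- integer lift of the positions -/
def Z {m : ℕ} (j t : ℕ) (ω : Om m) : ℤ :=
  ∑ s ∈ Finset.range t, S (fun r => sg (ω (s, r))) + Q (code j) (fun r => ω (t, r))

/-- the vertices -/
abbrev V (d : ℕ) : Type := ZMod (2 ^ (d + 1) + 1)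

/-- position of walker `j` at time `t` -/
def X {d : ℕ} (j t : ℕ) (ω : Om (d + 1)) : V d := ((Z j t ω : ℤ) : V d)

lemma Z_congr {m : ℕ} {j t : ℕ} {ω ω' : Om m} (h : ∀ s < t, ∀ r, ω (s, r) = ω' (s, r))
    (h' : ∀ r, code j r = true → ω (t, r) = ω' (t, r)) : Z j t ω = Z j t ω' := by
  unfold Z
  congr 1
  · apply Finset.sum_congr rfl
    intro s hs
    simp only [h s (Finset.mem_range.1 hs)]
  · unfold Q
    congr 1
    funext r
    split_ifs with hr
    · exact congrArg sg (h' r hr)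
    · rfl

lemma Z_zero {m : ℕ} (t : ℕ) (ω : Om m) :
    Z 0 t ω = ∑ s ∈ Finset.range t, S (fun r => sg (ω (s, r))) := by
  unfold Z; rw [Q_zero, add_zero]

lemma X_eq {d : ℕ} (j t : ℕ) (ω : Om (d + 1)) :
    X j t ω = X 0 t ω + ((Q (code j) (fun r => ω (t, r)) : ℤ) : V d) := by
  unfold X
  rw [Z_zero, ← Int.cast_add]; rfl

lemma X_zero_succ {d : ℕ} (t : ℕ) (ω : Om (d + 1)) :
    X 0 (t + 1) ω = X 0 t ω + ((S (fun r => sg (ω (t, r))) : ℤ) : V d) := by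
  unfold X
  rw [Z_zero, Z_zero, ← Int.cast_add, Finset.sum_range_succ]

lemma Z_meas {m : ℕ} (j t : ℕ) : Measurable (Z j t : Om m → ℤ) := by
  have h : ∀ p : ℕ × Fin m, Measurable (fun ω : Om m => sg (ω p)) := fun p =>
    (measurable_of_finite sg).comp (measurable_pi_apply p)
  unfold Z Q S
  refine Measurable.add ?_ ?_
  · refine Finset.measurable_sum _ fun s _ => Finset.measurable_sum _ fun r _ => ?_
    exact (h _).mul_const _
  · refine Finset.measurable_sum _ fun r _ => ?_
    refine Measurable.mul_const ?_ _
    by_cases hc : code j r = true <;> simp only [hc, if_true, if_false]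
    · exact h _
    · exact measurable_const

lemma X_meas_set {d : ℕ} (j t : ℕ) (v : V d) : MeasurableSet {ω : Om (d + 1) | X j t ω = v} := by
  have : {ω : Om (d + 1) | X j t ω = v} = Z j t ⁻¹' {z : ℤ | (z : V d) = v} := rfl
  rw [this]
  exact Z_meas j t (MeasurableSet.of_discrete)

lemma walk {d : ℕ} (j t : ℕ) (v : ℕ → V d) :
    mu (d + 1) {ω | ∀ s ≤ t + 1, X j s ω = v s} =
      mu (d + 1) {ω | ∀ s ≤ t, X j s ω = v s} *
        (if v (t + 1) = v t then 0 else ((2 ^ (d + 1) : ℕ) : ENNReal)⁻¹) := by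
  let s : Fin (d + 1) → ℕ := fun r => if code j r then t + 1 else t
  have hstep : ∀ ω : Om (d + 1),
      X j (t + 1) ω = X j t ω + ((S (fun r => sg (ω (s r, r))) : ℤ) : V d) := by
    intro ω
    rw [X_eq j (t + 1), X_zero_succ, X_eq j t, add_assoc, add_assoc, ← Int.cast_add,
      ← Int.cast_add]
    congr 2
    unfold Q
    rw [← S_add, ← S_add]
    congr 1
    funext r
    simp only [s]
    split_ifs <;> ring
  have hset : {ω : Om (d + 1) | ∀ s ≤ t + 1, X j s ω = v s} =
      {ω | ∀ s ≤ t, X j s ω = v s} ∩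
        {ω | ((S (fun r => sg (ω (s r, r))) : ℤ) : V d) = v (t + 1) - v t} := by
    ext ω
    simp only [Set.mem_inter_iff, Set.mem_ofPred_eq]
    constructor
    · intro h
      refine ⟨fun u hu => h u (by omega), ?_⟩
      have h1 := h (t + 1) le_rfl
      rw [hstep, h t (by omega)] at h1
      rw [← h1]; ring
    · rintro ⟨h1, h2⟩ u hu
      rcases Nat.lt_or_ge t u with h | h
      · have : u = t + 1 := by omega
        subst this
        rw [hstep, h1 t le_rfl, h2]; ring
      · exact h1 u h
  have hind : Ind s {ω : Om (d + 1) | ∀ s ≤ t, X j s ω = v s} := by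
    constructor
    · simp only [Set.ofPred_forall]
      exact MeasurableSet.iInter fun u => MeasurableSet.iInter fun _ => X_meas_set j u _
    · intro ω ω' h hω u hu
      rw [← hω u hu]
      unfold X
      congr 1
      refine (Z_congr ?_ ?_).symm
      · intro a ha r
        apply h
        simp only [s]
        split_ifs <;> omega
      · intro r hr
        apply h
        simp only [s, hr, if_true]
        omega
  rw [hset]
  split_ifs with hv
  · rw [mul_zero]
    convert measure_empty (μ := mu (d + 1))
    rw [Set.eq_empty_iff_forall_notMem]
    rintro ω ⟨_, h⟩
    simp only [Set.mem_ofPred_eq] at h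
    rw [hv, sub_self] at h
    exact full_ne (by omega) _ h
  · obtain ⟨β, hβ⟩ := full_surj (by omega : 0 < d + 1) (v (t + 1) - v t) (sub_ne_zero.2 hv)
    rw [← core s hind β]
    congr 2
    ext ω
    simp only [Set.mem_ofPred_eq]
    constructor
    · intro h
      rw [← hβ] at h
      exact full_inj _ _ h
    · intro h
      rw [← hβ, ← h]

lemma avoids {d k : ℕ} (hk' : k ≤ 2 ^ d) (ω : Om (d + 1)) :
    (∀ i j : Fin k, i ≠ j → X (d := d) i 0 ω ≠ X j 0 ω) ∧
    (∀ (t : ℕ) (i j : Fin k),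
      (i < j → X (d := d) j (t + 1) ω ≠ X i (t + 1) ω) ∧
      (j < i → X (d := d) j (t + 1) ω ≠ X i t ω)) := by
  have same : ∀ (t : ℕ) (i j : Fin k), i ≠ j → X (d := d) i t ω ≠ X j t ω := by
    intro t i j hij h
    rw [X_eq i, X_eq j] at h
    exact avoid_same (by omega) (by omega) (fun h => hij (Fin.ext h)) _ (add_left_cancel h)
  refine ⟨fun i j h => same 0 i j h, fun t i j => ⟨fun h => same _ _ _ h.ne', fun h h1 => ?_⟩⟩
  rw [X_eq j, X_eq i, X_zero_succ, add_assoc, ← Int.cast_add] at h1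
  exact avoid_next (by omega) h _ _ (add_left_cancel h1)

open Classical in
/-- consistent coins -/
noncomputable def E {d k : ℕ} (hk : 0 < k) (j : Fin k) (conf : Fin k → V d) :
    Finset (Fin (d + 1) → Bool) :=
  Finset.univ.filter fun β => ∀ i : Fin k, (i < j ∨ j.val = 0) →
    conf i = conf ⟨0, hk⟩ + ((Q (code i) β : ℤ) : V d)

/-- the next position as a function of the coins -/
def nxt {d k : ℕ} (hk : 0 < k) (j : Fin k) (conf : Fin k → V d) (β : Fin (d + 1) → Bool) : V d :=
  conf ⟨0, hk⟩ + (((if j.val = 0 then S (fun r => sg (β r)) else Q (code j) β) : ℤ) : V d)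

lemma markov {d k : ℕ} (hk : 0 < k) (t : ℕ) (j : Fin k) (v : Fin k → ℕ → V d) (w : V d) :
    mu (d + 1) {ω | ((∀ i : Fin k, ∀ s ≤ t, X i s ω = v i s) ∧
              (∀ i < j, X i (t + 1) ω = v i (t + 1))) ∧ X j (t + 1) ω = w} =
        mu (d + 1) {ω | (∀ i : Fin k, ∀ s ≤ t, X i s ω = v i s) ∧
               (∀ i < j, X i (t + 1) ω = v i (t + 1))} *
          law (0 : V d) (E hk j (fun i => if i < j then v i (t + 1) else v i t))
            (nxt hk j (fun i => if i < j then v i (t + 1) else v i t)) w := by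
  set z : Fin k := ⟨0, hk⟩ with hz
  by_cases hj : j.val = 0
  · have hnl : ∀ i : Fin k, ¬ i < j := fun i h => by
      have : i.val < j.val := h
      omega
    have hjz : j = z := Fin.ext hj
    let A : Set (Om (d + 1)) := {ω | (∀ i : Fin k, ∀ s < t, X i s ω = v i s) ∧ X 0 t ω = v z t}
    have hA : Ind (fun _ => t) A := by
      constructor
      · have h1 : MeasurableSet {ω : Om (d + 1) | ∀ i : Fin k, ∀ s < t, X i s ω = v i s} := by
          simp only [Set.ofPred_forall]
          exact MeasurableSet.iInter fun i => MeasurableSet.iInter fun u =>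
            MeasurableSet.iInter fun _ => X_meas_set i u _
        exact h1.inter (X_meas_set 0 t _)
      · rintro ω ω' h ⟨h1, h2⟩
        constructor
        · intro i u hu
          rw [← h1 i u hu]
          unfold X
          congr 1
          refine (Z_congr (fun a ha r => h _ ?_) (fun r _ => h _ ?_)).symm <;> dsimp only <;> omega
        · rw [← h2]
          unfold X
          congr 1
          refine (Z_congr (fun a ha r => h _ ?_) (fun r hr => ?_)).symm
          · dsimp only; omega
          · simp [code_zero] at hr
    have hH : ∀ ω : Om (d + 1), ((∀ i : Fin k, ∀ s ≤ t, X i s ω = v i s) ∧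
        (∀ i < j, X i (t + 1) ω = v i (t + 1))) ↔ ω ∈ A ∧ (fun r => ω (t, r)) ∈
          E hk j (fun i => if i < j then v i (t + 1) else v i t) := by
      intro ω
      simp only [E, hnl, if_false, hj, Finset.mem_filter, Finset.mem_univ, true_and, A,
        Set.mem_ofPred_eq, ← hz, false_or, true_implies, false_implies, implies_true, and_true]
      constructor
      · intro h
        have h0 : X 0 t ω = v z t := h z t le_rfl
        refine ⟨⟨fun i u hu => h i u hu.le, h0⟩, fun i => ?_⟩
        rw [← h i t le_rfl, ← h0, X_eq]
      · rintro ⟨⟨h1, h2⟩, h3⟩ i u hu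
        rcases Nat.lt_or_ge u t with hut | hut
        · exact h1 i u hut
        · have : u = t := by omega
          subst this
          rw [h3, X_eq, h2]
    have := law_core (0 : V d) (fun _ => t) hA
      (E hk j (fun i => if i < j then v i (t + 1) else v i t))
      (nxt hk j (fun i => if i < j then v i (t + 1) else v i t)) w
    convert this using 2
    · ext ω
      simp only [Set.mem_ofPred_eq, Set.mem_inter_iff]
      rw [hH, and_assoc]
      apply and_congr_right
      intro hA'
      apply and_congr_right
      intro _
      have h0 : X 0 t ω = v z t := hA'.2
      simp only [nxt, hj, if_true, hnl, if_false, ← hz]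
      rw [X_zero_succ, h0]
    · congr 1
      ext ω
      simp only [Set.mem_ofPred_eq, Set.mem_inter_iff]
      rw [hH]
  · have hzj : z < j := by
      show z.val < j.val
      simp [hz]; omega
    let A : Set (Om (d + 1)) := {ω | (∀ i : Fin k, ∀ s ≤ t, X i s ω = v i s) ∧
      X 0 (t + 1) ω = v z (t + 1)}
    have hA : Ind (fun _ => t + 1) A := by
      constructor
      · have h1 : MeasurableSet {ω : Om (d + 1) | ∀ i : Fin k, ∀ s ≤ t, X i s ω = v i s} := by
          simp only [Set.ofPred_forall]
          exact MeasurableSet.iInter fun i => MeasurableSet.iInter fun u =>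
            MeasurableSet.iInter fun _ => X_meas_set i u _
        exact h1.inter (X_meas_set 0 (t + 1) _)
      · rintro ω ω' h ⟨h1, h2⟩
        constructor
        · intro i u hu
          rw [← h1 i u hu]
          unfold X
          congr 1
          refine (Z_congr (fun a ha r => h _ ?_) (fun r _ => h _ ?_)).symm <;> dsimp only <;> omega
        · rw [← h2]
          unfold X
          congr 1
          refine (Z_congr (fun a ha r => h _ ?_) (fun r hr => ?_)).symm
          · dsimp only; omega
          · simp [code_zero] at hr
    have hH : ∀ ω : Om (d + 1), ((∀ i : Fin k, ∀ s ≤ t, X i s ω = v i s) ∧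
        (∀ i < j, X i (t + 1) ω = v i (t + 1))) ↔ ω ∈ A ∧ (fun r => ω (t + 1, r)) ∈
          E hk j (fun i => if i < j then v i (t + 1) else v i t) := by
      intro ω
      simp only [E, hj, Finset.mem_filter, Finset.mem_univ, true_and, A,
        Set.mem_ofPred_eq, ← hz, or_false, hzj, if_true]
      constructor
      · rintro ⟨h, h'⟩
        have h0 : X 0 (t + 1) ω = v z (t + 1) := h' z hzj
        refine ⟨⟨h, h0⟩, fun i hi => ?_⟩
        rw [if_pos hi, ← h' i hi, ← h0, X_eq]
      · rintro ⟨⟨h1, h2⟩, h3⟩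
        refine ⟨h1, fun i hi => ?_⟩
        have := h3 i hi
        rw [if_pos hi] at this
        rw [this, X_eq, h2]
    have := law_core (0 : V d) (fun _ => t + 1) hA
      (E hk j (fun i => if i < j then v i (t + 1) else v i t))
      (nxt hk j (fun i => if i < j then v i (t + 1) else v i t)) w
    convert this using 2
    · ext ω
      simp only [Set.mem_ofPred_eq, Set.mem_inter_iff]
      rw [hH, and_assoc]
      apply and_congr_right
      intro hA'
      apply and_congr_right
      intro _
      have h0 : X 0 (t + 1) ω = v z (t + 1) := hA'.2
      simp only [nxt, hj, if_false, ← hz, hzj, if_true]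
      rw [X_eq, h0]
    · congr 1
      ext ω
      simp only [Set.mem_ofPred_eq, Set.mem_inter_iff]
      rw [hH]

end AvCoup

/-- For every `d ≥ 1` and every `k` with `1 ≤ k ≤ 2^d`, there is a Markovian
avoidance coupling of `k` walkers on the loopless complete graph `K_n` for
`n = 2^(d+1) + 1`. -/
theorem markovian_avoidance_coupling_loopless_powers_of_two
    (d k : ℕ) (hd : 1 ≤ d) (hk : 1 ≤ k) (hk' : k ≤ 2 ^ d) :
    MarkovianAvoidanceCouplingLoopless (2 ^ (d + 1) + 1) k := by
  refine ⟨AvCoup.Om (d + 1), inferInstance, AvCoup.mu (d + 1),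
    fun j t ω => AvCoup.X (d := d) j t ω, inferInstance, ?_, ?_, ?_, ?_⟩
  · intro j t
    refine measurable_to_countable' fun v => ?_
    exact AvCoup.X_meas_set (d := d) j t v
  · intro j t v
    exact AvCoup.walk (d := d) j t v
  · exact Filter.Eventually.of_forall fun ω => AvCoup.avoids hk' ω
  · exact ⟨fun j conf => AvCoup.law (0 : AvCoup.V d) (AvCoup.E (d := d) hk j conf)
      (AvCoup.nxt (d := d) hk j conf), fun t j v w => AvCoup.markov (d := d) hk t j v w⟩
end

section
/- For all integers n ≥ 2 and k ≥ 1 with 4k ≤ n, there exists an avoidance coupling of k walkers on the looped complete graph K_n^*. -/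
open MeasureTheory ProbabilityTheory

namespace AvoidQuarter

/-- index of the block of `v`: blocks are `{2i, 2i+1}`, the last one has three elements if `n` is odd -/
def blk (n v : ℕ) : ℕ := min (v / 2) (n / 2 - 1)

/-- size of block `i` -/
def siz (n i : ℕ) : ℕ := if i + 1 = n / 2 then 2 + n % 2 else 2

lemma siz_cases (n i : ℕ) : siz n i = 2 ∨ siz n i = 3 := by
  unfold siz; split_ifs <;> omega

lemma siz_pos (n i : ℕ) : 0 < siz n i := by
  rcases siz_cases n i with h | h <;> omega

lemma blk_eq_iff {n i v : ℕ} (hn : 4 ≤ n) (hi : i + 1 ≤ n / 2) (hv : v < n) :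
    blk n v = i ↔ 2 * i ≤ v ∧ v < 2 * i + siz n i := by
  unfold blk siz; split_ifs <;> omega

lemma blk_lt {n v : ℕ} (hn : 4 ≤ n) : blk n v + 1 ≤ n / 2 := by
  unfold blk; omega

lemma pos_lt {n i x : ℕ} (hi : i + 1 ≤ n / 2) : 2 * i + x % siz n i < n := by
  have := Nat.mod_lt x (siz_pos n i)
  unfold siz at *; split_ifs at * <;> omega

/-- block of walker `w` at time `t` -/
def sig {n k : ℕ} (hkn : 4 * k ≤ n) (u : ℕ → Fin n) (t : ℕ) (w : Fin k) : ℕ :=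
  blk n (u t + (⟨4 * w, by omega⟩ : Fin n) : Fin n)

lemma sig_inj {n k : ℕ} (hkn : 4 * k ≤ n) (u : ℕ → Fin n) (t : ℕ) (w w' : Fin k)
    (h : sig hkn u t w = sig hkn u t w') : w = w' := by
  unfold sig blk at h
  rw [Fin.val_add_eq_ite, Fin.val_add_eq_ite] at h
  have := (u t).2
  have := w.2
  have := w'.2
  ext
  simp only at h
  split_ifs at h <;> omega

/-- the link in block `i` from time `t` to time `t+1` is active -/
def act {n k : ℕ} (hkn : 4 * k ≤ n) (u : ℕ → Fin n) (t i : ℕ) : Prop :=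
  ∃ w w' : Fin k, w < w' ∧ sig hkn u t w' = i ∧ sig hkn u (t + 1) w = i

open Classical in
/-- position inside block `i` at time `t` -/
noncomputable def pos {n k : ℕ} (hkn : 4 * k ≤ n) (u : ℕ → Fin n) (r : ℕ × ℕ → Fin 6) : ℕ → ℕ → ℕ
  | 0, i => r (0, i)
  | t + 1, i => if act hkn u t i then pos hkn u r t i + 1 else r (t + 1, i)

open Classical in
/-- start time of the chain -/
noncomputable def tau {n k : ℕ} (hkn : 4 * k ≤ n) (u : ℕ → Fin n) : ℕ → ℕ → ℕ
  | 0, _ => 0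
  | t + 1, i => if act hkn u t i then tau hkn u t i else t + 1

lemma tau_le {n k : ℕ} (hkn : 4 * k ≤ n) (u : ℕ → Fin n) (t i : ℕ) : tau hkn u t i ≤ t := by
  induction t with
  | zero => simp [tau]
  | succ t ih => unfold tau; split_ifs <;> omega

lemma pos_eq {n k : ℕ} (hkn : 4 * k ≤ n) (u : ℕ → Fin n) (r : ℕ × ℕ → Fin 6) (t i : ℕ) :
    pos hkn u r t i = r (tau hkn u t i, i) + (t - tau hkn u t i) := by
  induction t with
  | zero => simp [tau, pos]
  | succ t ih =>
    have := tau_le hkn u t i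
    unfold tau pos; split_ifs
    · omega
    · simp

lemma tau_dec {n k : ℕ} (hkn : 4 * k ≤ n) (u : ℕ → Fin n) (i s d : ℕ) (w w' : Fin k)
    (hw : sig hkn u s w = i) (hw' : sig hkn u (s + d + 1) w' = i)
    (h : tau hkn u (s + d + 1) i ≤ s) : w' < w := by
  induction d generalizing w' with
  | zero =>
    unfold tau at h
    split_ifs at h with ha
    · obtain ⟨a, b, hab, hb, ha⟩ := ha
      have h1 := sig_inj hkn u _ b w (hb.trans hw.symm)
      have h2 := sig_inj hkn u _ a w' (ha.trans hw'.symm)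
      subst h1 h2; exact hab
    · omega
  | succ d ih =>
    unfold tau at h
    split_ifs at h with ha
    · obtain ⟨a, b, hab, hb, ha⟩ := ha
      have h1 := ih b hb h
      have h2 := sig_inj hkn u _ a w' (ha.trans hw'.symm)
      subst h2; exact hab.trans h1
    · omega

lemma tau_inj {n k : ℕ} (hkn : 4 * k ≤ n) (u : ℕ → Fin n) (w : Fin k) :
    Function.Injective (fun s => (tau hkn u s (sig hkn u s w), sig hkn u s w)) := by
  have key : ∀ s s', s < s' → (tau hkn u s (sig hkn u s w), sig hkn u s w) ≠
      (tau hkn u s' (sig hkn u s' w), sig hkn u s' w) := by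
    intro s s' hs h
    rw [Prod.mk.injEq] at h
    obtain ⟨h1, h2⟩ := h
    obtain ⟨d, rfl⟩ : ∃ d, s' = s + d + 1 := ⟨s' - s - 1, by omega⟩
    have := tau_le hkn u s (sig hkn u s w)
    exact lt_irrefl _ (tau_dec hkn u _ s d w w h2 rfl (by omega))
  intro s s' h
  rcases lt_trichotomy s s' with h' | h' | h'
  · exact absurd h (key _ _ h')
  · exact h'
  · exact absurd h.symm (key _ _ h')

lemma sig_lt {n k : ℕ} (hkn : 4 * k ≤ n) (u : ℕ → Fin n) (t : ℕ) (w : Fin k) :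
    sig hkn u t w + 1 ≤ n / 2 := blk_lt (by have := w.2; omega)

/-- the walkers -/
noncomputable def walk {n k : ℕ} (hkn : 4 * k ≤ n) (w : Fin k) (t : ℕ)
    (ω : (ℕ → Fin n) × (ℕ × ℕ → Fin 6)) : Fin n :=
  ⟨2 * sig hkn ω.1 t w + pos hkn ω.1 ω.2 t (sig hkn ω.1 t w) % siz n (sig hkn ω.1 t w),
    pos_lt (sig_lt hkn _ t w)⟩

lemma blk_walk {n k : ℕ} (hkn : 4 * k ≤ n) (w : Fin k) (t : ℕ)
    (ω : (ℕ → Fin n) × (ℕ × ℕ → Fin 6)) : blk n (walk hkn w t ω) = sig hkn ω.1 t w := by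
  have := w.2
  rw [blk_eq_iff (by omega) (sig_lt hkn _ t w) (Fin.is_lt _)]
  have := Nat.mod_lt (pos hkn ω.1 ω.2 t (sig hkn ω.1 t w)) (siz_pos n (sig hkn ω.1 t w))
  simp only [walk]; omega

lemma walk_ne {n k : ℕ} (hkn : 4 * k ≤ n) (i j : Fin k) (hij : i ≠ j) (t : ℕ)
    (ω : (ℕ → Fin n) × (ℕ × ℕ → Fin 6)) : walk hkn i t ω ≠ walk hkn j t ω := by
  intro h
  apply hij
  apply sig_inj hkn ω.1 t
  rw [← blk_walk, ← blk_walk, h]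

lemma walk_ne' {n k : ℕ} (hkn : 4 * k ≤ n) (i j : Fin k) (hij : j < i) (t : ℕ)
    (ω : (ℕ → Fin n) × (ℕ × ℕ → Fin 6)) : walk hkn j (t + 1) ω ≠ walk hkn i t ω := by
  intro h
  have hs : sig hkn ω.1 (t + 1) j = sig hkn ω.1 t i := by
    rw [← blk_walk, ← blk_walk, h]
  have ha : act hkn ω.1 t (sig hkn ω.1 t i) := ⟨j, i, hij, rfl, hs⟩
  have hval := congrArg Fin.val h
  simp only [walk] at hval
  rw [hs, pos, if_pos ha] at hval
  rcases siz_cases n (sig hkn ω.1 t i) with h2 | h2 <;> rw [h2] at hval <;> omega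

/-- uniform measure -/
noncomputable def unif (m : ℕ) [NeZero m] : Measure (Fin m) :=
  (PMF.uniformOfFintype (Fin m)).toMeasure

instance (m : ℕ) [NeZero m] : IsProbabilityMeasure (unif m) := by
  unfold unif; infer_instance

lemma unif_apply (m : ℕ) [NeZero m] (p : Fin m → Prop) [DecidablePred p] :
    unif m {x | p x} = ((Finset.univ.filter p).card : ENNReal) / m := by
  unfold unif
  rw [PMF.toMeasure_uniformOfFintype_apply _ (MeasurableSet.of_discrete)]
  simp [Fintype.card_subtype]

lemma unif_blk {n : ℕ} [NeZero n] (hn : 4 ≤ n) (c : Fin n) (i : ℕ) (hi : i + 1 ≤ n / 2) :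
    unif n {x | blk n (x + c : Fin n) = i} = (siz n i : ENNReal) / n := by
  rw [unif_apply]
  congr 2
  have h1 : (Finset.univ.filter (fun x : Fin n => blk n (x + c : Fin n) = i)).card =
      (Finset.Ico (2 * i) (2 * i + siz n i)).card := by
    refine Finset.card_bij (fun x _ => ((x + c : Fin n) : ℕ)) ?_ ?_ ?_
    · intro a ha
      rw [Finset.mem_filter] at ha
      rw [Finset.mem_Ico]
      exact (blk_eq_iff hn hi (Fin.is_lt _)).1 ha.2
    · intro a _ b _ h
      exact add_right_cancel (Fin.ext h)
    · intro b hb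
      rw [Finset.mem_Ico] at hb
      have hbn : b < n := by
        have h2 := hb.2
        unfold siz at h2; split_ifs at h2 <;> omega
      refine ⟨⟨b, hbn⟩ - c, ?_, by simp⟩
      simp only [Finset.mem_filter, Finset.mem_univ, true_and, sub_add_cancel]
      exact (blk_eq_iff hn hi hbn).2 hb
  rw [h1]; simp

lemma unif_six (s o c : ℕ) (hs : s = 2 ∨ s = 3) (hc : c < s) :
    unif 6 {x | ((x : ℕ) + o) % s = c} = (s : ENNReal)⁻¹ := by
  rw [unif_apply]
  have h : (Finset.univ.filter (fun x : Fin 6 => ((x : ℕ) + o) % s = c)).card = 6 / s := by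
    have ho : o % s < s := Nat.mod_lt _ (by omega)
    have : ∀ x : Fin 6, ((x : ℕ) + o) % s = ((x : ℕ) + o % s) % s := by intro x; simp
    simp only [this]
    generalize o % s = q at ho
    rcases hs with rfl | rfl <;> interval_cases q <;> interval_cases c <;> decide
  rw [h]
  rcases hs with rfl | rfl
  · rw [show ((6 / 2 : ℕ) : ENNReal) = 3 by norm_num,
      ENNReal.div_eq_inv_mul, show ((6 : ℕ) : ENNReal) = 2 * 3 by norm_num, ENNReal.mul_inv (by simp) (by simp), mul_assoc,
      ENNReal.inv_mul_cancel (by simp) (by simp)]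
    simp
  · rw [show ((6 / 3 : ℕ) : ENNReal) = 2 by norm_num,
      ENNReal.div_eq_inv_mul, show ((6 : ℕ) : ENNReal) = 3 * 2 by norm_num, ENNReal.mul_inv (by simp) (by simp), mul_assoc,
      ENNReal.inv_mul_cancel (by simp) (by simp)]
    simp

lemma pi_inj {ι : Type} (m : ℕ) [NeZero m] (g : ℕ → ι) (hg : Function.Injective g)
    (A : ℕ → Set (Fin m)) (T : ℕ) :
    (Measure.infinitePi (fun _ : ι => unif m)) {r | ∀ s ≤ T, r (g s) ∈ A s} =
      ∏ s ∈ Finset.range (T + 1), unif m (A s) := by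
  classical
  have h := Measure.infinitePi_pi (fun _ : ι => unif m) (s := (Finset.range (T + 1)).image g)
    (t := fun i => A (Function.invFun g i)) (fun _ _ => MeasurableSet.of_discrete)
  rw [Finset.prod_image (fun a _ b _ h => hg h)] at h
  simp only [Function.leftInverse_invFun hg _] at h
  rw [← h]
  congr 1
  ext r
  simp [Set.mem_pi, Function.leftInverse_invFun hg _]

lemma meas_pos {n k : ℕ} (hkn : 4 * k ≤ n) (t i : ℕ) :
    Measurable (fun ω : (ℕ → Fin n) × (ℕ × ℕ → Fin 6) => pos hkn ω.1 ω.2 t i) := by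
  classical
  have hr : ∀ q, Measurable (fun ω : (ℕ → Fin n) × (ℕ × ℕ → Fin 6) => ((ω.2 q : Fin 6) : ℕ)) := by
    intro q
    exact (measurable_of_countable (fun x : Fin 6 => (x : ℕ))).comp
      ((measurable_pi_apply q).comp measurable_snd)
  induction t with
  | zero => exact hr _
  | succ t ih =>
    have hset : MeasurableSet {ω : (ℕ → Fin n) × (ℕ × ℕ → Fin 6) | act hkn ω.1 t i} := by
      have hf : Measurable (fun ω : (ℕ → Fin n) × (ℕ × ℕ → Fin 6) => (ω.1 t, ω.1 (t + 1))) := by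
        fun_prop
      exact hf (t := {p : Fin n × Fin n | ∃ w w' : Fin k, w < w' ∧
        blk n (p.1 + (⟨4 * w', by omega⟩ : Fin n) : Fin n) = i ∧
        blk n (p.2 + (⟨4 * w, by omega⟩ : Fin n) : Fin n) = i}) MeasurableSet.of_discrete
    exact Measurable.ite hset (ih.add_const 1) (hr _)

lemma meas_sig {n k : ℕ} (hkn : 4 * k ≤ n) (t : ℕ) (w : Fin k) :
    Measurable (fun u : ℕ → Fin n => sig hkn u t w) :=
  (measurable_of_countable (fun x : Fin n =>
    blk n (x + (⟨4 * w, by omega⟩ : Fin n) : Fin n))).comp (measurable_pi_apply t)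

lemma meas_walk {n k : ℕ} (hkn : 4 * k ≤ n) (w : Fin k) (t : ℕ) : Measurable (walk hkn w t) := by
  have h1 : Measurable (fun q : ((ℕ → Fin n) × (ℕ × ℕ → Fin 6)) × ℕ =>
      pos hkn q.1.1 q.1.2 t q.2) :=
    measurable_from_prod_countable_left (fun i => meas_pos hkn t i)
  have h2 : Measurable (fun ω : (ℕ → Fin n) × (ℕ × ℕ → Fin 6) => sig hkn ω.1 t w) :=
    (meas_sig hkn t w).comp measurable_fst
  have h3 := h1.comp (measurable_id.prodMk h2)
  have h4 : Measurable (fun ω => ((walk hkn w t ω : Fin n) : ℕ)) :=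
    (measurable_of_countable (fun q : ℕ × ℕ => 2 * q.1 + q.2 % siz n q.1)).comp (h2.prodMk h3)
  refine measurable_to_countable' (fun x => ?_)
  have : walk hkn w t ⁻¹' {x} = (fun ω => ((walk hkn w t ω : Fin n) : ℕ)) ⁻¹' {(x : ℕ)} := by
    ext ω; simp [Fin.ext_iff]
  rw [this]
  exact h4 MeasurableSet.of_discrete

lemma walk_prob {n k : ℕ} [NeZero n] (hkn : 4 * k ≤ n) (w : Fin k) (T : ℕ) (v : ℕ → Fin n) :
    ((Measure.infinitePi (fun _ : ℕ => unif n)).prod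
      (Measure.infinitePi (fun _ : ℕ × ℕ => unif 6))) {ω | ∀ s ≤ T, walk hkn w s ω = v s} =
      ((n : ENNReal)⁻¹) ^ (T + 1) := by
  classical
  have hn : 4 ≤ n := by have := w.2; omega
  have hmeas : MeasurableSet {ω | ∀ s ≤ T, walk hkn w s ω = v s} := by
    simp only [Set.ofPred_forall]
    exact MeasurableSet.iInter fun s => MeasurableSet.iInter fun _ =>
      meas_walk hkn w s (measurableSet_singleton (v s))
  rw [Measure.prod_apply hmeas]
  set B : Set (ℕ → Fin n) := {u | ∀ s ≤ T, u s ∈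
    {x : Fin n | blk n (x + (⟨4 * w, by omega⟩ : Fin n) : Fin n) = blk n (v s)}} with hB
  have hBm : MeasurableSet B := by
    simp only [hB, Set.ofPred_forall]
    exact MeasurableSet.iInter fun s => MeasurableSet.iInter fun _ =>
      measurable_pi_apply s MeasurableSet.of_discrete
  have hint : ∀ u, (Measure.infinitePi (fun _ : ℕ × ℕ => unif 6))
      (Prod.mk u ⁻¹' {ω | ∀ s ≤ T, walk hkn w s ω = v s}) =
      B.indicator (fun _ => ∏ s ∈ Finset.range (T + 1), ((siz n (blk n (v s)) : ℕ) : ENNReal)⁻¹) u := by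
    intro u
    by_cases hu : u ∈ B
    · rw [Set.indicator_of_mem hu]
      have hsig : ∀ s ≤ T, sig hkn u s w = blk n (v s) := fun s hs => hu s hs
      have := pi_inj 6 _ (tau_inj hkn u w) (fun s => {x : Fin 6 |
        ((x : ℕ) + (s - tau hkn u s (sig hkn u s w))) % siz n (blk n (v s)) =
          (v s : ℕ) - 2 * blk n (v s)}) T
      have hset : (Prod.mk u ⁻¹' {ω | ∀ s ≤ T, walk hkn w s ω = v s}) =
        {r | ∀ s ≤ T, r (tau hkn u s (sig hkn u s w), sig hkn u s w) ∈ {x : Fin 6 |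
        ((x : ℕ) + (s - tau hkn u s (sig hkn u s w))) % siz n (blk n (v s)) =
          (v s : ℕ) - 2 * blk n (v s)}} := by
        ext r
        simp only [Set.mem_preimage, Set.mem_ofPred_eq]
        refine forall_congr' fun s => forall_congr' fun hs => ?_
        have hb := (blk_eq_iff hn (blk_lt hn) (v s).2).1 rfl
        rw [← hsig s hs] at hb ⊢
        rw [← pos_eq, Fin.ext_iff]
        simp only [walk]
        omega
      rw [hset, this]
      refine Finset.prod_congr rfl fun s hs => ?_
      have hb := (blk_eq_iff hn (blk_lt hn) (v s).2).1 rfl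
      exact unif_six _ _ _ (siz_cases _ _) (by omega)
    · rw [Set.indicator_of_notMem hu]
      have : (Prod.mk u ⁻¹' {ω | ∀ s ≤ T, walk hkn w s ω = v s}) = ∅ := by
        ext r
        simp only [Set.mem_preimage, Set.mem_ofPred_eq, Set.mem_empty_iff_false, iff_false]
        intro h
        refine hu fun s hs => ?_
        have := blk_walk hkn w s (u, r)
        rw [h s hs] at this
        exact this.symm
      rw [this]; simp
  simp only [hint]
  rw [lintegral_indicator_const hBm, hB, pi_inj n (fun s => s) Function.injective_id,
    ← Finset.prod_mul_distrib, Finset.prod_congr rfl (g := fun _ => (n : ENNReal)⁻¹)]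
  · simp
  · intro s _
    rw [unif_blk hn _ _ (blk_lt hn), ENNReal.div_eq_inv_mul, mul_comm, mul_assoc,
      ENNReal.mul_inv_cancel (by exact_mod_cast (siz_pos _ _).ne') (by simp), mul_one]

end AvoidQuarter

/-- For all `n ≥ 2` and `k ≥ 1` with `4 * k ≤ n`, there is an avoidance
coupling of `k` walkers on the looped complete graph `K_n^*`. -/
theorem avoidance_coupling_looped_quarter (n k : ℕ) (hn : 2 ≤ n) (hk : 1 ≤ k)
    (hkn : 4 * k ≤ n) : AvoidanceCouplingLooped n k := by
  have : NeZero n := ⟨by omega⟩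
  refine ⟨(ℕ → Fin n) × (ℕ × ℕ → Fin 6), inferInstance,
    (Measure.infinitePi (fun _ : ℕ => AvoidQuarter.unif n)).prod
      (Measure.infinitePi (fun _ : ℕ × ℕ => AvoidQuarter.unif 6)),
    AvoidQuarter.walk hkn, inferInstance, AvoidQuarter.meas_walk hkn, ?_, ?_⟩
  · intro j t v
    rw [AvoidQuarter.walk_prob, AvoidQuarter.walk_prob, pow_succ]
  · refine Filter.Eventually.of_forall fun ω => ⟨fun i j hij => AvoidQuarter.walk_ne hkn i j hij 0 ω,
      fun t i j => ⟨fun h => AvoidQuarter.walk_ne hkn j i h.ne' _ ω,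
        fun h => AvoidQuarter.walk_ne' hkn i j h t ω⟩⟩
end
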